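/- Let Λ ⊂ ℕ and let p₁, …, p_k be rationally independent integer polynomials with p_i(0) = 0 for i = 1, …, k. Then for every ε > 0, the set {n ∈ ℕ : d̄(Λ ∩ (Λ + p₁(n)) ∩ ⋯ ∩ (Λ + p_k(n))) ≥ d̄(Λ)^{k+1} − ε} is syndetic. -/

import Mathlib

open MeasureTheory Filter Finset

/-- An integer polynomial: a function `ℤ → ℤ` given by a polynomial (with rational
coefficients) taking integer values on the integers. -/
def IsIntPoly (p : ℤ → ℤ) : Prop :=
  ∃ q : Polynomial ℚ, ∀ n : ℤ, q.eval (n : ℚ) = (p n : ℚ)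

/-- Rational independence: every nontrivial integer linear combination is nonconstant. -/
def RatIndep {k : ℕ} (p : Fin k → ℤ → ℤ) : Prop :=
  ∀ c : Fin k → ℤ, c ≠ 0 → ¬ ∃ C : ℤ, ∀ n : ℤ, (∑ i, c i * p i n) = C

/-- A set of natural numbers is syndetic if for some `M`, every interval of length
greater than `M` meets the set. -/
def Syndetic (S : Set ℕ) : Prop :=
  ∃ M : ℕ, ∀ a : ℕ, ∃ n ∈ S, a ≤ n ∧ n ≤ a + M

open Classical in
/-- The upper density `d̄(Λ) = limsup_{N→∞} |Λ ∩ [1,N]| / N`. -/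
noncomputable def upperDensity (Λ : Set ℕ) : ℝ :=
  Filter.limsup (fun N : ℕ => (((Finset.Icc 1 N).filter (fun m => m ∈ Λ)).card : ℝ) / N)
    Filter.atTop

/-- The shift `Λ + m = {x + m : x ∈ Λ}`, viewed inside `ℕ`. -/
def shiftSet (Λ : Set ℕ) (m : ℤ) : Set ℕ := {x : ℕ | ∃ y ∈ Λ, (x : ℤ) = (y : ℤ) + m}

namespace PolyConfig

/-! ### Invariant means on `ℤ` -/

/-- A shift-invariant mean on `ℤ`, extended linearly to all functions. -/
structure IsMean (m : (ℤ → ℂ) →ₗ[ℂ] ℂ) : Prop where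
  one : m (fun _ => 1) = 1
  norm_le : ∀ (F : ℤ → ℂ) (C : ℝ), (∀ n, ‖F n‖ ≤ C) → ‖m F‖ ≤ C
  shift : ∀ (F : ℤ → ℂ) (C : ℝ) (k : ℤ), (∀ n, ‖F n‖ ≤ C) → m (fun n => F (n + k)) = m F
  re_nonneg : ∀ (F : ℤ → ℂ) (C : ℝ), (∀ n, ‖F n‖ ≤ C) → (∀ n, 0 ≤ (F n).re) → 0 ≤ (m F).re

/-- The average of `F` over the interval `[a, a + L)`. -/
noncomputable def intervalAvg (a : ℤ) (L : ℕ) (F : ℤ → ℂ) : ℂ :=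
  (∑ i ∈ range L, F (a + i)) / L

lemma norm_intervalAvg_le {a : ℤ} {L : ℕ} {F : ℤ → ℂ} {C : ℝ} (hC : 0 ≤ C)
    (h : ∀ n, ‖F n‖ ≤ C) : ‖intervalAvg a L F‖ ≤ C := by
  unfold intervalAvg
  rcases Nat.eq_zero_or_pos L with rfl | hL
  · simpa using hC
  rw [norm_div, Complex.norm_natCast, div_le_iff₀ (by positivity)]
  calc _ ≤ ∑ i ∈ range L, ‖F (a + i)‖ := norm_sum_le _ _
    _ ≤ ∑ i ∈ range L, C := sum_le_sum fun i _ => h _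
    _ = C * L := by simp [mul_comm]

lemma intervalAvg_shift_one_sub {a : ℤ} {L : ℕ} {F : ℤ → ℂ} {C : ℝ}
    (h : ∀ n, ‖F n‖ ≤ C) :
    ‖intervalAvg a L (fun n => F (n + 1)) - intervalAvg a L F‖ ≤ 2 * C / L := by
  unfold intervalAvg
  have h1 : (∑ i ∈ range L, F (a + i + 1)) - ∑ i ∈ range L, F (a + i) = F (a + L) - F a := by
    rw [← sum_sub_distrib]
    have := Finset.sum_range_sub (fun i : ℕ => F (a + i)) L
    simpa [add_assoc] using this
  rw [← sub_div, h1, norm_div, Complex.norm_natCast]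
  gcongr
  calc _ ≤ ‖F (a + L)‖ + ‖F a‖ := norm_sub_le _ _
    _ ≤ _ := by linarith [h (a + L), h a]

lemma intervalAvg_add {a : ℤ} {L : ℕ} (F G : ℤ → ℂ) :
    intervalAvg a L (F + G) = intervalAvg a L F + intervalAvg a L G := by
  simp [intervalAvg, sum_add_distrib, add_div]

lemma intervalAvg_smul {a : ℤ} {L : ℕ} (c : ℂ) (F : ℤ → ℂ) :
    intervalAvg a L (c • F) = c * intervalAvg a L F := by
  simp [intervalAvg, mul_div_assoc, ← mul_sum]

/-- The submodule of bounded functions. -/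
def boundedFun : Submodule ℂ (ℤ → ℂ) where
  carrier := {F | ∃ C, ∀ n, ‖F n‖ ≤ C}
  zero_mem' := ⟨0, by simp⟩
  add_mem' := by
    rintro F G ⟨C, hC⟩ ⟨D, hD⟩
    exact ⟨C + D, fun n => (norm_add_le _ _).trans (add_le_add (hC n) (hD n))⟩
  smul_mem' := by
    rintro c F ⟨C, hC⟩
    refine ⟨‖c‖ * C, fun n => ?_⟩
    simp only [Pi.smul_apply, norm_smul]
    gcongr
    exact hC n

/-- If the averages over long intervals of a bounded function are frequently at most `c`,
then some invariant mean takes value at most `c` on it. -/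
theorem exists_isMean_le (a : ℕ → ℤ) (L : ℕ → ℕ) (hL : Tendsto L atTop atTop)
    (F : ℤ → ℂ) (C : ℝ) (hF : ∀ n, ‖F n‖ ≤ C) (c : ℝ)
    (hc : ∃ᶠ j in atTop, (intervalAvg (a j) (L j) F).re ≤ c) :
    ∃ m, IsMean m ∧ (m F).re ≤ c := by
  have hne : (atTop ⊓ 𝓟 {j | (intervalAvg (a j) (L j) F).re ≤ c}).NeBot :=
    frequently_mem_iff_neBot.1 hc
  let U : Ultrafilter ℕ := Ultrafilter.of (atTop ⊓ 𝓟 {j | (intervalAvg (a j) (L j) F).re ≤ c})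
  have hU : (U : Filter ℕ) ≤ atTop ⊓ 𝓟 {j | (intervalAvg (a j) (L j) F).re ≤ c} :=
    Ultrafilter.of_le _
  have hU1 : (U : Filter ℕ) ≤ atTop := hU.trans inf_le_left
  have hU2 : ∀ᶠ j in (U : Filter ℕ), (intervalAvg (a j) (L j) F).re ≤ c := by
    have := hU.trans inf_le_right
    exact le_principal_iff.1 this
  have hnn : ∀ {G : ℤ → ℂ} {D : ℝ}, (∀ n, ‖G n‖ ≤ D) → 0 ≤ D :=
    fun {G D} h => (norm_nonneg (G 0)).trans (h 0)
  have key : ∀ G : boundedFun, ∃ z : ℂ,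
      Tendsto (fun j => intervalAvg (a j) (L j) (G : ℤ → ℂ)) U (nhds z) := by
    rintro ⟨G, D, hD⟩
    have hcomp : IsCompact (Metric.closedBall (0 : ℂ) D) := isCompact_closedBall _ _
    obtain ⟨z, -, hz⟩ := hcomp.ultrafilter_le_nhds
      (U.map (fun j => intervalAvg (a j) (L j) G)) (by
        refine le_principal_iff.2 ?_
        refine Filter.mem_map.2 (Eventually.of_forall fun j => ?_)
        simpa using norm_intervalAvg_le (hnn hD) hD)
    exact ⟨z, hz⟩
  choose f hf using key
  let fl : boundedFun →ₗ[ℂ] ℂ :=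
    { toFun := f
      map_add' := fun G H => tendsto_nhds_unique (hf (G + H)) (by
        simpa [intervalAvg_add] using (hf G).add (hf H))
      map_smul' := fun r G => tendsto_nhds_unique (hf (r • G)) (by
        simpa [intervalAvg_smul] using (hf G).const_mul r) }
  obtain ⟨m, hm⟩ := LinearMap.exists_extend fl
  have hmt : ∀ (G : ℤ → ℂ) (D : ℝ), (∀ n, ‖G n‖ ≤ D) →
      Tendsto (fun j => intervalAvg (a j) (L j) G) U (nhds (m G)) := by
    intro G D hD
    have h1 := hf ⟨G, D, hD⟩
    have h2 : m G = f ⟨G, D, hD⟩ := LinearMap.congr_fun hm ⟨G, D, hD⟩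
    rw [h2]; exact h1
  refine ⟨m, ⟨?_, ?_, ?_, ?_⟩, ?_⟩
  · refine tendsto_nhds_unique (hmt (fun _ => 1) 1 (by simp)) ?_
    refine Tendsto.congr' ?_ tendsto_const_nhds
    filter_upwards [hU1 (hL.eventually_ge_atTop 1)] with j hj
    have : (L j : ℂ) ≠ 0 := by
      have : 1 ≤ L j := hj
      exact_mod_cast (by lia : L j ≠ 0)
    simp [intervalAvg, this]
  · intro G D hD
    exact le_of_tendsto (hmt G D hD).norm (Eventually.of_forall fun j =>
      norm_intervalAvg_le (hnn hD) hD)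
  · have h1 : ∀ (G : ℤ → ℂ) (D : ℝ), (∀ n, ‖G n‖ ≤ D) → m (fun n => G (n + 1)) = m G := by
      intro G D hD
      have h2 := (hmt (fun n => G (n + 1)) D (fun n => hD _)).sub (hmt G D hD)
      have h3 : Tendsto (fun j => intervalAvg (a j) (L j) (fun n => G (n + 1))
          - intervalAvg (a j) (L j) G) U (nhds 0) := by
        refine squeeze_zero_norm (fun j => intervalAvg_shift_one_sub hD) ?_
        have h4 : Tendsto (fun j => (L j : ℝ)) U atTop :=
          (tendsto_natCast_atTop_atTop.comp hL).mono_left hU1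
        exact h4.const_div_atTop _
      exact sub_eq_zero.1 (tendsto_nhds_unique h2 h3)
    intro G D k hD
    induction k using Int.induction_on with
    | zero => simp
    | succ i ih =>
      rw [← ih, ← h1 (fun n => G (n + i)) D (fun n => hD _)]
      congr 1; ext n; congr 1; ring
    | pred i ih =>
      rw [← ih, ← h1 (fun n => G (n + (-i - 1))) D (fun n => hD _)]
      congr 1; ext n; congr 1; ring
  · intro G D hD hre
    have h5 : Tendsto (fun j => (intervalAvg (a j) (L j) G).re) U (nhds (m G).re) :=
      (Complex.continuous_re.tendsto _).comp (hmt G D hD)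
    refine ge_of_tendsto h5 (Eventually.of_forall fun j => ?_)
    have : (intervalAvg (a j) (L j) G).re = (∑ i ∈ range (L j), (G (a j + i)).re) / L j := by
      simp [intervalAvg, Complex.div_natCast_re]
    rw [this]
    exact div_nonneg (sum_nonneg fun i _ => hre _) (by positivity)
  · have h5 : Tendsto (fun j => (intervalAvg (a j) (L j) F).re) U (nhds (m F).re) :=
      (Complex.continuous_re.tendsto _).comp (hmt F C hF)
    exact le_of_tendsto h5 hU2

namespace IsMean

variable {m : (ℤ → ℂ) →ₗ[ℂ] ℂ}

lemma const (hm : IsMean m) (c : ℂ) : m (fun _ => c) = c := by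
  have : (fun _ : ℤ => c) = c • (fun _ : ℤ => (1 : ℂ)) := by ext; simp
  rw [this, map_smul, hm.one]; simp

lemma map_mul_left (c : ℂ) (F : ℤ → ℂ) : m (fun n => c * F n) = c * m F := by
  have : (fun n : ℤ => c * F n) = c • F := by ext; simp
  rw [this, map_smul]; simp

lemma map_mul_right (c : ℂ) (F : ℤ → ℂ) : m (fun n => F n * c) = m F * c := by
  simp_rw [mul_comm _ c]; exact map_mul_left c F

lemma map_add' (F G : ℤ → ℂ) : m (fun n => F n + G n) = m F + m G := map_add m F G

lemma map_sub' (F G : ℤ → ℂ) : m (fun n => F n - G n) = m F - m G := map_sub m F G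

lemma map_sum' {ι : Type*} (s : Finset ι) (F : ι → ℤ → ℂ) :
    m (fun n => ∑ i ∈ s, F i n) = ∑ i ∈ s, m (F i) := by
  have : (fun n => ∑ i ∈ s, F i n) = ∑ i ∈ s, F i := by ext; simp
  rw [this, map_sum]

lemma re_mono (hm : IsMean m) {F G : ℤ → ℂ} {C D : ℝ} (hF : ∀ n, ‖F n‖ ≤ C)
    (hG : ∀ n, ‖G n‖ ≤ D) (h : ∀ n, (F n).re ≤ (G n).re) : (m F).re ≤ (m G).re := by
  have := hm.re_nonneg (fun n => G n - F n) (D + C)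
    (fun n => (norm_sub_le _ _).trans (add_le_add (hG n) (hF n)))
    (fun n => by simpa using h n)
  rw [map_sub'] at this
  simpa using this

lemma norm_le_re (hm : IsMean m) {F G : ℤ → ℂ} {D : ℝ}
    (hG : ∀ n, ‖G n‖ ≤ D) (h : ∀ n, ‖F n‖ ≤ (G n).re) : ‖m F‖ ≤ (m G).re := by
  have hF : ∀ n, ‖F n‖ ≤ D := fun n => (h n).trans ((Complex.re_le_norm _).trans (hG n))
  obtain ⟨u, hu, hu2⟩ : ∃ u : ℂ, ‖u‖ = 1 ∧ u * m F = ‖m F‖ := by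
    by_cases h0 : m F = 0
    · exact ⟨1, by simp, by simp [h0]⟩
    · refine ⟨(starRingEnd ℂ) (m F) / ‖m F‖, ?_, ?_⟩
      · simp [h0]
      · have : (‖m F‖ : ℂ) ≠ 0 := by simpa using h0
        field_simp
        rw [mul_comm, Complex.mul_conj, Complex.normSq_eq_norm_sq]; push_cast; ring
  have h1 := hm.re_mono (F := fun n => u * F n) (G := G) (C := D) (D := D)
    (fun n => by rw [norm_mul, hu, one_mul]; exact hF n) hG
    (fun n => (Complex.re_le_norm _).trans (by rw [norm_mul, hu, one_mul]; exact h n))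
  rw [map_mul_left, hu2] at h1
  simpa using h1

lemma im_ofReal (hm : IsMean m) {F : ℤ → ℝ} {C : ℝ} (hF : ∀ n, |F n| ≤ C) :
    (m (fun n => (F n : ℂ))).im = 0 := by
  have h1 := hm.re_nonneg (fun n => Complex.I * F n) C (by simpa using hF) (by simp)
  have h2 := hm.re_nonneg (fun n => -Complex.I * F n) C (by simpa using hF) (by simp)
  rw [map_mul_left] at h1 h2
  simp at h1 h2
  linarith

lemma map_conj (hm : IsMean m) {F : ℤ → ℂ} {C : ℝ} (hF : ∀ n, ‖F n‖ ≤ C) :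
    m (fun n => (starRingEnd ℂ) (F n)) = (starRingEnd ℂ) (m F) := by
  have hre := hm.im_ofReal (F := fun n => (F n).re) (fun n => (Complex.abs_re_le_norm _).trans (hF n))
  have him := hm.im_ofReal (F := fun n => (F n).im) (fun n => (Complex.abs_im_le_norm _).trans (hF n))
  have h1 : m F = m (fun n => ((F n).re : ℂ)) + Complex.I * m (fun n => ((F n).im : ℂ)) := by
    rw [← map_mul_left, ← map_add']
    congr 1; ext n
    rw [mul_comm, Complex.re_add_im]
  have h2 : m (fun n => (starRingEnd ℂ) (F n)) =
      m (fun n => ((F n).re : ℂ)) - Complex.I * m (fun n => ((F n).im : ℂ)) := by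
    rw [← map_mul_left, ← map_sub']
    congr 1; ext n
    apply Complex.ext <;> simp
  rw [h1, h2, map_add, map_mul, Complex.conj_I, Complex.conj_eq_iff_im.2 hre,
    Complex.conj_eq_iff_im.2 him]
  ring

/-- Cauchy–Schwarz for means. -/
lemma norm_sq_le (hm : IsMean m) {F : ℤ → ℂ} {C : ℝ} (hF : ∀ n, ‖F n‖ ≤ C) :
    ‖m F‖ ^ 2 ≤ (m (fun n => ((‖F n‖ ^ 2 : ℝ) : ℂ))).re := by
  have hb : ∀ n, ‖((‖F n‖ ^ 2 : ℝ) : ℂ)‖ ≤ C ^ 2 := by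
    intro n
    rw [Complex.norm_real, Real.norm_of_nonneg (by positivity)]
    gcongr; exact hF n
  set u := (starRingEnd ℂ) (m F) with hu
  have hb2 : ∀ n, ‖2 * (u * F n)‖ ≤ 2 * (‖u‖ * C) := fun n => by
    simp only [norm_mul, Complex.norm_ofNat]; gcongr; exact hF n
  have h1 := hm.re_mono (F := fun n => 2 * (u * F n))
    (G := fun n => ((‖F n‖ ^ 2 : ℝ) : ℂ) + ((‖m F‖ ^ 2 : ℝ) : ℂ)) (C := 2 * (‖u‖ * C))
    (D := C ^ 2 + ‖((‖m F‖ ^ 2 : ℝ) : ℂ)‖) hb2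
    (fun n => (norm_add_le _ _).trans (by gcongr; exact hb n)) (by
      intro n
      have h2 : (2 * (u * F n)).re ≤ 2 * (‖m F‖ * ‖F n‖) := by
        refine (Complex.re_le_norm _).trans ?_
        simp [hu]
      have h3 : (((‖F n‖ ^ 2 : ℝ) : ℂ) + ((‖m F‖ ^ 2 : ℝ) : ℂ)).re = ‖F n‖ ^ 2 + ‖m F‖ ^ 2 := by
        rw [Complex.add_re, Complex.ofReal_re, Complex.ofReal_re]
      rw [h3]
      nlinarith [sq_nonneg (‖F n‖ - ‖m F‖)])
  rw [map_mul_left, map_mul_left, map_add', hm.const] at h1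
  have h4 : (2 * (u * m F)).re = 2 * ‖m F‖ ^ 2 := by
    rw [hu, mul_comm ((starRingEnd ℂ) _), Complex.mul_conj, Complex.normSq_eq_norm_sq]
    norm_cast
  rw [h4, Complex.add_re, Complex.ofReal_re] at h1
  linarith

end IsMean

/-- The restriction of a mean to the progression `b ℤ + r`. -/
noncomputable def progMean (m : (ℤ → ℂ) →ₗ[ℂ] ℂ) (b : ℕ) (r : ℤ) : (ℤ → ℂ) →ₗ[ℂ] ℂ where
  toFun F := b * m (fun n => if (b : ℤ) ∣ n - r then F ((n - r) / b) else 0)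
  map_add' F G := by
    rw [← mul_add, ← map_add]
    congr 2; ext n; simp only [Pi.add_apply]; split_ifs <;> simp
  map_smul' c F := by
    rw [RingHom.id_apply, smul_eq_mul, mul_left_comm, ← IsMean.map_mul_left c]
    congr 2; ext n; simp

lemma progMean_apply (m : (ℤ → ℂ) →ₗ[ℂ] ℂ) (b : ℕ) (r : ℤ) (F : ℤ → ℂ) :
    progMean m b r F = b * m (fun n => if (b : ℤ) ∣ n - r then F ((n - r) / b) else 0) := rfl

lemma sum_ite_dvd_sub (b : ℕ) (hb : 0 < b) (n : ℤ) (z : ℂ) :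
    ∑ r ∈ range b, (if (b : ℤ) ∣ n - (r : ℤ) then z else 0) = z := by
  have hb' : (0 : ℤ) < b := by exact_mod_cast hb
  rw [Finset.sum_eq_single_of_mem (n % b).toNat]
  · rw [if_pos]
    rw [Int.toNat_of_nonneg (Int.emod_nonneg _ hb'.ne')]
    exact Int.dvd_self_sub_emod
  · rw [Finset.mem_range]; have := Int.emod_lt_of_pos n hb'; have := Int.emod_nonneg n hb'.ne'; lia
  · intro r hr hne
    rw [if_neg]
    intro hd
    apply hne
    have h1 : n % b = (r : ℤ) % b :=
      Int.emod_eq_emod_iff_emod_sub_eq_zero.2 (Int.emod_eq_zero_of_dvd hd)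
    rw [h1, Int.emod_eq_of_lt (by positivity) (by exact_mod_cast Finset.mem_range.1 hr)]
    simp

lemma IsMean.indicator {m : (ℤ → ℂ) →ₗ[ℂ] ℂ} (hm : IsMean m) (b : ℕ) (hb : 0 < b) (r : ℤ) :
    (b : ℂ) * m (fun n => if (b : ℤ) ∣ n - r then 1 else 0) = 1 := by
  have h1 : ∀ r : ℤ, m (fun n => if (b : ℤ) ∣ n - r then 1 else 0)
      = m (fun n => if (b : ℤ) ∣ n then 1 else 0) := fun r => by
    rw [← hm.shift (fun n => if (b : ℤ) ∣ n then 1 else 0) 1 (-r)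
      (fun n => by split_ifs <;> simp)]
    simp [sub_eq_add_neg]
  have h2 : m (fun n => ∑ r ∈ range b, (if (b : ℤ) ∣ n - (r : ℤ) then (1 : ℂ) else 0)) = 1 := by
    simp_rw [sum_ite_dvd_sub b hb]; exact hm.one
  rw [IsMean.map_sum'] at h2
  simp_rw [h1] at h2
  rw [h1]; simpa using h2

theorem isMean_progMean {m : (ℤ → ℂ) →ₗ[ℂ] ℂ} (hm : IsMean m) (b : ℕ) (hb : 0 < b) (r : ℤ) :
    IsMean (progMean m b r) := by
  have hb' : (0 : ℤ) < b := by exact_mod_cast hb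
  have hnn : ∀ {G : ℤ → ℂ} {D : ℝ}, (∀ n, ‖G n‖ ≤ D) → 0 ≤ D :=
    fun {G D} h => (norm_nonneg (G 0)).trans (h 0)
  refine ⟨hm.indicator b hb r, ?_, ?_, ?_⟩
  · intro F C hF
    rw [progMean_apply, norm_mul, Complex.norm_natCast]
    have h1 := hm.norm_le_re (F := fun n => if (b : ℤ) ∣ n - r then F ((n - r) / b) else 0)
      (G := fun n => (C : ℂ) * (if (b : ℤ) ∣ n - r then 1 else 0)) (D := |C|)
      (fun n => by split_ifs <;> simp) (fun n => by split_ifs <;> simp [hF])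
    rw [IsMean.map_mul_left] at h1
    have h2 := hm.indicator b hb r
    calc _ ≤ (b : ℝ) * ((C : ℂ) * m (fun n => if (b : ℤ) ∣ n - r then 1 else 0)).re := by gcongr
      _ = ((C : ℂ) * (b * m (fun n => if (b : ℤ) ∣ n - r then 1 else 0))).re := by
        rw [Complex.re_ofReal_mul, Complex.re_ofReal_mul, ← Complex.ofReal_natCast,
          Complex.re_ofReal_mul]; ring
      _ = C := by rw [h2]; simp
  · intro F C k hF
    rw [progMean_apply, progMean_apply]
    congr 1
    have h0 := hnn hF
    rw [← hm.shift (fun n => if (b : ℤ) ∣ n - r then F ((n - r) / b) else 0) C (b * k)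
      (fun n => by split_ifs <;> simp [hF, h0])]
    congr 1; ext n
    have h1 : n + b * k - r = (n - r) + b * k := by ring
    rw [h1, Int.add_mul_ediv_left _ _ hb'.ne']
    simp
  · intro F C hF hre
    rw [progMean_apply]
    have h0 := hnn hF
    have := hm.re_nonneg (fun n => if (b : ℤ) ∣ n - r then F ((n - r) / b) else 0) C
      (fun n => by split_ifs <;> simp [hF, h0]) (fun n => by split_ifs <;> simp [hre])
    rw [← Complex.ofReal_natCast, Complex.re_ofReal_mul]
    positivity

theorem sum_progMean (m : (ℤ → ℂ) →ₗ[ℂ] ℂ) (b : ℕ) (hb : 0 < b) (F : ℤ → ℂ) :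
    ∑ r ∈ range b, progMean m b r (fun n => F (b * n + r)) = b * m F := by
  simp_rw [progMean_apply]
  rw [← mul_sum, ← IsMean.map_sum']
  congr 2; ext n
  rw [← sum_ite_dvd_sub b hb n (F n)]
  refine sum_congr rfl fun r _ => ?_
  split_ifs with h
  · rw [Int.mul_ediv_cancel' h]; simp
  · rfl

lemma exists_progMean_ge {m : (ℤ → ℂ) →ₗ[ℂ] ℂ} (b : ℕ) (hb : 0 < b) (F : ℤ → ℂ)
    {c : ℝ} (h : c ≤ ‖m F‖) :
    ∃ r < b, c ≤ ‖progMean m b r (fun n => F (b * n + r))‖ := by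
  by_contra! hcon
  have h1 : ‖(b : ℂ) * m F‖ < b * c := by
    rw [← sum_progMean m b hb F]
    calc _ ≤ ∑ r ∈ range b, ‖progMean m b r (fun n => F (b * n + r))‖ := norm_sum_le _ _
      _ < ∑ r ∈ range b, c := sum_lt_sum_of_nonempty (by simpa using hb.ne')
          (fun r hr => hcon r (Finset.mem_range.1 hr))
      _ = b * c := by simp
  rw [norm_mul, Complex.norm_natCast] at h1
  have : (0 : ℝ) < b := by exact_mod_cast hb
  nlinarith

/-! ### Weyl sums along invariant means -/

/-- The additive character `x ↦ exp (2πix)`. -/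
noncomputable def ee (x : ℝ) : ℂ := Complex.exp (2 * Real.pi * x * Complex.I)

@[simp] lemma ee_zero : ee 0 = 1 := by simp [ee]

lemma ee_add (x y : ℝ) : ee (x + y) = ee x * ee y := by
  simp only [ee, ← Complex.exp_add]; congr 1; push_cast; ring

@[simp] lemma norm_ee (x : ℝ) : ‖ee x‖ = 1 := by
  have : (2 * Real.pi * x * Complex.I : ℂ) = ((2 * Real.pi * x : ℝ) : ℂ) * Complex.I := by
    push_cast; ring
  rw [ee, this, Complex.norm_exp_ofReal_mul_I]

lemma ee_ne_zero (x : ℝ) : ee x ≠ 0 := by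
  rw [← norm_pos_iff]; simp

lemma ee_neg (x : ℝ) : ee (-x) = (starRingEnd ℂ) (ee x) := by
  have h : ee (-x) * ee x = 1 := by rw [← ee_add]; simp
  have h2 : (starRingEnd ℂ) (ee x) * ee x = 1 := by
    rw [mul_comm, Complex.mul_conj, Complex.normSq_eq_norm_sq]; simp
  exact mul_right_cancel₀ (ee_ne_zero x) (h.trans h2.symm)

lemma ee_sub (x y : ℝ) : ee (x - y) = ee x * (starRingEnd ℂ) (ee y) := by
  rw [sub_eq_add_neg, ee_add, ee_neg]

lemma ee_eq_one_iff (x : ℝ) : ee x = 1 ↔ ∃ k : ℤ, x = k := by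
  have hpi : (2 * Real.pi * Complex.I : ℂ) ≠ 0 := by
    simp [Real.pi_ne_zero]
  rw [ee, Complex.exp_eq_one_iff]
  constructor
  · rintro ⟨k, hk⟩
    refine ⟨k, ?_⟩
    have : (x : ℂ) = k := by
      apply mul_left_cancel₀ hpi
      linear_combination hk
    exact_mod_cast this
  · rintro ⟨k, rfl⟩
    exact ⟨k, by push_cast; ring⟩

lemma ee_int (k : ℤ) : ee k = 1 := (ee_eq_one_iff _).2 ⟨k, rfl⟩

lemma ee_sum {ι : Type*} (s : Finset ι) (f : ι → ℝ) : ee (∑ i ∈ s, f i) = ∏ i ∈ s, ee (f i) := by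
  classical
  induction s using Finset.induction_on with
  | empty => simp
  | insert a s ha ih => rw [sum_insert ha, prod_insert ha, ee_add, ih]

lemma continuous_ee : Continuous ee := by unfold ee; fun_prop

open Polynomial in
lemma natDegree_taylor_sub_le {R : Type*} [CommRing R] (q : R[X]) (k : R) (d : ℕ)
    (hq : q.natDegree ≤ d + 1) : (taylor k q - q).natDegree ≤ d ∧
      (taylor k q - q).coeff d = (d + 1) * q.coeff (d + 1) * k := by
  have hev : ∀ p : R[X], p.natDegree ≤ 1 → p.eval k = p.coeff 0 + p.coeff 1 * k := by
    intro p hp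
    rw [eval_eq_sum_range' (n := 2) (by lia)]
    simp [sum_range_succ]
  constructor
  · rw [natDegree_le_iff_coeff_eq_zero]
    intro N hN
    rw [coeff_sub, taylor_coeff]
    have h0 : (hasseDeriv N q).natDegree ≤ 0 := (natDegree_hasseDeriv_le q N).trans (by lia)
    rw [eq_C_of_natDegree_le_zero h0, eval_C, hasseDeriv_coeff]
    simp
  · rw [coeff_sub, taylor_coeff, hev _ ((natDegree_hasseDeriv_le q d).trans (by lia)),
      hasseDeriv_coeff, hasseDeriv_coeff]
    simp [add_comm 1 d]

/-- Van der Corput's inequality for scalar sequences. -/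
lemma vdc_scalar {m : (ℤ → ℂ) →ₗ[ℂ] ℂ} (hm : IsMean m) (F : ℤ → ℂ) (hF : ∀ n, ‖F n‖ ≤ 1)
    (A : Finset ℤ) : (#A : ℝ) ^ 2 * ‖m F‖ ^ 2 ≤
      ∑ h ∈ A, ∑ h' ∈ A, (m (fun n => F (n + h) * (starRingEnd ℂ) (F (n + h')))).re := by
  have h1 : (#A : ℂ) * m F = m (fun n => ∑ h ∈ A, F (n + h)) := by
    rw [IsMean.map_sum']
    rw [sum_congr rfl fun h _ => hm.shift F 1 h hF]
    simp
  have h2 : ∀ n, ‖∑ h ∈ A, F (n + h)‖ ≤ #A := fun n => by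
    refine (norm_sum_le _ _).trans ((sum_le_sum fun h _ => hF _).trans (by simp))
  have h3 := hm.norm_sq_le h2
  have h4 : (fun n => ((‖∑ h ∈ A, F (n + h)‖ ^ 2 : ℝ) : ℂ)) =
      fun n => ∑ h ∈ A, ∑ h' ∈ A, F (n + h) * (starRingEnd ℂ) (F (n + h')) := by
    ext n
    rw [← sum_mul_sum, ← map_sum, Complex.mul_conj, Complex.normSq_eq_norm_sq]
  rw [h4, ← h1, norm_mul, Complex.norm_natCast, mul_pow] at h3
  simpa [IsMean.map_sum', Complex.re_sum] using h3

/-- If the mean is large, then so is a correlation with a shift `1 ≤ k ≤ H`. -/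
lemma exists_large_correlation (c : ℝ) (hc : 0 < c) : ∃ H : ℕ, ∀ m, IsMean m →
    ∀ F : ℤ → ℂ, (∀ n, ‖F n‖ ≤ 1) → c ≤ ‖m F‖ →
    ∃ k : ℕ, 1 ≤ k ∧ k ≤ H ∧
      c ^ 2 / 2 ≤ ‖m (fun n => F (n + k) * (starRingEnd ℂ) (F n))‖ := by
  obtain ⟨H, hH⟩ := exists_nat_gt (2 / c ^ 2)
  refine ⟨H, fun m hm F hF hcF => ?_⟩
  by_contra! hcon
  have hH0 : (0 : ℝ) < H := lt_trans (by positivity) hH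
  have hb : ∀ h h' : ℤ, ∀ n, ‖F (n + h) * (starRingEnd ℂ) (F (n + h'))‖ ≤ 1 := fun h h' n => by
    rw [norm_mul, RCLike.norm_conj]
    exact mul_le_one₀ (hF _) (norm_nonneg _) (hF _)
  have hpos : ∀ h h' : ℕ, h' < h → h < H →
      ‖m (fun n => F (n + h) * (starRingEnd ℂ) (F (n + h')))‖ < c ^ 2 / 2 := by
    intro h h' hlt hltH
    have := hcon (h - h') (by lia) (by lia)
    rw [← hm.shift _ 1 h' (fun n => by simpa using hb (h - h' : ℕ) 0 n)] at this
    have h2 : ∀ n : ℤ, n + h' + ((h - h' : ℕ) : ℤ) = n + h := fun n => by lia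
    simpa only [h2] using this
  have hle : ∀ h ∈ range H, ∀ h' ∈ range H,
      (m (fun n => F (n + h) * (starRingEnd ℂ) (F (n + h')))).re ≤
        c ^ 2 / 2 + if h = h' then 1 else 0 := by
    intro h hh h' hh'
    rw [Finset.mem_range] at hh hh'
    refine (Complex.re_le_norm _).trans ?_
    rcases lt_trichotomy h h' with hlt | rfl | hlt
    · have h1 := hpos h' h hlt hh'
      have h2 : ‖m (fun n => F (n + h) * (starRingEnd ℂ) (F (n + h')))‖ ≤ c ^ 2 / 2 := by
        have : m (fun n => F (n + h) * (starRingEnd ℂ) (F (n + h'))) =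
            (starRingEnd ℂ) (m (fun n => F (n + h') * (starRingEnd ℂ) (F (n + h)))) := by
          rw [← hm.map_conj (hb h' h)]
          congr 1; ext n; simp [mul_comm]
        rw [this, RCLike.norm_conj]; exact h1.le
      simpa [hlt.ne] using h2
    · have := hm.norm_le _ 1 (hb h h)
      simp only [if_true]
      have : 0 < c ^ 2 / 2 := by positivity
      linarith
    · simpa [hlt.ne'] using (hpos h h' hlt hh).le
  have h3 := vdc_scalar hm F hF ((range H).map Nat.castEmbedding)
  simp only [card_map, card_range, sum_map, Nat.castEmbedding_apply] at h3
  have h4 := h3.trans (sum_le_sum fun h hh => sum_le_sum fun h' hh' => hle h hh h' hh')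
  have h6 : ∑ h ∈ range H, ∑ h' ∈ range H, (c ^ 2 / 2 + if h = h' then (1 : ℝ) else 0) =
      H ^ 2 * (c ^ 2 / 2) + H := by
    rw [sum_congr rfl (fun h hh => by
      rw [sum_add_distrib, sum_ite_eq, if_pos hh])]
    simp; ring
  rw [h6] at h4
  have h7 : (H : ℝ) ^ 2 * c ^ 2 ≤ H ^ 2 * ‖m F‖ ^ 2 := by gcongr
  have h8 : (H : ℝ) * (H * (c ^ 2 / 2)) ≤ H * 1 := by nlinarith
  have h9 := le_of_mul_le_mul_left h8 hH0
  rw [div_lt_iff₀ (by positivity)] at hH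
  linarith

open Polynomial in
theorem weyl_top (d : ℕ) : ∀ c : ℝ, 0 < c → ∃ b : ℕ, 0 < b ∧ ∀ m, IsMean m → ∀ q : ℝ[X],
    q.natDegree ≤ d + 1 → c ≤ ‖m (fun n => ee (q.eval (n : ℝ)))‖ →
      ∃ z : ℤ, b * q.coeff (d + 1) = z := by
  induction d with
  | zero =>
    intro c hc
    refine ⟨1, one_pos, fun m hm q hq hcq => ?_⟩
    have hev : ∀ x : ℝ, q.eval x = q.coeff 0 + q.coeff 1 * x := fun x => by
      rw [eval_eq_sum_range' (n := 2) (by lia)]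
      simp [sum_range_succ]
    have h1 := hm.shift (fun n => ee (q.eval (n : ℝ))) 1 1 (by simp)
    have h2 : (fun n : ℤ => ee (q.eval ((n + 1 : ℤ) : ℝ))) =
        fun n : ℤ => ee (q.coeff 1) * ee (q.eval (n : ℝ)) := by
      ext n
      rw [← ee_add, hev, hev]; congr 1; push_cast; ring
    rw [h2, IsMean.map_mul_left] at h1
    have h3 : m (fun n => ee (q.eval (n : ℝ))) ≠ 0 := by
      rw [← norm_pos_iff]; linarith
    obtain ⟨k, hk⟩ := (ee_eq_one_iff _).1 (mul_right_cancel₀ h3 (h1.trans (one_mul _).symm))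
    exact ⟨k, by simpa using hk⟩
  | succ d ih =>
    intro c hc
    obtain ⟨H, hH⟩ := exists_large_correlation c hc
    obtain ⟨b, hb, hbT⟩ := ih (c ^ 2 / 2) (by positivity)
    refine ⟨b * (d + 2) * H.factorial, by positivity, fun m hm q hq hcq => ?_⟩
    obtain ⟨k, hk1, hkH, hk⟩ := hH m hm _ (by simp) hcq
    obtain ⟨hdeg, hcoeff⟩ := natDegree_taylor_sub_le q (k : ℝ) (d + 1) hq
    obtain ⟨z, hz⟩ := hbT m hm (taylor (k : ℝ) q - q) hdeg (by
      refine hk.trans_eq ?_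
      congr 2; ext n
      rw [← ee_sub, eval_sub, taylor_eval]; push_cast; rfl)
    rw [hcoeff] at hz
    obtain ⟨e, he⟩ := Nat.dvd_factorial hk1 hkH
    refine ⟨z * e, ?_⟩
    rw [he]; push_cast; rw [← hz]; push_cast; ring

open Polynomial in
/-- If the Weyl sum of a real polynomial is at least `c`, then the polynomial is constant modulo
one along a progression whose step is bounded in terms of `c` and the degree. -/
theorem weyl_progression (d : ℕ) : ∀ c : ℝ, 0 < c → ∃ K : ℕ, 0 < K ∧ ∀ m, IsMean m →
    ∀ q : ℝ[X], q.natDegree ≤ d → c ≤ ‖m (fun n => ee (q.eval (n : ℝ)))‖ →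
      ∃ r < K, ∀ n : ℤ, ee (q.eval ((K * n + r : ℤ) : ℝ)) = ee (q.eval (r : ℝ)) := by
  induction d with
  | zero =>
    intro c hc
    refine ⟨1, one_pos, fun m hm q hq _ => ⟨0, one_pos, fun n => ?_⟩⟩
    rw [eq_C_of_natDegree_le_zero hq]; simp
  | succ d ih =>
    intro c hc
    obtain ⟨b, hb, hbT⟩ := weyl_top d c hc
    obtain ⟨K, hK, hKT⟩ := ih c hc
    refine ⟨b * K, by positivity, fun m hm q hq hcq => ?_⟩
    obtain ⟨z, hz⟩ := hbT m hm q hq hcq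
    obtain ⟨r, hr, hcr⟩ := exists_progMean_ge b hb _ hcq
    set q1 : ℝ[X] := (taylor (r : ℝ) q).comp (C (b : ℝ) * X) with hq1
    set q2 : ℝ[X] := q1 - C ((b : ℝ) ^ (d + 1) * q.coeff (d + 1)) * X ^ (d + 1) with hq2
    have hq1d : q1.natDegree ≤ d + 1 := by
      refine natDegree_comp_le.trans ?_
      rw [natDegree_taylor]
      calc _ ≤ (d + 1) * 1 := Nat.mul_le_mul hq ((natDegree_C_mul_le _ _).trans natDegree_X_le)
        _ = _ := by ring
    have hq1c : q1.coeff (d + 1) = (b : ℝ) ^ (d + 1) * q.coeff (d + 1) := by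
      have h1 := coeff_eq_zero_of_natDegree_lt (n := d + 1)
        (Nat.lt_succ_of_le (natDegree_taylor_sub_le q (r : ℝ) d hq).1)
      rw [coeff_sub, sub_eq_zero] at h1
      rw [hq1, comp_C_mul_X_coeff, h1, mul_comm]
    have hq2d : q2.natDegree ≤ d := by
      rw [natDegree_le_iff_coeff_eq_zero]
      intro N hN
      rw [hq2, coeff_sub, coeff_C_mul, coeff_X_pow]
      rcases eq_or_ne N (d + 1) with rfl | hne
      · rw [hq1c]; simp
      · rw [if_neg hne, coeff_eq_zero_of_natDegree_lt (by lia)]; simp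
    have hq2e : ∀ n : ℤ, ee (q2.eval (n : ℝ)) = ee (q.eval ((b * n + r : ℤ) : ℝ)) := by
      intro n
      have h1 : q.eval ((b * n + r : ℤ) : ℝ) = q2.eval (n : ℝ) +
          ((b ^ d * z * n ^ (d + 1) : ℤ) : ℝ) := by
        rw [hq2, hq1, eval_sub, eval_comp, taylor_eval]
        simp only [eval_mul, eval_C, eval_X, eval_pow]
        push_cast; rw [← hz]; ring
      rw [h1, ee_add, ee_int, mul_one]
    simp_rw [← hq2e] at hcr
    obtain ⟨r', hr', hrn⟩ := hKT _ (isMean_progMean hm b hb r) q2 hq2d hcr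
    refine ⟨b * r' + r, ?_, fun n => ?_⟩
    · nlinarith
    · have h1 := hrn n
      rw [hq2e] at h1
      have h2 := hq2e r'
      rw [show (r' : ℝ) = ((r' : ℤ) : ℝ) by simp] at h1
      rw [h2] at h1
      convert h1 using 3 <;> push_cast <;> ring

/-! ### Exponential sums of rationally independent polynomials -/

lemma exists_int_mul_sum_of_mem_span {ι κ : Type*} [Fintype ι] (v : κ → ι → ℤ) (w : ι → ℚ)
    (hw : w ∈ Submodule.span ℚ (Set.range fun n => fun j => (v n j : ℚ))) :
    ∃ b : ℕ, 0 < b ∧ ∀ θ : ι → ℝ, (∀ n, ∃ z : ℤ, ∑ j, θ j * v n j = z) →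
      ∃ z : ℤ, b * ∑ j, θ j * (w j : ℝ) = z := by
  induction hw using Submodule.span_induction with
  | mem x hx =>
    obtain ⟨n, rfl⟩ := hx
    refine ⟨1, one_pos, fun θ hθ => ?_⟩
    obtain ⟨z, hz⟩ := hθ n
    exact ⟨z, by simpa using hz⟩
  | zero => exact ⟨1, one_pos, fun θ _ => ⟨0, by simp⟩⟩
  | add x y _ _ hx hy =>
    obtain ⟨b, hb, hx⟩ := hx
    obtain ⟨b', hb', hy⟩ := hy
    refine ⟨b * b', by positivity, fun θ hθ => ?_⟩
    obtain ⟨z, hz⟩ := hx θ hθ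
    obtain ⟨z', hz'⟩ := hy θ hθ
    refine ⟨b' * z + b * z', ?_⟩
    push_cast
    rw [← hz, ← hz']
    simp only [Pi.add_apply, Rat.cast_add, mul_add, sum_add_distrib]
    ring
  | smul q x _ hx =>
    obtain ⟨b, hb, hx⟩ := hx
    refine ⟨b * q.den, Nat.mul_pos hb q.den_pos, fun θ hθ => ?_⟩
    obtain ⟨z, hz⟩ := hx θ hθ
    refine ⟨q.num * z, ?_⟩
    push_cast
    rw [← hz]
    have h1 : (q.den : ℝ) * (q : ℝ) = q.num := by exact_mod_cast Rat.den_mul_eq_num q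
    have h2 : ∑ j, θ j * (((q • x) j : ℚ) : ℝ) = q * ∑ j, θ j * (x j : ℝ) := by
      rw [mul_sum]; refine sum_congr rfl fun j _ => ?_
      simp only [Pi.smul_apply, smul_eq_mul, Rat.cast_mul]; ring
    rw [h2, ← h1]; ring

open Polynomial in
lemma span_values_eq_top {ι : Type*} [Fintype ι] [DecidableEq ι] (p : ι → ℤ[X])
    (hp : LinearIndependent ℤ p) (hp0 : ∀ i, (p i).eval 0 = 0) (K : ℕ) (hK : 0 < K) (r : ℤ) :
    Submodule.span ℚ (Set.range fun n : ℤ => fun j =>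
      (((p j).eval (K * n + r) - (p j).eval r : ℤ) : ℚ)) = ⊤ := by
  by_contra hne
  obtain ⟨f, hf, hle⟩ := Submodule.exists_le_ker_of_lt_top _ (lt_top_iff_ne_top.2 hne)
  apply hf
  set D : ℕ := ∏ j, (f (Pi.single j 1)).den with hD
  have hD0 : D ≠ 0 := prod_ne_zero_iff.2 fun j _ => (f (Pi.single j 1)).den_nz
  have hintg : ∀ j, ∃ z : ℤ, (D : ℚ) * f (Pi.single j 1) = z := by
    intro j
    obtain ⟨e, he⟩ := Finset.dvd_prod_of_mem (fun j => (f (Pi.single j 1)).den) (mem_univ j)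
    refine ⟨(f (Pi.single j 1)).num * e, ?_⟩
    rw [hD, he]; push_cast
    rw [mul_right_comm, Rat.den_mul_eq_num]
  choose c hc using hintg
  have hfw : ∀ w : ι → ℚ, f w = ∑ j, w j * f (Pi.single j 1) := by
    intro w
    conv_lhs => rw [pi_eq_sum_univ' w]
    simp
  have hz : ∀ n : ℤ, ∑ j, c j * ((p j).eval (K * n + r) - (p j).eval r) = 0 := by
    intro n
    have h1 : f (fun j => (((p j).eval (K * n + r) - (p j).eval r : ℤ) : ℚ)) = 0 :=
      hle (Submodule.subset_span ⟨n, rfl⟩)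
    rw [hfw] at h1
    have h2 : ((∑ j, c j * ((p j).eval (K * n + r) - (p j).eval r) : ℤ) : ℚ) =
        D * ∑ j, (((p j).eval (K * n + r) - (p j).eval r : ℤ) : ℚ) * f (Pi.single j 1) := by
      rw [mul_sum]; push_cast
      refine sum_congr rfl fun j _ => ?_
      rw [← hc]; ring
    rw [h1, mul_zero] at h2
    exact_mod_cast h2
  set P : ℤ[X] := ∑ j, c j • p j with hP
  have hPe : ∀ x : ℤ, P.eval x = ∑ j, c j * (p j).eval x := by
    intro x; rw [hP, eval_finsetSum]; simp
  have hPc : P - C (P.eval r) = 0 := by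
    refine eq_zero_of_infinite_isRoot _ (Set.Infinite.mono ?_
      (Set.infinite_range_of_injective (f := fun n : ℤ => (K : ℤ) * n + r) ?_))
    · rintro _ ⟨n, rfl⟩
      simp only [Set.mem_ofPred_eq, IsRoot, eval_sub, eval_C, hPe]
      rw [← sum_sub_distrib, ← hz n]
      simp [mul_sub]
    · intro a b hab
      have : (K : ℤ) * a = K * b := by simpa using hab
      exact mul_left_cancel₀ (by exact_mod_cast hK.ne') this
  have hP0 : P = 0 := by
    have h1 : P.eval 0 = 0 := by rw [hPe]; simp [hp0]
    have h2 := sub_eq_zero.1 hPc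
    rw [h2, eval_C] at h1
    rw [h2, h1, C_0]
  have hc0 := Fintype.linearIndependent_iff.1 hp c hP0
  ext w
  rw [LinearMap.comp_apply, LinearMap.zero_comp, LinearMap.zero_apply]
  have h1 := hc w
  rw [hc0 w] at h1
  have hD0' : (D : ℚ) ≠ 0 := by exact_mod_cast hD0
  simpa [hD0'] using h1

open Polynomial in
/-- If a mean of `e(∑ θⱼ pⱼ(n))` is large for rationally independent `pⱼ`, then all `θⱼ` are
rational with bounded denominator. -/
theorem exists_int_mul_of_large_mean {ι : Type*} [Fintype ι] (p : ι → ℤ[X])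
    (hp : LinearIndependent ℤ p) (hp0 : ∀ i, (p i).eval 0 = 0) (c : ℝ) (hc : 0 < c) :
    ∃ b : ℕ, 0 < b ∧ ∀ m, IsMean m → ∀ θ : ι → ℝ,
      c ≤ ‖m (fun n => ∏ j, ee (θ j * ((p j).eval n : ℤ)))‖ → ∀ j, ∃ z : ℤ, b * θ j = z := by
  classical
  obtain ⟨K, hK, hKw⟩ := weyl_progression (univ.sup fun j => (p j).natDegree) c hc
  have hspan : ∀ (r : ℕ) (j : ι), ∃ b : ℕ, 0 < b ∧ ∀ θ : ι → ℝ,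
      (∀ n : ℤ, ∃ z : ℤ, ∑ j, θ j * ((p j).eval (K * n + r) - (p j).eval (r : ℤ) : ℤ) = z) →
      ∃ z : ℤ, b * θ j = z := by
    intro r j
    obtain ⟨b, hb, h⟩ := exists_int_mul_sum_of_mem_span
      (fun n : ℤ => fun j => (p j).eval (K * n + r) - (p j).eval (r : ℤ)) (Pi.single j 1)
      (by rw [span_values_eq_top p hp hp0 K hK r]; trivial)
    refine ⟨b, hb, fun θ hθ => ?_⟩
    obtain ⟨z, hz⟩ := h θ hθ
    refine ⟨z, ?_⟩
    rw [← hz]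
    congr 1
    rw [Fintype.sum_eq_single j (fun i hi => by simp [Pi.single_eq_of_ne hi])]
    simp
  choose b hb hbθ using hspan
  refine ⟨∏ r ∈ range K, ∏ j, b r j, prod_pos fun r _ => prod_pos fun j _ => hb r j,
    fun m hm θ hcθ j => ?_⟩
  set q : ℝ[X] := ∑ j, C (θ j) * (p j).map (Int.castRingHom ℝ) with hq
  have hqe : ∀ n : ℤ, q.eval (n : ℝ) = ∑ j, θ j * ((p j).eval n : ℤ) := by
    intro n
    rw [hq, eval_finsetSum]
    simp
  have hqd : q.natDegree ≤ univ.sup fun j => (p j).natDegree := by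
    refine natDegree_sum_le_of_forall_le _ _ fun j _ => ?_
    refine (natDegree_C_mul_le _ _).trans (natDegree_map_le.trans ?_)
    exact Finset.le_sup (f := fun j => (p j).natDegree) (mem_univ j)
  obtain ⟨r, hr, hrn⟩ := hKw m hm q hqd (by simpa only [hqe, ee_sum] using hcθ)
  obtain ⟨z, hz⟩ := hbθ r j θ (fun n => by
    have h1 := hrn n
    have h2 : ee (q.eval ((K * n + r : ℤ) : ℝ) - q.eval ((r : ℤ) : ℝ)) = 1 := by
      rw [ee_sub, h1, Int.cast_natCast, Complex.mul_conj, Complex.normSq_eq_norm_sq]; simp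
    obtain ⟨z, hz⟩ := (ee_eq_one_iff _).1 h2
    refine ⟨z, ?_⟩
    rw [← hz, hqe, hqe, ← sum_sub_distrib]
    refine sum_congr rfl fun j _ => ?_
    push_cast; ring)
  obtain ⟨e, he⟩ : b r j ∣ ∏ r ∈ range K, ∏ j, b r j :=
    (Finset.dvd_prod_of_mem (fun j => b r j) (mem_univ j)).trans
      (Finset.dvd_prod_of_mem (fun r => ∏ j, b r j) (Finset.mem_range.2 hr))
  refine ⟨z * e, ?_⟩
  rw [he]; push_cast; rw [← hz]; ring

/-! ### Bounded functions, actions, weak limits and van der Corput's inequality -/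

/-- Measurable functions bounded by one. -/
structure B1 {X : Type*} [MeasurableSpace X] (f : X → ℂ) : Prop where
  meas : Measurable f
  norm_le : ∀ x, ‖f x‖ ≤ 1

/-- A measure preserving action of `ℤ`. -/
structure IsAction {X : Type*} [MeasurableSpace X] (τ : ℤ → X → X) (μ : Measure X) : Prop where
  zero : ∀ x, τ 0 x = x
  add : ∀ a b x, τ (a + b) x = τ a (τ b x)
  mp : ∀ n, MeasurePreserving (τ n) μ μ

section

variable {X : Type*} [MeasurableSpace X] {μ : Measure X} {τ : ℤ → X → X}

lemma IsAction.meas (hτ : IsAction τ μ) (n : ℤ) : Measurable (τ n) := (hτ.mp n).measurable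

lemma IsAction.neg_apply (hτ : IsAction τ μ) (n : ℤ) (x : X) : τ n (τ (-n) x) = x := by
  rw [← hτ.add]; simp [hτ.zero]

lemma IsAction.apply_neg (hτ : IsAction τ μ) (n : ℤ) (x : X) : τ (-n) (τ n x) = x := by
  rw [← hτ.add]; simp [hτ.zero]

/-- Each element of the action as a measurable equivalence. -/
def IsAction.equiv (hτ : IsAction τ μ) (n : ℤ) : X ≃ᵐ X where
  toFun := τ n
  invFun := τ (-n)
  left_inv := hτ.apply_neg n
  right_inv := hτ.neg_apply n
  measurable_toFun := hτ.meas n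
  measurable_invFun := hτ.meas (-n)

lemma IsAction.integral_comp (hτ : IsAction τ μ) (n : ℤ) {E : Type*} [NormedAddCommGroup E]
    [NormedSpace ℝ E] (f : X → E) : ∫ x, f (τ n x) ∂μ = ∫ x, f x ∂μ :=
  (hτ.mp n).integral_comp (hτ.equiv n).measurableEmbedding f

namespace B1

variable {f g : X → ℂ}

lemma one : B1 (fun _ : X => (1 : ℂ)) := ⟨measurable_const, by simp⟩

lemma const {c : ℂ} (hc : ‖c‖ ≤ 1) : B1 (fun _ : X => c) := ⟨measurable_const, fun _ => hc⟩

lemma mul (hf : B1 f) (hg : B1 g) : B1 (fun x => f x * g x) :=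
  ⟨hf.meas.mul hg.meas, fun x => by
    rw [norm_mul]; exact mul_le_one₀ (hf.norm_le x) (norm_nonneg _) (hg.norm_le x)⟩

lemma conj (hf : B1 f) : B1 (fun x => (starRingEnd ℂ) (f x)) :=
  ⟨Complex.continuous_conj.measurable.comp hf.meas, fun x => by
    rw [RCLike.norm_conj]; exact hf.norm_le x⟩

lemma comp {Y : Type*} [MeasurableSpace Y] (hf : B1 f) {t : Y → X} (ht : Measurable t) :
    B1 (fun y => f (t y)) :=
  ⟨hf.meas.comp ht, fun _ => hf.norm_le _⟩

lemma prod {ι : Type*} (s : Finset ι) {f : ι → X → ℂ} (hf : ∀ i ∈ s, B1 (f i)) :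
    B1 (fun x => ∏ i ∈ s, f i x) :=
  ⟨Finset.measurable_fun_prod s fun i hi => (hf i hi).meas, fun x => by
    rw [norm_prod]
    exact prod_le_one (fun _ _ => norm_nonneg _) fun i hi => (hf i hi).norm_le x⟩

lemma integrable [IsFiniteMeasure μ] (hf : B1 f) : Integrable f μ :=
  Integrable.of_bound hf.meas.aestronglyMeasurable 1 (Eventually.of_forall hf.norm_le)

lemma norm_integral_le [IsProbabilityMeasure μ] (hf : B1 f) : ‖∫ x, f x ∂μ‖ ≤ 1 := by
  have := norm_integral_le_of_norm_le_const (μ := μ) (Eventually.of_forall hf.norm_le)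
  simpa using this

end B1

lemma norm_integral_sq_le [IsProbabilityMeasure μ] {f : X → ℂ} {C : ℝ} (hf : Measurable f)
    (hC : ∀ x, ‖f x‖ ≤ C) : ‖∫ x, f x ∂μ‖ ^ 2 ≤ ∫ x, ‖f x‖ ^ 2 ∂μ := by
  have hi : Integrable (fun x => ‖f x‖) μ :=
    Integrable.of_bound hf.norm.aestronglyMeasurable C (Eventually.of_forall (by simpa using hC))
  have hi2 : Integrable (fun x => ‖f x‖ ^ 2) μ :=
    Integrable.of_bound (hf.norm.pow_const 2).aestronglyMeasurable (C ^ 2)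
      (Eventually.of_forall fun x => by
        rw [Real.norm_of_nonneg (by positivity)]; have := hC x; gcongr)
  have h1 := norm_integral_le_integral_norm (μ := μ) f
  set t := ∫ x, ‖f x‖ ∂μ with ht
  have h2 : 0 ≤ ∫ x, (‖f x‖ - t) ^ 2 ∂μ := integral_nonneg fun x => by positivity
  have h3 : ∫ x, (‖f x‖ - t) ^ 2 ∂μ = (∫ x, ‖f x‖ ^ 2 ∂μ) - t ^ 2 := by
    have : ∀ x, (‖f x‖ - t) ^ 2 = ‖f x‖ ^ 2 - 2 * t * ‖f x‖ + t ^ 2 := fun x => by ring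
    simp_rw [this]
    have hi3 : Integrable (fun x => ‖f x‖ ^ 2 - 2 * t * ‖f x‖) μ := hi2.sub (hi.const_mul _)
    rw [integral_add hi3 (integrable_const _),
      integral_sub hi2 (hi.const_mul _), integral_const_mul, ← ht]
    simp; ring
  have h4 : ‖∫ x, f x ∂μ‖ ^ 2 ≤ t ^ 2 := by gcongr
  linarith

/-- Weak limits along a mean are represented by bounded functions. -/
theorem exists_weak_limit [IsProbabilityMeasure μ] {m : (ℤ → ℂ) →ₗ[ℂ] ℂ} (hm : IsMean m)
    (g : ℤ → X → ℂ) (hg : ∀ n, B1 (g n)) :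
    ∃ D : X → ℂ, B1 D ∧ ∀ φ : X → ℂ, Measurable φ → (∃ C : ℝ, ∀ x, ‖φ x‖ ≤ C) →
      ∫ x, φ x * D x ∂μ = m (fun n => ∫ x, φ x * g n x ∂μ) := by
  have hintg : ∀ (φ : Lp ℂ 2 μ) n, Integrable (fun x => φ x * g n x) μ := fun φ n =>
    ((Lp.memLp φ).integrable (by norm_num)).mul_bdd (c := 1) (hg n).meas.aestronglyMeasurable
      (Eventually.of_forall (hg n).norm_le)
  have hL1 : ∀ φ : Lp ℂ 2 μ, ∫ x, ‖φ x‖ ∂μ ≤ ‖φ‖ := by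
    intro φ
    have h1 := (Lp.memLp φ).aestronglyMeasurable
    have h2 : eLpNorm φ 1 μ ≤ eLpNorm φ 2 μ :=
      eLpNorm_le_eLpNorm_of_exponent_le (by norm_num) h1
    rw [Lp.norm_def, ← ENNReal.toReal_ofReal (integral_nonneg fun x => norm_nonneg (φ x))]
    refine ENNReal.toReal_mono (Lp.eLpNorm_ne_top φ) ?_
    refine le_trans (le_of_eq ?_) h2
    rw [eLpNorm_one_eq_lintegral_enorm, ofReal_integral_norm_eq_lintegral_enorm
      ((Lp.memLp φ).integrable (by norm_num))]
  have hbd : ∀ (φ : Lp ℂ 2 μ) n, ‖∫ x, φ x * g n x ∂μ‖ ≤ ‖φ‖ := by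
    intro φ n
    refine (norm_integral_le_integral_norm _).trans (le_trans ?_ (hL1 φ))
    refine integral_mono (hintg φ n).norm ((Lp.memLp φ).integrable (by norm_num)).norm fun x => ?_
    simp only [norm_mul]
    exact mul_le_of_le_one_right (norm_nonneg _) ((hg n).norm_le x)
  let ℓ₀ : Lp ℂ 2 μ →ₗ[ℂ] ℂ :=
    { toFun := fun φ => m (fun n => ∫ x, φ x * g n x ∂μ)
      map_add' := fun φ ψ => by
        rw [← IsMean.map_add']
        congr 1; ext n
        rw [← integral_add (hintg φ n) (hintg ψ n)]
        refine integral_congr_ae ?_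
        filter_upwards [Lp.coeFn_add φ ψ] with x hx
        rw [hx, Pi.add_apply, add_mul]
      map_smul' := fun c φ => by
        rw [RingHom.id_apply, smul_eq_mul, ← IsMean.map_mul_left]
        congr 1; ext n
        rw [← integral_const_mul]
        refine integral_congr_ae ?_
        filter_upwards [Lp.coeFn_smul c φ] with x hx
        rw [hx, Pi.smul_apply, smul_eq_mul, mul_assoc] }
  let ℓ : Lp ℂ 2 μ →L[ℂ] ℂ := ℓ₀.mkContinuous 1 (fun φ => by
    rw [one_mul]; exact hm.norm_le _ _ (hbd φ))
  set w := (InnerProductSpace.toDual ℂ (Lp ℂ 2 μ)).symm ℓ with hw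
  have hwi : ∀ φ : X → ℂ, ∀ hφ : MemLp φ 2 μ, ∫ x, φ x * (starRingEnd ℂ) (w x) ∂μ =
      m (fun n => ∫ x, φ x * g n x ∂μ) := by
    intro φ hφ
    have h1 : inner ℂ w (hφ.toLp φ) = ℓ (hφ.toLp φ) := by
      rw [hw, InnerProductSpace.toDual_symm_apply]
    rw [L2.inner_def] at h1
    have h2 : ℓ (hφ.toLp φ) = m (fun n => ∫ x, φ x * g n x ∂μ) := by
      change m (fun n => ∫ x, (hφ.toLp φ) x * g n x ∂μ) = _
      congr 1; ext n
      refine integral_congr_ae ?_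
      filter_upwards [hφ.coeFn_toLp] with x hx
      rw [hx]
    rw [← h2, ← h1]
    refine integral_congr_ae ?_
    filter_upwards [hφ.coeFn_toLp] with x hx
    rw [hx]; simp [RCLike.inner_apply]
  have hwm : MemLp w 2 μ := Lp.memLp w
  obtain ⟨D₀, hD₀m, hD₀⟩ : ∃ D₀ : X → ℂ, Measurable D₀ ∧
      (fun x => (starRingEnd ℂ) (w x)) =ᵐ[μ] D₀ := by
    have h1 : AEMeasurable (fun x => (starRingEnd ℂ) (w x)) μ :=
      Complex.continuous_conj.measurable.comp_aemeasurable hwm.aestronglyMeasurable.aemeasurable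
    exact ⟨h1.mk _, h1.measurable_mk, h1.ae_eq_mk⟩
  have hD₀i : Integrable D₀ μ := by
    refine Integrable.congr ?_ hD₀
    exact (Complex.conjCLE.toContinuousLinearMap.integrable_comp
      (hwm.integrable (by norm_num)))
  have hD₀e : ∀ φ : X → ℂ, MemLp φ 2 μ → ∫ x, φ x * D₀ x ∂μ =
      m (fun n => ∫ x, φ x * g n x ∂μ) := by
    intro φ hφ
    rw [← hwi φ hφ]
    refine integral_congr_ae ?_
    filter_upwards [hD₀] with x hx
    rw [hx]
  have hbm : ∀ φ : X → ℂ, Measurable φ → (∃ C : ℝ, ∀ x, ‖φ x‖ ≤ C) → MemLp φ 2 μ :=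
    fun φ hφ ⟨C, hC⟩ => MemLp.of_bound hφ.aestronglyMeasurable C (Eventually.of_forall hC)
  -- the set where the density exceeds one is null
  set A : Set X := {x | 1 < ‖D₀ x‖} with hA
  have hAm : MeasurableSet A := measurableSet_lt measurable_const hD₀m.norm
  have hA0 : μ A = 0 := by
    set φ : X → ℂ := A.indicator (fun x => (starRingEnd ℂ) (D₀ x) / ‖D₀ x‖) with hφ
    have hφm : Measurable φ :=
      ((Complex.continuous_conj.measurable.comp hD₀m).div
        (Complex.measurable_ofReal.comp hD₀m.norm)).indicator hAm
    have hφn : ∀ x, ‖φ x‖ ≤ A.indicator (fun _ => (1 : ℝ)) x := by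
      intro x
      by_cases hx : x ∈ A
      · simp only [hφ, Set.indicator_of_mem hx, norm_div, RCLike.norm_conj, Complex.norm_real,
          norm_norm]
        exact div_self_le_one _
      · simp [hφ, Set.indicator_of_notMem hx]
    have hφ1 : ∀ x, ‖φ x‖ ≤ 1 := fun x => (hφn x).trans (Set.indicator_le_self' (by simp) x)
    have h1 := hD₀e φ (hbm φ hφm ⟨1, hφ1⟩)
    have h2 : ‖m (fun n => ∫ x, φ x * g n x ∂μ)‖ ≤ μ.real A := by
      refine hm.norm_le _ _ fun n => ?_
      calc _ ≤ ∫ x, A.indicator (fun _ => (1 : ℝ)) x ∂μ := by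
            refine norm_integral_le_of_norm_le ((integrable_const _).indicator hAm)
              (Eventually.of_forall fun x => ?_)
            rw [norm_mul]
            exact (mul_le_of_le_one_right (norm_nonneg _) ((hg n).norm_le x)).trans (hφn x)
        _ = _ := by rw [integral_indicator_const _ hAm]; simp
    have h3 : ∫ x, φ x * D₀ x ∂μ = ((∫ x in A, ‖D₀ x‖ ∂μ : ℝ) : ℂ) := by
      rw [← integral_indicator hAm, ← integral_complex_ofReal]
      congr 1; ext x
      by_cases hx : x ∈ A
      · simp only [hφ, Set.indicator_of_mem hx]
        have : (‖D₀ x‖ : ℂ) ≠ 0 := by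
          have h0 : (1 : ℝ) < ‖D₀ x‖ := hx
          simp only [ne_eq, Complex.ofReal_eq_zero]; linarith
        rw [div_mul_eq_mul_div, mul_comm, Complex.mul_conj, Complex.normSq_eq_norm_sq]
        field_simp; push_cast; ring
      · simp [hφ, Set.indicator_of_notMem hx]
    rw [← h1, h3, Complex.norm_real, Real.norm_of_nonneg (integral_nonneg fun x => norm_nonneg _)]
      at h2
    have h4 : ∫ x in A, (‖D₀ x‖ - 1) ∂μ ≤ 0 := by
      rw [integral_sub hD₀i.norm.integrableOn (integrable_const _)]
      simp; exact h2
    have h5 : 0 ≤ᵐ[μ.restrict A] fun x => ‖D₀ x‖ - 1 := by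
      refine (ae_restrict_iff' hAm).2 (Eventually.of_forall fun x hx => ?_)
      have : (1 : ℝ) < ‖D₀ x‖ := hx
      simp; linarith
    have h6 := (integral_eq_zero_iff_of_nonneg_ae h5
      ((hD₀i.norm.sub (integrable_const 1)).integrableOn)).1
      (le_antisymm h4 (integral_nonneg_of_ae h5))
    have h7 : ∀ᵐ x ∂μ, x ∉ A := by
      filter_upwards [(ae_restrict_iff' hAm).1 h6] with x hx hxA
      have h8 := hx hxA
      have : (1 : ℝ) < ‖D₀ x‖ := hxA
      simp at h8; linarith
    simpa [ae_iff] using h7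
  refine ⟨Aᶜ.indicator D₀, ⟨hD₀m.indicator hAm.compl, fun x => ?_⟩, fun φ hφm hφb => ?_⟩
  · by_cases hx : x ∈ A
    · simp [hx]
    · rw [Set.indicator_of_mem (by simpa using hx)]; simpa [hA] using hx
  · rw [← hD₀e φ (hbm φ hφm hφb)]
    refine integral_congr_ae ?_
    have h7 : ∀ᵐ x ∂μ, x ∉ A := by simpa [ae_iff] using hA0
    filter_upwards [h7] with x hx
    rw [Set.indicator_of_mem (by simpa using hx)]

/-- Van der Corput's inequality. -/
theorem vdc [IsProbabilityMeasure μ] {m : (ℤ → ℂ) →ₗ[ℂ] ℂ} (hm : IsMean m)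
    (f : X → ℂ) (hf : B1 f) (u : ℤ → X → ℂ) (hu : ∀ n, B1 (u n)) (A : Finset ℤ) :
    (#A : ℝ) ^ 2 * ‖m (fun n => ∫ x, f x * u n x ∂μ)‖ ^ 2 ≤
      ∑ h ∈ A, ∑ h' ∈ A,
        (m (fun n => ∫ x, u (n + h) x * (starRingEnd ℂ) (u (n + h') x) ∂μ)).re := by
  have hb : ∀ n, ‖∫ x, f x * u n x ∂μ‖ ≤ 1 := fun n => (hf.mul (hu n)).norm_integral_le
  have h1 : (#A : ℂ) * m (fun n => ∫ x, f x * u n x ∂μ) =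
      m (fun n => ∫ x, f x * ∑ h ∈ A, u (n + h) x ∂μ) := by
    have : ∀ n, ∫ x, f x * ∑ h ∈ A, u (n + h) x ∂μ = ∑ h ∈ A, ∫ x, f x * u (n + h) x ∂μ := by
      intro n
      simp_rw [mul_sum]
      exact integral_finsetSum _ fun h _ => (hf.mul (hu _)).integrable
    simp_rw [this]
    rw [IsMean.map_sum', sum_congr rfl fun h _ => hm.shift _ 1 h hb]
    simp
  have hsm : ∀ n, Measurable (fun x => ∑ h ∈ A, u (n + h) x) := fun n =>
    Finset.measurable_fun_sum _ fun h _ => (hu _).meas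
  have hsb : ∀ n x, ‖∑ h ∈ A, u (n + h) x‖ ≤ #A := fun n x =>
    (norm_sum_le _ _).trans ((sum_le_sum fun h _ => (hu _).norm_le x).trans (by simp))
  have hfb : ∀ n x, ‖f x * ∑ h ∈ A, u (n + h) x‖ ≤ #A := fun n x => by
    rw [norm_mul]
    exact (mul_le_of_le_one_left (norm_nonneg _) (hf.norm_le x)).trans (hsb n x)
  have hFb : ∀ n, ‖∫ x, f x * ∑ h ∈ A, u (n + h) x ∂μ‖ ≤ #A := fun n => by
    have := norm_integral_le_of_norm_le_const (μ := μ) (Eventually.of_forall (hfb n))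
    simpa using this
  have h2 := hm.norm_sq_le hFb
  have h3 : ∀ n, (∑ h ∈ A, ∑ h' ∈ A, ∫ x, u (n + h) x * (starRingEnd ℂ) (u (n + h') x) ∂μ) =
      ((∫ x, ‖∑ h ∈ A, u (n + h) x‖ ^ 2 ∂μ : ℝ) : ℂ) := by
    intro n
    rw [← integral_complex_ofReal]
    rw [sum_congr rfl fun h _ => (integral_finsetSum _ fun h' _ =>
      ((hu (n + h)).mul (hu (n + h')).conj).integrable).symm]
    rw [← integral_finsetSum _ fun h _ => integrable_finsetSum _ fun h' _ =>
      ((hu (n + h)).mul (hu (n + h')).conj).integrable]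
    congr 1; ext x
    rw [← sum_mul_sum, ← map_sum, Complex.mul_conj, Complex.normSq_eq_norm_sq]
  have hb3 : ∀ n, ‖∑ h ∈ A, ∑ h' ∈ A, ∫ x, u (n + h) x * (starRingEnd ℂ) (u (n + h') x) ∂μ‖
      ≤ ∑ h ∈ A, ∑ h' ∈ A, 1 := fun n =>
    norm_sum_le_of_le _ fun h _ => norm_sum_le_of_le _ fun h' _ =>
      ((hu (n + h)).mul (hu (n + h')).conj).norm_integral_le
  have h4 := hm.re_mono (F := fun n => ((‖∫ x, f x * ∑ h ∈ A, u (n + h) x ∂μ‖ ^ 2 : ℝ) : ℂ))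
    (G := fun n => ∑ h ∈ A, ∑ h' ∈ A, ∫ x, u (n + h) x * (starRingEnd ℂ) (u (n + h') x) ∂μ)
    (C := (#A : ℝ) ^ 2) (D := ∑ h ∈ A, ∑ h' ∈ A, 1)
    (fun n => by
      rw [Complex.norm_real, Real.norm_of_nonneg (by positivity)]
      have := hFb n; gcongr) hb3
    (fun n => by
      rw [h3, Complex.ofReal_re, Complex.ofReal_re]
      refine (norm_integral_sq_le (hf.meas.mul (hsm n)) (hfb n)).trans ?_
      refine integral_mono_of_nonneg (Eventually.of_forall fun x => by positivity)
        (Integrable.of_bound ((hsm n).norm.pow_const 2).aestronglyMeasurable ((#A : ℝ) ^ 2)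
          (Eventually.of_forall fun x => by
            rw [Real.norm_of_nonneg (by positivity)]; have := hsb n x; gcongr))
        (Eventually.of_forall fun x => ?_)
      refine pow_le_pow_left₀ (norm_nonneg _) ?_ 2
      rw [Pi.mul_apply, norm_mul]
      exact mul_le_of_le_one_left (norm_nonneg _) (hf.norm_le x))
  rw [← h1, norm_mul, Complex.norm_natCast, mul_pow] at h2
  refine (h2.trans h4).trans_eq ?_
  simp [IsMean.map_sum', Complex.re_sum]

end

/-! ### Cubes and the box Cauchy–Schwarz inequality -/

/-- The product of `φ`, with conjugations, over the vertices of the cube spanned by `h` and `v`;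
the vertex `v` is not conjugated. -/
noncomputable def cube : (r : ℕ) → ((Fin r → ℤ) → ℂ) → (Fin r → ℤ) → (Fin r → ℤ) → ℂ
  | 0, φ, _, v => φ v
  | r + 1, φ, h, v =>
    (starRingEnd ℂ) (cube r (fun k => φ (Fin.cons (h 0) k)) (Fin.tail h) (Fin.tail v)) *
      cube r (fun k => φ (Fin.cons (v 0) k)) (Fin.tail h) (Fin.tail v)

/-- The part of `cube` coming from the vertices other than the top one. -/
noncomputable def cubeRest : (r : ℕ) → ((Fin r → ℤ) → ℂ) → (Fin r → ℤ) → (Fin r → ℤ) → ℂ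
  | 0, _, _, _ => 1
  | r + 1, φ, h, v =>
    (starRingEnd ℂ) (cube r (fun k => φ (Fin.cons (h 0) k)) (Fin.tail h) (Fin.tail v)) *
      cubeRest r (fun k => φ (Fin.cons (v 0) k)) (Fin.tail h) (Fin.tail v)

/-- The signed sum of `f` over the vertices of a cube. -/
noncomputable def cubeSum : (r : ℕ) → ((Fin r → ℤ) → ℝ) → (Fin r → ℤ) → (Fin r → ℤ) → ℝ
  | 0, f, _, v => f v
  | r + 1, f, h, v =>
    cubeSum r (fun k => f (Fin.cons (v 0) k)) (Fin.tail h) (Fin.tail v) -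
      cubeSum r (fun k => f (Fin.cons (h 0) k)) (Fin.tail h) (Fin.tail v)

lemma cube_eq_mul_cubeRest (r : ℕ) (φ : (Fin r → ℤ) → ℂ) (h h' : Fin r → ℤ) :
    cube r φ h h' = φ h' * cubeRest r φ h h' := by
  induction r with
  | zero => simp [cube, cubeRest]
  | succ r ih =>
    rw [cube, cubeRest, ih (fun k => φ (Fin.cons (h' 0) k)), Fin.cons_self_tail]; ring

lemma cube_mul (r : ℕ) (φ ψ : (Fin r → ℤ) → ℂ) (h h' : Fin r → ℤ) :
    cube r (fun k => φ k * ψ k) h h' = cube r φ h h' * cube r ψ h h' := by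
  induction r with
  | zero => simp [cube]
  | succ r ih => simp only [cube, ih, map_mul]; ring

lemma cube_conj (r : ℕ) (φ : (Fin r → ℤ) → ℂ) (h h' : Fin r → ℤ) :
    cube r (fun k => (starRingEnd ℂ) (φ k)) h h' = (starRingEnd ℂ) (cube r φ h h') := by
  induction r with
  | zero => simp [cube]
  | succ r ih => simp only [cube, ih, map_mul]

lemma cube_one (r : ℕ) (h h' : Fin r → ℤ) : cube r (fun _ => 1) h h' = 1 := by
  induction r with
  | zero => simp [cube]
  | succ r ih => simp only [cube, ih, map_one, mul_one]

lemma cube_prod (r : ℕ) {ι : Type*} (s : Finset ι) (φ : ι → (Fin r → ℤ) → ℂ) (h h' : Fin r → ℤ) :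
    cube r (fun k => ∏ i ∈ s, φ i k) h h' = ∏ i ∈ s, cube r (φ i) h h' := by
  classical
  induction s using Finset.induction_on with
  | empty => simp [cube_one]
  | insert a s ha ih => simp only [prod_insert ha, cube_mul, ih]

lemma norm_cube_const (r : ℕ) (c : ℂ) (hc : ‖c‖ = 1) (h h' : Fin r → ℤ) :
    ‖cube r (fun _ => c) h h'‖ = 1 := by
  induction r with
  | zero => simpa [cube]
  | succ r ih => simp only [cube, norm_mul, RCLike.norm_conj, ih, mul_one]

lemma cube_succ_const (r : ℕ) (c : ℂ) (hc : ‖c‖ = 1) (h h' : Fin (r + 1) → ℤ) :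
    cube (r + 1) (fun _ => c) h h' = 1 := by
  rw [cube, mul_comm, Complex.mul_conj, Complex.normSq_eq_norm_sq, norm_cube_const r c hc]
  simp

lemma norm_cube_le (r : ℕ) {φ : (Fin r → ℤ) → ℂ} (hφ : ∀ k, ‖φ k‖ ≤ 1) (h h' : Fin r → ℤ) :
    ‖cube r φ h h'‖ ≤ 1 := by
  induction r with
  | zero => exact hφ _
  | succ r ih =>
    rw [cube, norm_mul, RCLike.norm_conj]
    exact mul_le_one₀ (ih (fun k => hφ _) _ _) (norm_nonneg _) (ih (fun k => hφ _) _ _)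

lemma norm_cubeRest_le (r : ℕ) {φ : (Fin r → ℤ) → ℂ} (hφ : ∀ k, ‖φ k‖ ≤ 1) (h h' : Fin r → ℤ) :
    ‖cubeRest r φ h h'‖ ≤ 1 := by
  induction r with
  | zero => simp [cubeRest]
  | succ r ih =>
    rw [cubeRest, norm_mul, RCLike.norm_conj]
    exact mul_le_one₀ (norm_cube_le r (fun k => hφ _) _ _) (norm_nonneg _) (ih (fun k => hφ _) _ _)

lemma cube_shift (r : ℕ) (φ : (Fin r → ℤ) → ℂ) (v h h' : Fin r → ℤ) :
    cube r (fun k => φ (k + v)) h h' = cube r φ (h + v) (h' + v) := by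
  induction r with
  | zero => simp [cube]
  | succ r ih =>
    have h1 : ∀ (a : ℤ) (k : Fin r → ℤ), (Fin.cons a k : Fin (r + 1) → ℤ) + v =
        Fin.cons (a + v 0) (k + Fin.tail v) := by
      intro a k; ext j
      refine Fin.cases ?_ (fun j => ?_) j <;> simp [Fin.tail]
    have h2 : ∀ h : Fin (r + 1) → ℤ, Fin.tail (h + v) = Fin.tail h + Fin.tail v := fun h => rfl
    simp only [cube, h1, h2, Pi.add_apply]
    rw [ih (fun k => φ (Fin.cons (h 0 + v 0) k)), ih (fun k => φ (Fin.cons (h' 0 + v 0) k))]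

section

variable {X : Type*} [MeasurableSpace X]

lemma measurable_cube (r : ℕ) {φ : X → (Fin r → ℤ) → ℂ} (hφ : ∀ k, Measurable fun x => φ x k)
    (h h' : Fin r → ℤ) : Measurable fun x => cube r (φ x) h h' := by
  induction r with
  | zero => exact hφ _
  | succ r ih =>
    simp only [cube]
    exact (Complex.continuous_conj.measurable.comp (ih (fun k => hφ _) _ _)).mul
      (ih (fun k => hφ _) _ _)

lemma measurable_cubeRest (r : ℕ) {φ : X → (Fin r → ℤ) → ℂ}
    (hφ : ∀ k, Measurable fun x => φ x k) (h h' : Fin r → ℤ) :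
    Measurable fun x => cubeRest r (φ x) h h' := by
  induction r with
  | zero => exact measurable_const
  | succ r ih =>
    simp only [cubeRest]
    exact (Complex.continuous_conj.measurable.comp (measurable_cube r (fun k => hφ _) _ _)).mul
      (ih (fun k => hφ _) _ _)

lemma B1.cube (r : ℕ) {φ : X → (Fin r → ℤ) → ℂ} (hφ : ∀ k, B1 fun x => φ x k)
    (h h' : Fin r → ℤ) : B1 fun x => cube r (φ x) h h' :=
  ⟨measurable_cube r (fun k => (hφ k).meas) h h',
    fun x => norm_cube_le r (fun k => (hφ k).norm_le x) h h'⟩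

lemma B1.cubeRest (r : ℕ) {φ : X → (Fin r → ℤ) → ℂ} (hφ : ∀ k, B1 fun x => φ x k)
    (h h' : Fin r → ℤ) : B1 fun x => cubeRest r (φ x) h h' :=
  ⟨measurable_cubeRest r (fun k => (hφ k).meas) h h',
    fun x => norm_cubeRest_le r (fun k => (hφ k).norm_le x) h h'⟩

end

/-- Products of bounded functions each of which misses a coordinate. -/
def Low {r : ℕ} (b : (Fin r → ℤ) → ℂ) : Prop :=
  ∃ B : Fin r → (Fin r → ℤ) → ℂ, (∀ j h, ‖B j h‖ ≤ 1) ∧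
    (∀ j h k, B j (Function.update h j k) = B j h) ∧ ∀ h, b h = ∏ j, B j h

namespace Low

variable {r : ℕ} {b b' : (Fin r → ℤ) → ℂ}

lemma mul (hb : Low b) (hb' : Low b') : Low fun h => b h * b' h := by
  obtain ⟨B, h1, h2, h3⟩ := hb
  obtain ⟨B', h1', h2', h3'⟩ := hb'
  refine ⟨fun j h => B j h * B' j h, fun j h => ?_, fun j h k => by simp only [h2, h2'],
      fun h => ?_⟩
  · rw [norm_mul]; exact mul_le_one₀ (h1 j h) (norm_nonneg _) (h1' j h)
  · simp only [h3, h3', prod_mul_distrib]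

lemma conj (hb : Low b) : Low fun h => (starRingEnd ℂ) (b h) := by
  obtain ⟨B, h1, h2, h3⟩ := hb
  refine ⟨fun j h => (starRingEnd ℂ) (B j h), fun j h => ?_, fun j h k => by simp only [h2],
      fun h => ?_⟩
  · rw [RCLike.norm_conj]; exact h1 j h
  · simp only [h3, map_prod]

end Low

lemma low_cubeRest (r : ℕ) {φ : (Fin r → ℤ) → ℂ} (hφ : ∀ k, ‖φ k‖ ≤ 1) (h : Fin r → ℤ) :
    Low (cubeRest r φ h) := by
  induction r with
  | zero => exact ⟨fun _ _ => 1, by simp, by simp, by simp [cubeRest]⟩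
  | succ r ih =>
    have hl : ∀ a : ℤ, Low (cubeRest r (fun k => φ (Fin.cons a k)) (Fin.tail h)) :=
      fun a => ih (fun k => hφ _) _
    choose B h1 h2 h3 using hl
    refine ⟨Fin.cons (fun h' => (starRingEnd ℂ)
      (cube r (fun k => φ (Fin.cons (h 0) k)) (Fin.tail h) (Fin.tail h')))
      (fun j h' => B (h' 0) j (Fin.tail h')), fun j h' => ?_, fun j h' k => ?_, fun h' => ?_⟩
    · refine Fin.cases ?_ (fun j => ?_) j
      · simp only [Fin.cons_zero, RCLike.norm_conj]
        exact norm_cube_le r (fun k => hφ _) _ _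
      · simp only [Fin.cons_succ]; exact h1 _ _ _
    · refine Fin.cases ?_ (fun j => ?_) j
      · simp only [Fin.cons_zero, Fin.tail_update_zero]
      · simp only [Fin.cons_succ, Fin.tail_update_succ, h2]
        rw [Function.update_of_ne (Fin.succ_ne_zero j).symm]
    · rw [Fin.prod_univ_succ]
      simp only [Fin.cons_zero, Fin.cons_succ, cubeRest]
      rw [h3]

lemma sum_piFinset_succ {M : Type*} [AddCommMonoid M] {r : ℕ} (Ω : Fin (r + 1) → Finset ℤ)
    (F : (Fin (r + 1) → ℤ) → M) :
    ∑ h ∈ Fintype.piFinset Ω, F h =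
      ∑ k ∈ Ω 0, ∑ h ∈ Fintype.piFinset (Fin.tail Ω), F (Fin.cons k h) := by
  rw [← sum_product']
  refine sum_nbij' (fun h => (h 0, Fin.tail h)) (fun q => Fin.cons q.1 q.2) ?_ ?_ ?_ ?_ ?_
  · intro h hh
    rw [Fintype.mem_piFinset] at hh
    rw [mem_product, Fintype.mem_piFinset]
    exact ⟨hh 0, fun j => hh j.succ⟩
  · rintro ⟨k, h⟩ hq
    rw [mem_product, Fintype.mem_piFinset] at hq
    rw [Fintype.mem_piFinset]
    intro j
    refine Fin.cases ?_ (fun j => ?_) j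
    · exact hq.1
    · exact hq.2 j
  · intro h _; exact Fin.cons_self_tail h
  · rintro ⟨k, h⟩ _; simp
  · intro h _; rw [Fin.cons_self_tail]

lemma card_piFinset_succ {r : ℕ} (Ω : Fin (r + 1) → Finset ℤ) :
    #(Fintype.piFinset Ω) = #(Ω 0) * #(Fintype.piFinset (Fin.tail Ω)) := by
  simp [Fintype.card_piFinset, Fin.prod_univ_succ, Fin.tail]

lemma pow_sum_le_card_pow_mul {ι : Type*} (s : Finset ι) (f : ι → ℝ) (hf : ∀ i ∈ s, 0 ≤ f i)
    (n : ℕ) : (∑ i ∈ s, f i) ^ (n + 1) ≤ (#s : ℝ) ^ n * ∑ i ∈ s, f i ^ (n + 1) := by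
  rcases s.eq_empty_or_nonempty with rfl | hs
  · simp
  have h := pow_sum_div_card_le_sum_pow hf n
  have : (0 : ℝ) < (#s : ℝ) ^ n := pow_pos (by exact_mod_cast hs.card_pos) _
  rwa [div_le_iff₀' this] at h

/-- The box Cauchy–Schwarz inequality. -/
theorem box_cauchy_schwarz (r : ℕ) (Ω : Fin (r + 1) → Finset ℤ) (φ b : (Fin (r + 1) → ℤ) → ℂ)
    (hb : Low b) :
    (#(Fintype.piFinset Ω) : ℝ) ^ 2 * ‖∑ h ∈ Fintype.piFinset Ω, φ h * b h‖ ^ 2 ^ (r + 1) ≤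
      (#(Fintype.piFinset Ω) : ℝ) ^ 2 ^ (r + 1) *
        (∑ h ∈ Fintype.piFinset Ω, ∑ h' ∈ Fintype.piFinset Ω, cube (r + 1) φ h h').re := by
  induction r with
  | zero =>
    obtain ⟨B, h1, h2, h3⟩ := hb
    have : Subsingleton (Fin (0 + 1)) := inferInstanceAs (Subsingleton (Fin 1))
    have hprod : ∀ h, ∏ j : Fin (0 + 1), B j h = B 0 h := fun h => Fin.prod_univ_one _
    have hconst : ∀ h, b h = b 0 := by
      intro h
      have : Function.update h 0 0 = 0 := by
        ext j; rw [Subsingleton.elim j 0]; simp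
      rw [h3, h3, hprod, hprod, ← this, h2]
    have hb1 : ‖b 0‖ ≤ 1 := by rw [h3, hprod]; exact h1 0 0
    have hcube : ∀ h h', cube 1 φ h h' = (starRingEnd ℂ) (φ h) * φ h' := by
      intro h h'
      have : ∀ k : Fin 0 → ℤ, ∀ h : Fin 1 → ℤ, (Fin.cons (h 0) k : Fin 1 → ℤ) = h := by
        intro k h; ext j; rw [Subsingleton.elim j 0]; simp
      simp only [cube, this]
    simp only [zero_add, pow_one]
    gcongr
    simp_rw [hconst, hcube]
    rw [← sum_mul, ← sum_mul_sum, ← map_sum, mul_comm ((starRingEnd ℂ) _), Complex.mul_conj,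
      Complex.normSq_eq_norm_sq, Complex.ofReal_re, norm_mul]
    gcongr
    exact mul_le_of_le_one_right (norm_nonneg _) hb1
  | succ r ih =>
    obtain ⟨B, h1, h2, h3⟩ := hb
    set Ω' := Fin.tail Ω with hΩ'
    set P := Fintype.piFinset Ω' with hP
    set b' : ℤ → (Fin (r + 1) → ℤ) → ℂ := fun k h => ∏ j : Fin (r + 1), B j.succ (Fin.cons k h)
      with hb'
    have hlow : ∀ k, Low (b' k) := fun k =>
      ⟨fun j h => B j.succ (Fin.cons k h), fun j h => h1 _ _, fun j h v => by
        simp only [Fin.cons_update, h2], fun h => rfl⟩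
    have hB0 : ∀ k h, B 0 (Fin.cons k h) = B 0 (Fin.cons 0 h) := by
      intro k h
      rw [← h2 0 (Fin.cons k h) 0, Fin.update_cons_zero]
    set T : ℤ → ℤ → ℂ := fun k k' => ∑ h ∈ P,
      ((starRingEnd ℂ) (φ (Fin.cons k h)) * φ (Fin.cons k' h)) *
        ((starRingEnd ℂ) (b' k h) * b' k' h) with hT
    have hS : ∑ h ∈ Fintype.piFinset Ω, φ h * b h =
        ∑ h ∈ P, B 0 (Fin.cons 0 h) * ∑ k ∈ Ω 0, φ (Fin.cons k h) * b' k h := by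
      rw [sum_piFinset_succ, sum_comm]
      refine sum_congr rfl fun h _ => ?_
      rw [mul_sum]
      refine sum_congr rfl fun k _ => ?_
      rw [h3, Fin.prod_univ_succ, hB0]; ring
    have hCS : ‖∑ h ∈ Fintype.piFinset Ω, φ h * b h‖ ^ 2 ≤
        #P * ∑ k ∈ Ω 0, ∑ k' ∈ Ω 0, ‖T k k'‖ := by
      rw [hS]
      have e1 : ‖∑ h ∈ P, B 0 (Fin.cons 0 h) * ∑ k ∈ Ω 0, φ (Fin.cons k h) * b' k h‖ ≤
          ∑ h ∈ P, ‖∑ k ∈ Ω 0, φ (Fin.cons k h) * b' k h‖ := by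
        refine (norm_sum_le _ _).trans (sum_le_sum fun h _ => ?_)
        rw [norm_mul]; exact mul_le_of_le_one_left (norm_nonneg _) (h1 _ _)
      have e2 := sq_sum_le_card_mul_sum_sq (s := P)
        (f := fun h => ‖∑ k ∈ Ω 0, φ (Fin.cons k h) * b' k h‖)
      refine (pow_le_pow_left₀ (norm_nonneg _) e1 2).trans (e2.trans ?_)
      gcongr
      have e3 : ((∑ h ∈ P, ‖∑ k ∈ Ω 0, φ (Fin.cons k h) * b' k h‖ ^ 2 : ℝ) : ℂ) =
          ∑ k ∈ Ω 0, ∑ k' ∈ Ω 0, T k k' := by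
        have e4 : ∀ h, ((‖∑ k ∈ Ω 0, φ (Fin.cons k h) * b' k h‖ ^ 2 : ℝ) : ℂ) =
            ∑ k ∈ Ω 0, ∑ k' ∈ Ω 0, ((starRingEnd ℂ) (φ (Fin.cons k h)) * φ (Fin.cons k' h)) *
              ((starRingEnd ℂ) (b' k h) * b' k' h) := by
          intro h
          rw [← Complex.normSq_eq_norm_sq, ← Complex.mul_conj, mul_comm, map_sum, sum_mul_sum]
          refine sum_congr rfl fun k _ => sum_congr rfl fun k' _ => ?_
          rw [map_mul]; ring
        rw [Complex.ofReal_sum]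
        simp_rw [e4, hT]
        rw [sum_comm]
        exact sum_congr rfl fun k _ => sum_comm
      calc _ = ‖((∑ h ∈ P, ‖∑ k ∈ Ω 0, φ (Fin.cons k h) * b' k h‖ ^ 2 : ℝ) : ℂ)‖ := by
            rw [Complex.norm_real, Real.norm_of_nonneg (sum_nonneg fun _ _ => by positivity)]
        _ ≤ _ := by
            rw [e3]
            exact norm_sum_le_of_le _ fun k _ => norm_sum_le _ _
    set N := 2 ^ (r + 1) with hN
    obtain ⟨M, hM⟩ : ∃ M, N = M + 1 := ⟨N - 1, by have : 0 < N := by positivity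
                                                  lia⟩
    set c : ℤ → ℤ → ℝ := fun k k' => (∑ h ∈ P, ∑ h' ∈ P, cube (r + 1)
      (fun h => (starRingEnd ℂ) (φ (Fin.cons k h)) * φ (Fin.cons k' h)) h h').re with hc
    have hTc : ∀ k k', (#P : ℝ) ^ 2 * ‖T k k'‖ ^ N ≤ (#P : ℝ) ^ N * c k k' := fun k k' =>
      ih Ω' _ _ ((hlow k).conj.mul (hlow k'))
    have hcsum : (∑ h ∈ Fintype.piFinset Ω, ∑ h' ∈ Fintype.piFinset Ω, cube (r + 2) φ h h').re =
        ∑ k ∈ Ω 0, ∑ k' ∈ Ω 0, c k k' := by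
      have e5 : ∀ k k' (h h' : Fin (r + 1) → ℤ), cube (r + 2) φ (Fin.cons k h) (Fin.cons k' h') =
          cube (r + 1) (fun h => (starRingEnd ℂ) (φ (Fin.cons k h)) * φ (Fin.cons k' h)) h h' := by
        intro k k' h h'
        rw [cube_mul, cube_conj, cube]
        simp
      rw [sum_piFinset_succ]
      simp_rw [sum_piFinset_succ Ω, e5, hc, Complex.re_sum]
      refine sum_congr rfl fun k _ => ?_
      rw [sum_comm]
    have hpow : (∑ k ∈ Ω 0, ∑ k' ∈ Ω 0, ‖T k k'‖) ^ N ≤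
        ((#(Ω 0) : ℝ) ^ 2) ^ M * ∑ k ∈ Ω 0, ∑ k' ∈ Ω 0, ‖T k k'‖ ^ N := by
      have := pow_sum_le_card_pow_mul (Ω 0 ×ˢ Ω 0) (fun q => ‖T q.1 q.2‖)
        (fun _ _ => norm_nonneg _) M
      rw [sum_product, sum_product, card_product, ← hM] at this
      push_cast at this
      rwa [← pow_two] at this
    have hNN : 2 ^ (r + 1 + 1) = 2 * N := by rw [hN]; ring
    rw [hNN, pow_mul, hcsum, card_piFinset_succ]
    push_cast
    calc ((#(Ω 0) : ℝ) * #P) ^ 2 * (‖∑ h ∈ Fintype.piFinset Ω, φ h * b h‖ ^ 2) ^ N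
        ≤ ((#(Ω 0) : ℝ) * #P) ^ 2 * (#P * ∑ k ∈ Ω 0, ∑ k' ∈ Ω 0, ‖T k k'‖) ^ N := by gcongr
      _ = ((#(Ω 0) : ℝ) * #P) ^ 2 * ((#P : ℝ) ^ N * (∑ k ∈ Ω 0, ∑ k' ∈ Ω 0, ‖T k k'‖) ^ N) := by
          rw [mul_pow (#P : ℝ) (∑ k ∈ Ω 0, ∑ k' ∈ Ω 0, ‖T k k'‖) N]
      _ ≤ ((#(Ω 0) : ℝ) * #P) ^ 2 * ((#P : ℝ) ^ N *
          (((#(Ω 0) : ℝ) ^ 2) ^ M * ∑ k ∈ Ω 0, ∑ k' ∈ Ω 0, ‖T k k'‖ ^ N)) := by gcongr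
      _ = ((#(Ω 0) : ℝ) ^ 2 * (#P : ℝ) ^ N * ((#(Ω 0) : ℝ) ^ 2) ^ M) *
          ∑ k ∈ Ω 0, ∑ k' ∈ Ω 0, (#P : ℝ) ^ 2 * ‖T k k'‖ ^ N := by
          simp_rw [← mul_sum]; ring
      _ ≤ ((#(Ω 0) : ℝ) ^ 2 * (#P : ℝ) ^ N * ((#(Ω 0) : ℝ) ^ 2) ^ M) *
          ∑ k ∈ Ω 0, ∑ k' ∈ Ω 0, (#P : ℝ) ^ N * c k k' := by
          exact mul_le_mul_of_nonneg_left
            (sum_le_sum fun k _ => sum_le_sum fun k' _ => hTc k k') (by positivity)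
      _ = _ := by
          simp_rw [← mul_sum]
          rw [hM]; ring

/-! ### Box correlations and the linear case -/

section

variable {X : Type*} [MeasurableSpace X] {μ : Measure X} {τ : ℤ → X → X}

/-- The product of the translates of `F` over the cube spanned by `h` and `v`. -/
noncomputable def cubeProd (τ : ℤ → X → X) (s : ℕ) (B : ℤ) (F : X → ℂ) (h v : Fin s → ℤ)
    (x : X) : ℂ :=
  cube s (fun k => F (τ (B * ∑ j, k j) x)) h v

/-- The box `∏ [-H j, H j]`. -/
noncomputable def box {s : ℕ} (H : Fin s → ℕ) : Finset (Fin s → ℤ) :=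
  Fintype.piFinset fun j => Icc (-(H j : ℤ)) (H j)

/-- All box averages of the squared correlations of `F` along cubes are at least `δ`. -/
def Theta (τ : ℤ → X → X) (μ : Measure X) (s : ℕ) (B : ℤ) (δ : ℝ) (F : X → ℂ) : Prop :=
  ∀ H : Fin s → ℕ, δ * ∏ j, (2 * (H j : ℝ) + 1) ≤
    ∑ h ∈ box H, ‖∫ x, cubeProd τ s B F 0 h x ∂μ‖ ^ 2

lemma B1.cubeProd (hτ : IsAction τ μ) {F : X → ℂ} (hF : B1 F) (s : ℕ) (B : ℤ)
    (h h' : Fin s → ℤ) : B1 (cubeProd τ s B F h h') :=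
  B1.cube s (fun _ => hF.comp (hτ.meas _)) h h'

lemma cubeProd_translate (hτ : IsAction τ μ) (s : ℕ) (B : ℤ) (F : X → ℂ) (h h' : Fin s → ℤ)
    (b : ℤ) (x : X) :
    cubeProd τ s B (fun y => F (τ b y)) h h' x = cubeProd τ s B F h h' (τ b x) := by
  unfold cubeProd
  congr 1; funext k
  simp only [← hτ.add, add_comm]

lemma cubeProd_add (hτ : IsAction τ μ) (s : ℕ) (B : ℤ) (F : X → ℂ) (h h' v : Fin s → ℤ) (x : X) :
    cubeProd τ s B F (h + v) (h' + v) x = cubeProd τ s B F h h' (τ (B * ∑ j, v j) x) := by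
  unfold cubeProd
  rw [← cube_shift]
  congr 1; funext k
  rw [← hτ.add]
  simp only [Pi.add_apply, sum_add_distrib, mul_add]

lemma integral_cubeProd (hτ : IsAction τ μ) (s : ℕ) (B : ℤ) (F : X → ℂ) (h h' : Fin s → ℤ) :
    ∫ x, cubeProd τ s B F h h' x ∂μ = ∫ x, cubeProd τ s B F 0 (h' - h) x ∂μ := by
  have : ∀ x, cubeProd τ s B F h h' x = cubeProd τ s B F 0 (h' - h) (τ (B * ∑ j, h j) x) := by
    intro x; rw [← cubeProd_add hτ]; simp
  simp_rw [this]
  exact hτ.integral_comp _ _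

omit [MeasurableSpace X] in
lemma cubeProd_conj (s : ℕ) (B : ℤ) (F : X → ℂ) (h h' : Fin s → ℤ) (x : X) :
    cubeProd τ s B (fun y => (starRingEnd ℂ) (F y)) h h' x =
      (starRingEnd ℂ) (cubeProd τ s B F h h' x) := cube_conj _ _ _ _

lemma cubeProd_succ (hτ : IsAction τ μ) (s : ℕ) (B : ℤ) (F : X → ℂ) (a : ℤ) (h : Fin s → ℤ)
    (x : X) :
    cubeProd τ (s + 1) B F 0 (Fin.cons a h) x =
      cubeProd τ s B (fun y => (starRingEnd ℂ) (F y) * F (τ (B * a) y)) 0 h x := by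
  simp only [cubeProd, cube, Fin.cons_zero, Fin.tail_cons, cube_mul, cube_conj, Fin.sum_cons,
    Pi.zero_apply, zero_add]
  have : Fin.tail (0 : Fin (s + 1) → ℤ) = 0 := rfl
  simp only [this, mul_add, hτ.add]

lemma theta_sum_succ (hτ : IsAction τ μ) (s : ℕ) (B : ℤ) (F : X → ℂ) (H : Fin (s + 1) → ℕ) :
    ∑ h ∈ box H, ‖∫ x, cubeProd τ (s + 1) B F 0 h x ∂μ‖ ^ 2 =
      ∑ a ∈ Icc (-(H 0 : ℤ)) (H 0), ∑ h ∈ box (Fin.tail H),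
        ‖∫ x, cubeProd τ s B (fun y => (starRingEnd ℂ) (F y) * F (τ (B * a) y)) 0 h x ∂μ‖ ^ 2 := by
  unfold box
  rw [sum_piFinset_succ]
  simp only [cubeProd_succ hτ]
  rfl

lemma theta_zero (hτ : IsAction τ μ) {B : ℤ} {δ : ℝ} {F : X → ℂ} :
    Theta τ μ 0 B δ F ↔ δ ≤ ‖∫ x, F x ∂μ‖ ^ 2 := by
  have : ∀ h : Fin 0 → ℤ, ∫ x, cubeProd τ 0 B F 0 h x ∂μ = ∫ x, F x ∂μ := by
    intro h; simp [cubeProd, cube, hτ.zero]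
  simp only [Theta, this, box, sum_const, univ_eq_empty, prod_empty, mul_one, forall_const,
    Fintype.card_piFinset, one_smul]

lemma theta_translate (hτ : IsAction τ μ) {s : ℕ} {B : ℤ} {δ : ℝ} {F : X → ℂ} (b : ℤ) :
    Theta τ μ s B δ (fun y => F (τ b y)) ↔ Theta τ μ s B δ F := by
  unfold Theta
  simp only [cubeProd_translate hτ, hτ.integral_comp b]

lemma theta_conj {s : ℕ} {B : ℤ} {δ : ℝ} {F : X → ℂ} :
    Theta τ μ s B δ (fun y => (starRingEnd ℂ) (F y)) ↔ Theta τ μ s B δ F := by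
  unfold Theta
  simp only [cubeProd_conj, integral_conj, RCLike.norm_conj]

/-- If `c² T²` is at most the sum of a function of differences over `[0, T) × [0, T)`, then that
function is at least `c² / 2` for many differences. -/
lemma many_large_differences {c : ℝ} (H : ℕ) (a : ℤ → ℤ → ℝ)
    (ha1 : ∀ t t', a t t' ≤ 1) (P : ℤ → Prop)
    (hP : ∀ t t', c / 2 ≤ a t t' → P (t - t'))
    (h : ((H + 1 : ℕ) : ℝ) ^ 2 * c ≤ ∑ t ∈ Finset.Icc (0 : ℤ) H, ∑ t' ∈ Finset.Icc (0 : ℤ) H,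
        a t t') :
    ∃ G ⊆ Icc (-(H : ℤ)) H, (∀ k ∈ G, P k) ∧ c / 4 * (2 * H + 1) ≤ #G := by
  classical
  refine ⟨(Icc (-(H : ℤ)) H).filter P, filter_subset _ _, fun k hk => (mem_filter.1 hk).2, ?_⟩
  set G := (Icc (-(H : ℤ)) H).filter P with hG
  have hcard : (#(Icc (0 : ℤ) H) : ℝ) = H + 1 := by
    simp
  rcases le_or_gt c 0 with hc | hc
  · have : c / 4 * (2 * H + 1) ≤ 0 := mul_nonpos_of_nonpos_of_nonneg (by linarith) (by positivity)
    exact this.trans (by positivity)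
  have hrow : ∀ t ∈ Icc (0 : ℤ) H, ∑ t' ∈ Icc (0 : ℤ) H, a t t' ≤ #G + c / 2 * (H + 1) := by
    intro t ht
    have h1 : ∀ t' ∈ Icc (0 : ℤ) H, a t t' ≤ (if t - t' ∈ G then 1 else 0) + c / 2 := by
      intro t' ht'
      rw [mem_Icc] at ht ht'
      split_ifs with hk
      · have := ha1 t t'; linarith
      · by_contra! hlt
        exact hk (mem_filter.2 ⟨mem_Icc.2 ⟨by lia, by lia⟩, hP _ _ (by linarith)⟩)
    refine (sum_le_sum h1).trans ?_
    rw [sum_add_distrib, sum_const, nsmul_eq_mul, hcard, ← sum_filter, sum_const, nsmul_eq_mul,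
      mul_one]
    have h2 : #((Icc (0 : ℤ) H).filter fun t' => t - t' ∈ G) ≤ #G := by
      refine card_le_card_of_injOn (fun t' => t - t') (fun t' ht' => ?_) (fun a _ b _ hab => ?_)
      · exact (mem_filter.1 ht').2
      · simp only at hab; lia
    have h3 : (#((Icc (0 : ℤ) H).filter fun t' => t - t' ∈ G) : ℝ) ≤ #G := by exact_mod_cast h2
    linarith
  have h4 := h.trans (sum_le_sum hrow)
  rw [sum_const, nsmul_eq_mul, hcard] at h4
  push_cast at h4
  have h5 : ((H : ℝ) + 1) * c ≤ #G + c / 2 * (H + 1) := by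
    have : (0 : ℝ) < H + 1 := by positivity
    refine le_of_mul_le_mul_left ?_ this
    linarith
  nlinarith

/-- Van der Corput's inequality for a family, followed by a translation. -/
lemma vdc_family [IsProbabilityMeasure μ] {m : (ℤ → ℂ) →ₗ[ℂ] ℂ} (hm : IsMean m)
    (hτ : IsAction τ μ) {ι : Type*} [Fintype ι] (p : ι → ℤ → ℤ) (P q : ℤ → ℤ)
    (w : ℤ → ℂ) (hw : ∀ n, ‖w n‖ ≤ 1) (f₀ : X → ℂ) (hf₀ : B1 f₀) (f : ι → X → ℂ)
    (hf : ∀ i, B1 (f i)) (F : X → ℂ) (hF : B1 F) (A : Finset ℤ) :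
    (#A : ℝ) ^ 2 * ‖m (fun n => w n * ∫ x, f₀ x * (∏ i, f i (τ (p i n) x)) * F (τ (P n) x) ∂μ)‖ ^ 2
      ≤ ∑ h ∈ A, ∑ h' ∈ A, ‖m (fun n => (w (n + h) * (starRingEnd ℂ) (w (n + h'))) *
        ∫ x, (∏ i, f i (τ (p i (n + h) - q n) x) *
          (starRingEnd ℂ) (f i (τ (p i (n + h') - q n) x))) *
          (F (τ (P (n + h) - q n) x) * (starRingEnd ℂ) (F (τ (P (n + h') - q n) x))) ∂μ)‖ := by
  set u : ℤ → X → ℂ := fun n x => w n * ((∏ i, f i (τ (p i n) x)) * F (τ (P n) x)) with hu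
  have hu1 : ∀ n, B1 (u n) := fun n =>
    (B1.const (hw n)).mul ((B1.prod _ fun i _ => (hf i).comp (hτ.meas _)).mul (hF.comp (hτ.meas _)))
  have h1 : (fun n => w n * ∫ x, f₀ x * (∏ i, f i (τ (p i n) x)) * F (τ (P n) x) ∂μ) =
      fun n => ∫ x, f₀ x * u n x ∂μ := by
    funext n
    rw [← integral_const_mul]
    congr 1; funext x; simp only [hu]; ring
  rw [h1]
  refine (vdc hm f₀ hf₀ u hu1 A).trans (sum_le_sum fun h _ => sum_le_sum fun h' _ => ?_)
  refine (Complex.re_le_norm _).trans (le_of_eq ?_)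
  congr 2; funext n
  rw [← integral_const_mul, ← hτ.integral_comp (-q n)]
  congr 1; funext x
  simp only [hu, map_mul, map_prod, ← hτ.add, ← sub_eq_add_neg, prod_mul_distrib]
  ring

lemma theta_succ_of_many (hτ : IsAction τ μ) {s : ℕ} {B : ℤ} {δ κ : ℝ} (hδ : 0 ≤ δ) {F : X → ℂ}
    (h : ∀ H : ℕ, ∃ G ⊆ Icc (-(H : ℤ)) H,
      (∀ k ∈ G, Theta τ μ s B δ fun y => (starRingEnd ℂ) (F y) * F (τ (B * k) y)) ∧
        κ * (2 * H + 1) ≤ #G) :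
    Theta τ μ (s + 1) B (κ * δ) F := by
  intro H
  obtain ⟨G, hG, h1, h2⟩ := h (H 0)
  rw [theta_sum_succ hτ, Fin.prod_univ_succ]
  have hP : (0 : ℝ) ≤ ∏ j : Fin s, (2 * (H j.succ : ℝ) + 1) :=
    prod_nonneg fun _ _ => by positivity
  calc κ * δ * ((2 * (H 0 : ℝ) + 1) * ∏ j : Fin s, (2 * (H j.succ : ℝ) + 1))
      = (κ * (2 * (H 0 : ℝ) + 1)) * (δ * ∏ j : Fin s, (2 * (H j.succ : ℝ) + 1)) := by ring
    _ ≤ #G * (δ * ∏ j : Fin s, (2 * (H j.succ : ℝ) + 1)) := by gcongr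
    _ = ∑ _k ∈ G, (δ * ∏ j : Fin s, (2 * (H j.succ : ℝ) + 1)) := by
        rw [sum_const, nsmul_eq_mul]
    _ ≤ ∑ k ∈ G, ∑ h ∈ box (Fin.tail H), ‖∫ x, cubeProd τ s B
          (fun y => (starRingEnd ℂ) (F y) * F (τ (B * k) y)) 0 h x ∂μ‖ ^ 2 :=
        sum_le_sum fun k hk => h1 k hk (Fin.tail H)
    _ ≤ _ := sum_le_sum_of_subset_of_nonneg hG fun _ _ _ => by positivity

lemma theta_succ_of_vdc [IsProbabilityMeasure μ] {m : (ℤ → ℂ) →ₗ[ℂ] ℂ} (hm : IsMean m)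
    (hτ : IsAction τ μ) {ι : Type*} [Fintype ι] (a : ι → ℤ) {a₀ : ℤ} (q : ℤ) {B d : ℤ}
    (hd : d ≠ 0) {w : ℤ → ℂ} (hw : ∀ n, ‖w n‖ ≤ 1) {f₀ : X → ℂ} (hf₀ : B1 f₀)
    {f : ι → X → ℂ} (hf : ∀ i, B1 (f i)) {F : X → ℂ} (hF : B1 F) {c : ℝ} (hc : 0 < c)
    (hcm : c ≤ ‖m (fun n => w n * ∫ x, f₀ x * (∏ i, f i (τ (a i * n) x)) * F (τ (a₀ * n) x) ∂μ)‖)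
    {s : ℕ} {δ : ℝ} (hδ : 0 ≤ δ)
    (h : ∀ t t' : ℤ, c ^ 2 / 2 ≤ ‖m (fun n => (w (n + d * t) * (starRingEnd ℂ) (w (n + d * t'))) *
        ∫ x, (∏ i, f i (τ (a i * (n + d * t) - q * n) x) *
          (starRingEnd ℂ) (f i (τ (a i * (n + d * t') - q * n) x))) *
          (F (τ (a₀ * (n + d * t) - q * n) x) *
            (starRingEnd ℂ) (F (τ (a₀ * (n + d * t') - q * n) x))) ∂μ)‖ →
      Theta τ μ s B δ fun y => (starRingEnd ℂ) (F y) * F (τ (B * (t - t')) y)) :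
    Theta τ μ (s + 1) B (c ^ 2 / 4 * δ) F := by
  refine theta_succ_of_many hτ hδ fun H => ?_
  have hinj : Function.Injective fun t : ℤ => d * t := fun x y hxy => by
    simpa [hd] using hxy
  have h1 := vdc_family hm hτ (fun i n => a i * n) (fun n => a₀ * n) (fun n => q * n) w hw f₀ hf₀
    f hf F hF ((Icc (0 : ℤ) H).image fun t => d * t)
  rw [card_image_of_injective _ hinj, sum_image hinj.injOn] at h1
  simp_rw [sum_image hinj.injOn] at h1
  refine many_large_differences H _ (fun t t' => ?_) _ (fun t t' htt => h t t' htt) ?_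
  · refine hm.norm_le _ 1 fun n => ?_
    rw [norm_mul, norm_mul, RCLike.norm_conj]
    refine mul_le_one₀ (mul_le_one₀ (hw _) (norm_nonneg _) (hw _)) (norm_nonneg _) ?_
    exact ((B1.prod _ fun i _ => ((hf i).comp (hτ.meas _)).mul ((hf i).comp (hτ.meas _)).conj).mul
      ((hF.comp (hτ.meas _)).mul (hF.comp (hτ.meas _)).conj)).norm_integral_le
  · refine le_trans ?_ h1
    have : #(Icc (0 : ℤ) H) = H + 1 := by simp
    rw [this]
    gcongr

theorem linear_theta [IsProbabilityMeasure μ] (hτ : IsAction τ μ) (N : ℕ) :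
    ∀ (a : Fin N → ℤ) (a₀ : ℤ), a₀ ≠ 0 → (∀ i, a i ≠ a₀) →
    ∃ B : ℤ, 0 < B ∧ ∀ B' : ℤ, B ∣ B' → B' ≠ 0 → ∀ c : ℝ, 0 < c → ∃ δ : ℝ, 0 < δ ∧
      ∀ (m : (ℤ → ℂ) →ₗ[ℂ] ℂ) (w : ℤ → ℂ) (f₀ : X → ℂ) (f : Fin N → X → ℂ) (F : X → ℂ),
        IsMean m → (∀ n, ‖w n‖ ≤ 1) → B1 f₀ → (∀ i, B1 (f i)) → B1 F →
        c ≤ ‖m (fun n => w n * ∫ x, f₀ x * (∏ i, f i (τ (a i * n) x)) * F (τ (a₀ * n) x) ∂μ)‖ →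
        Theta τ μ (N + 1) B' δ F := by
  induction N with
  | zero =>
    intro a a₀ ha₀ _
    refine ⟨|a₀|, abs_pos.2 ha₀, fun B' hB' hB0 c hc =>
      ⟨c ^ 2 / 4 * (c ^ 2 / 2) ^ 2, by positivity, ?_⟩⟩
    intro m w f₀ f F hm hw hf₀ hf hF hcm
    obtain ⟨d, hd⟩ := (abs_dvd _ _).1 hB'
    have hd0 : d ≠ 0 := by rintro rfl; simp at hd; lia
    refine theta_succ_of_vdc hm hτ a a₀ hd0 hw hf₀ hf hF hc hcm (by positivity)
      fun t t' htt => ?_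
    rw [theta_zero hτ]
    gcongr
    refine htt.trans (hm.norm_le _ _ fun n => ?_)
    rw [norm_mul]
    refine (mul_le_of_le_one_left (norm_nonneg _) ?_).trans (le_of_eq ?_)
    · rw [norm_mul, RCLike.norm_conj]
      exact mul_le_one₀ (hw _) (norm_nonneg _) (hw _)
    · rw [← hτ.integral_comp (a₀ * (n + d * t') - a₀ * n)
        (fun y => (starRingEnd ℂ) (F y) * F (τ (B' * (t - t')) y))]
      congr 2; funext x
      simp only [univ_eq_empty, prod_empty, one_mul, ← hτ.add]
      rw [mul_comm]
      congr 3
      rw [hd]; ring_nf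
  | succ N ih =>
    intro a a₀ ha₀ ha
    obtain ⟨B, hB, hB2⟩ := ih (fun i => a i.succ - a 0) (a₀ - a 0)
      (sub_ne_zero.2 (ha 0).symm) (fun i => by have := ha i.succ; simpa using this)
    refine ⟨|a₀| * B, mul_pos (abs_pos.2 ha₀) hB, fun B' hB' hB0 c hc => ?_⟩
    obtain ⟨δ, hδ, H⟩ := hB2 B' ((Dvd.intro_left _ rfl).trans hB') hB0 (c ^ 2 / 2) (by positivity)
    refine ⟨c ^ 2 / 4 * δ, by positivity, fun m w f₀ f F hm hw hf₀ hf hF hcm => ?_⟩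
    obtain ⟨d, hd⟩ := (abs_dvd _ _).1 ((Dvd.intro _ rfl).trans hB')
    have hd0 : d ≠ 0 := by rintro rfl; simp at hd; lia
    refine theta_succ_of_vdc hm hτ a (a 0) hd0 hw hf₀ hf hF hc hcm hδ.le
      fun t t' htt => ?_
    have hΔ : B1 fun y => (starRingEnd ℂ) (F y) * F (τ (B' * (t - t')) y) :=
      hF.conj.mul (hF.comp (hτ.meas _))
    rw [← theta_translate hτ (a₀ * (d * t'))]
    refine H m (fun n => w (n + d * t) * (starRingEnd ℂ) (w (n + d * t')))
      (fun x => f 0 (τ (a 0 * (d * t)) x) * (starRingEnd ℂ) (f 0 (τ (a 0 * (d * t')) x)))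
      (fun i x => f i.succ (τ (a i.succ * (d * t)) x) *
        (starRingEnd ℂ) (f i.succ (τ (a i.succ * (d * t')) x))) _ hm (fun n => ?_)
      (((hf _).comp (hτ.meas _)).mul ((hf _).comp (hτ.meas _)).conj)
      (fun i => ((hf _).comp (hτ.meas _)).mul ((hf _).comp (hτ.meas _)).conj)
      (hΔ.comp (hτ.meas _)) (htt.trans (le_of_eq ?_))
    · rw [norm_mul, RCLike.norm_conj]
      exact mul_le_one₀ (hw _) (norm_nonneg _) (hw _)
    · congr 2; funext n; congr 2; funext x
      simp only [Fin.prod_univ_succ, ← hτ.add]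
      have e0 : ∀ u : ℤ, a 0 * (n + u) - a 0 * n = a 0 * u := fun u => by ring
      have e1 : ∀ (i : Fin N) (u : ℤ), a i.succ * (n + u) - a 0 * n =
          a i.succ * u + (a i.succ - a 0) * n := fun i u => by ring
      have e2 : a₀ * (n + d * t') - a 0 * n = a₀ * (d * t') + (a₀ - a 0) * n := by ring
      have e3 : a₀ * (n + d * t) - a 0 * n =
          B' * (t - t') + (a₀ * (d * t') + (a₀ - a 0) * n) := by rw [hd]; ring
      simp only [e0, e1, e2, e3, ← add_assoc]
      ring

end

/-! ### Reduction of polynomial averages to box correlations -/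

open Polynomial in
/-- Large averages along the family `p`, `P` force a box correlation of the function attached to
the distinguished polynomial `P`. -/
def PolyControl {X : Type*} [MeasurableSpace X] (μ : Measure X) (τ : ℤ → X → X)
    {ι : Type} [Fintype ι] (p : ι → ℤ[X]) (P : ℤ[X]) : Prop :=
  ∀ c : ℝ, 0 < c → ∃ L : Set (ℕ × ℤ × ℝ), L.Finite ∧ (∀ t ∈ L, t.2.1 ≠ 0 ∧ 0 < t.2.2) ∧
    ∀ (m : (ℤ → ℂ) →ₗ[ℂ] ℂ) (w : ℤ → ℂ) (f₀ : X → ℂ) (f : ι → X → ℂ) (F : X → ℂ), IsMean m →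
      (∀ n, ‖w n‖ ≤ 1) → B1 f₀ → (∀ i, B1 (f i)) → B1 F →
      c ≤ ‖m (fun n => w n * ∫ x, f₀ x * (∏ i, f i (τ ((p i).eval n) x)) *
        F (τ (P.eval n) x) ∂μ)‖ →
      ∃ t ∈ L, Theta τ μ (t.1 + 1) t.2.1 t.2.2 F

section

variable {X : Type*} [MeasurableSpace X] {μ : Measure X} {τ : ℤ → X → X}

open Polynomial

/-- The family produced from `p`, `P` by van der Corput's inequality with difference `k` and
subtraction of `q`. -/
noncomputable def vdcFamily {ι : Type} (p : ι → ℤ[X]) (P q : ℤ[X]) (k : ℤ) :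
    (ι ⊕ ι) ⊕ Unit → ℤ[X] :=
  Sum.elim (Sum.elim (fun i => taylor k (p i) - q) (fun i => p i - q)) (fun _ => P - q)

lemma polyControl_of_vdc [IsProbabilityMeasure μ] (hτ : IsAction τ μ) {ι : Type}
    [Fintype ι] (p : ι → ℤ[X]) (P q : ℤ[X]) (K : Finset ℤ)
    (h : ∀ k ∉ K, PolyControl μ τ (vdcFamily p P q k) (taylor k P - q)) :
    PolyControl μ τ p P := by
  intro c hc
  have h' : ∀ k, ∃ L : Set (ℕ × ℤ × ℝ), L.Finite ∧ (∀ t ∈ L, t.2.1 ≠ 0 ∧ 0 < t.2.2) ∧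
      (k ∉ K → ∀ (m : (ℤ → ℂ) →ₗ[ℂ] ℂ) (w : ℤ → ℂ) (f₀ : X → ℂ)
      (f : (ι ⊕ ι) ⊕ Unit → X → ℂ) (F : X → ℂ), IsMean m → (∀ n, ‖w n‖ ≤ 1) → B1 f₀ →
          (∀ i, B1 (f i)) → B1 F →
      c ^ 2 / 2 ≤ ‖m (fun n => w n * ∫ x, f₀ x *
        (∏ i, f i (τ ((vdcFamily p P q k i).eval n) x)) *
        F (τ ((taylor k P - q).eval n) x) ∂μ)‖ →
      ∃ t ∈ L, Theta τ μ (t.1 + 1) t.2.1 t.2.2 F) := by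
    intro k
    by_cases hk : k ∈ K
    · exact ⟨∅, Set.finite_empty, by simp, fun hk' => absurd hk hk'⟩
    · obtain ⟨L, h1, h2, h3⟩ := h k hk (c ^ 2 / 2) (by positivity)
      exact ⟨L, h1, h2, fun _ => h3⟩
  choose L hL1 hL2 hL3 using h'
  obtain ⟨H, hH⟩ := exists_nat_gt ((#K : ℝ) / (c ^ 2 / 4))
  have hH' : (#K : ℝ) < c ^ 2 / 4 * (2 * H + 1) := by
    rw [div_lt_iff₀' (by positivity)] at hH
    nlinarith [sq_nonneg c, (Nat.cast_nonneg H : (0 : ℝ) ≤ H), sq_pos_of_pos hc]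
  refine ⟨⋃ k ∈ Icc (-(H : ℤ)) H, L k, (Icc (-(H : ℤ)) H).finite_toSet.biUnion fun k _ => hL1 k,
    fun t ht => ?_, fun m w f₀ f F hm hw hf₀ hf hF hcm => ?_⟩
  · simp only [Set.mem_iUnion] at ht
    obtain ⟨k, _, hk⟩ := ht
    exact hL2 k t hk
  set V : ℤ → ℝ := fun k => ‖m (fun n => (w (n + k) * (starRingEnd ℂ) (w n)) *
      ∫ x, (∏ i, f i (τ ((p i).eval (n + k)) x) * (starRingEnd ℂ) (f i (τ ((p i).eval n) x))) *
        (F (τ (P.eval (n + k)) x) * (starRingEnd ℂ) (F (τ (P.eval n) x))) ∂μ)‖ with hV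
  have hb : ∀ k n, ‖(w (n + k) * (starRingEnd ℂ) (w n)) *
      ∫ x, (∏ i, f i (τ ((p i).eval (n + k)) x) * (starRingEnd ℂ) (f i (τ ((p i).eval n) x))) *
        (F (τ (P.eval (n + k)) x) * (starRingEnd ℂ) (F (τ (P.eval n) x))) ∂μ‖ ≤ 1 := by
    intro k n
    rw [norm_mul, norm_mul, RCLike.norm_conj]
    refine mul_le_one₀ (mul_le_one₀ (hw _) (norm_nonneg _) (hw _)) (norm_nonneg _) ?_
    exact ((B1.prod _ fun i _ => ((hf i).comp (hτ.meas _)).mul ((hf i).comp (hτ.meas _)).conj).mul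
      ((hF.comp (hτ.meas _)).mul (hF.comp (hτ.meas _)).conj)).norm_integral_le
  have h1 := vdc_family hm hτ (fun i n => (p i).eval n) (fun n => P.eval n) (fun _ => 0) w hw f₀
    hf₀ f hf F hF (Icc (0 : ℤ) H)
  simp only [sub_zero] at h1
  have h2 : ∀ t t' : ℤ, ‖m (fun n => (w (n + t) * (starRingEnd ℂ) (w (n + t'))) *
      ∫ x, (∏ i, f i (τ ((p i).eval (n + t)) x) *
        (starRingEnd ℂ) (f i (τ ((p i).eval (n + t')) x))) *
        (F (τ (P.eval (n + t)) x) * (starRingEnd ℂ) (F (τ (P.eval (n + t')) x))) ∂μ)‖ =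
      V (t - t') := by
    intro t t'
    rw [hV]
    simp only
    rw [← hm.shift _ 1 t' (hb (t - t'))]
    simp only [add_assoc, add_sub_cancel]
  simp only [h2] at h1
  obtain ⟨G, hG1, hG2, hG3⟩ := many_large_differences (c := c ^ 2) H (fun t t' => V (t - t'))
    (fun t t' => hm.norm_le _ 1 (hb _)) (fun k => c ^ 2 / 2 ≤ V k) (fun t t' h => h) (by
      refine le_trans ?_ h1
      have : #(Icc (0 : ℤ) H) = H + 1 := by simp
      rw [this]; gcongr)
  obtain ⟨k, hkG, hkK⟩ : ∃ k ∈ G, k ∉ K := by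
    by_contra! hcon
    have : (#G : ℝ) ≤ #K := by exact_mod_cast card_le_card hcon
    linarith
  obtain ⟨t, ht, hΘ⟩ := hL3 k hkK m (fun n => w (n + k) * (starRingEnd ℂ) (w n)) (fun _ => 1)
    (Sum.elim (Sum.elim f fun i x => (starRingEnd ℂ) (f i x)) fun _ x => (starRingEnd ℂ) (F x)) F
    hm (fun n => by
      rw [norm_mul, RCLike.norm_conj]; exact mul_le_one₀ (hw _) (norm_nonneg _) (hw _))
    B1.one (by
      rintro ((i | i) | _)
      · exact hf i
      · exact (hf i).conj
      · exact hF.conj) hF ((hG2 k hkG).trans (le_of_eq (by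
        rw [hV]
        beta_reduce
        congr 2; funext n; congr 1
        rw [← hτ.integral_comp (-q.eval n)]
        congr 1; funext x
        simp only [vdcFamily, Fintype.prod_sum_type, Sum.elim_inl, Sum.elim_inr, eval_sub,
          taylor_eval, ← hτ.add, ← sub_eq_add_neg, prod_mul_distrib, univ_unique, prod_singleton]
        ring)))
  exact ⟨t, Set.mem_biUnion (hG1 hkG) ht, hΘ⟩

/-- Constant members of the family can be discarded. -/
lemma polyControl_of_subtype (hτ : IsAction τ μ) {ι : Type}
    [Fintype ι] (p : ι → ℤ[X]) (P : ℤ[X])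
    (h : PolyControl μ τ (fun i : {i // 1 ≤ (p i).natDegree} => p i) P) :
    PolyControl μ τ p P := by
  classical
  intro c hc
  obtain ⟨L, hL1, hL2, hL3⟩ := h c hc
  refine ⟨L, hL1, hL2, fun m w f₀ f F hm hw hf₀ hf hF hcm => ?_⟩
  refine hL3 m w (fun x => f₀ x * ∏ i : {i // ¬ 1 ≤ (p i).natDegree}, f i (τ ((p i).eval 0) x))
    (fun i => f i) F hm hw (hf₀.mul (B1.prod _ fun i _ => (hf i).comp (hτ.meas _))) (fun i => hf i) hF
    (hcm.trans (le_of_eq ?_))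
  congr 2; funext n; congr 2; funext x
  rw [← Fintype.prod_subtype_mul_prod_subtype (fun i => 1 ≤ (p i).natDegree)]
  have : ∀ i : {i // ¬ 1 ≤ (p i).natDegree}, (p i).eval n = (p i).eval 0 := by
    intro i
    have h0 : (p i).natDegree = 0 := by have := i.2; lia
    rw [eq_C_of_natDegree_eq_zero h0]; simp
  simp only [this]
  ring

lemma polyControl_linear [IsProbabilityMeasure μ] (hτ : IsAction τ μ) {ι : Type}
    [Fintype ι] (p : ι → ℤ[X]) (P : ℤ[X]) (hP : P.natDegree = 1)
    (hp : ∀ i, (p i).natDegree ≤ 1) (hne : ∀ i, 1 ≤ (P - p i).natDegree) :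
    PolyControl μ τ p P := by
  set e := (Fintype.equivFin ι).symm with he
  obtain ⟨B, hB, h⟩ := linear_theta (μ := μ) hτ (Fintype.card ι)
    (fun j => (p (e j)).coeff 1) (P.coeff 1)
    (by rw [← hP, coeff_natDegree, leadingCoeff_ne_zero]; rintro rfl; simp at hP)
    (fun j hj => by
      have h1 := hne (e j)
      have h2 : (P - p (e j)).natDegree ≤ 1 :=
        (natDegree_sub_le _ _).trans (max_le hP.le (hp _))
      have h3 : (P - p (e j)).coeff (P - p (e j)).natDegree = 0 := by
        rw [le_antisymm h2 h1, coeff_sub, hj, sub_self]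
      rw [coeff_natDegree, leadingCoeff_eq_zero] at h3
      rw [h3] at h1; simp at h1)
  intro c hc
  obtain ⟨δ, hδ, h⟩ := h B dvd_rfl hB.ne' c hc
  refine ⟨{(Fintype.card ι, B, δ)}, Set.finite_singleton _, ?_,
      fun m w f₀ f F hm hw hf₀ hf hF hcm =>
    ⟨_, rfl, ?_⟩⟩
  · rintro t rfl; exact ⟨hB.ne', hδ⟩
  have hlin : ∀ (Q : ℤ[X]), Q.natDegree ≤ 1 → ∀ n : ℤ, Q.eval n = Q.coeff 1 * n + Q.coeff 0 := by
    intro Q hQ n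
    conv_lhs => rw [eq_X_add_C_of_natDegree_le_one hQ]
    simp
  rw [← theta_translate hτ (P.coeff 0)]
  refine h m w f₀ (fun j x => f (e j) (τ ((p (e j)).coeff 0) x)) _ hm hw hf₀
    (fun j => (hf _).comp (hτ.meas _)) (hF.comp (hτ.meas _)) (hcm.trans (le_of_eq ?_))
  congr 2; funext n; congr 2; funext x
  simp only [← hτ.add]
  rw [hlin P hP.le, ← e.prod_comp]
  simp only [hlin _ (hp _), add_comm]

/-- The degree and leading coefficient of a polynomial. -/
noncomputable def degLead (q : ℤ[X]) : ℕ × ℤ := (q.natDegree, q.leadingCoeff)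

open Classical in
/-- The leading terms of the nonconstant members of the family. -/
noncomputable def leadTerms {ι : Type} [Fintype ι] (p : ι → ℤ[X]) (P : ℤ[X]) : Finset (ℕ × ℤ) :=
  ((univ.image fun i => degLead (p i)) ∪ {degLead P}).filter fun t => 1 ≤ t.1

lemma mem_leadTerms {ι : Type} [Fintype ι] {p : ι → ℤ[X]} {P : ℤ[X]} {t : ℕ × ℤ} :
    t ∈ leadTerms p P ↔ ((∃ i, degLead (p i) = t) ∨ degLead P = t) ∧ 1 ≤ t.1 := by
  simp [leadTerms, eq_comm, or_comm]

lemma degLead_taylor (q : ℤ[X]) (k : ℤ) : degLead (taylor k q) = degLead q := by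
  simp [degLead]

lemma degLead_sub_of_lt {q r : ℤ[X]} (h : r.natDegree < q.natDegree) :
    degLead (q - r) = degLead q := by
  have h' : r.degree < q.degree := degree_lt_degree h
  simp only [degLead]
  rw [natDegree_sub_eq_left_of_natDegree_lt h, leadingCoeff_sub_of_degree_lt h']

lemma degLead_sub_of_eq {q r : ℤ[X]} (h : q.natDegree = r.natDegree)
    (hd : r.natDegree ≤ (q - r).natDegree) (h1 : 1 ≤ r.natDegree) :
    degLead (q - r) = (r.natDegree, q.leadingCoeff - r.leadingCoeff) ∧
      q.leadingCoeff ≠ r.leadingCoeff := by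
  have h2 : (q - r).natDegree = r.natDegree :=
    le_antisymm ((natDegree_sub_le _ _).trans (max_le h.le le_rfl)) hd
  have h3 : (q - r).leadingCoeff = q.leadingCoeff - r.leadingCoeff := by
    rw [leadingCoeff, h2, coeff_sub, coeff_natDegree, ← h, coeff_natDegree]
  refine ⟨by rw [degLead, h2, h3], fun h4 => ?_⟩
  rw [h4, sub_self, leadingCoeff_eq_zero] at h3
  rw [h3, natDegree_zero] at h2
  lia

/-- Subtracting a member of least degree decreases the leading terms in the multiset order. -/
lemma leadTerms_vdcFamily_lt {ι : Type} [Fintype ι] (p : ι → ℤ[X]) (P q : ℤ[X]) (k : ℤ)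
    (hq : degLead q ∈ leadTerms p P) (hp : ∀ i, q.natDegree ≤ (p i).natDegree)
    (hP : q.natDegree ≤ P.natDegree) :
    Multiset.IsDershowitzMannaLT ((leadTerms (vdcFamily p P q k) (taylor k P - q)).val.map Prod.fst)
      ((leadTerms p P).val.map Prod.fst) := by
  classical
  set d := q.natDegree with hd
  have hd1 : 1 ≤ d := (mem_leadTerms.1 hq).2
  set φ : ℕ × ℤ → ℕ × ℤ := fun t => if t.1 = d then (t.1, t.2 - q.leadingCoeff) else t with hφ
  have hφ1 : ∀ t, (φ t).1 = t.1 := fun t => by simp only [hφ]; split_ifs <;> rfl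
  have hφi : Function.Injective φ := by
    intro t t' h
    have h1 : t.1 = t'.1 := by rw [← hφ1 t, h, hφ1]
    simp only [hφ, h1] at h
    split_ifs at h with h2
    · rw [Prod.mk.injEq] at h
      exact Prod.ext h1 (by linarith [h.2])
    · exact h
  set C := leadTerms p P with hC
  set C' := leadTerms (vdcFamily p P q k) (taylor k P - q) with hC'
  have key : ∀ r : ℤ[X], d ≤ r.natDegree → degLead r ∈ C → d ≤ (r - q).natDegree →
      degLead (r - q) ∈ (C.erase (degLead q)).image φ := by
    intro r hr hrC hrd
    rw [mem_image]
    refine ⟨degLead r, mem_erase.2 ⟨fun hrq => ?_, hrC⟩, ?_⟩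
    · have h1 : r.natDegree = d := congrArg Prod.fst hrq
      exact (degLead_sub_of_eq h1 hrd hd1).2 (congrArg Prod.snd hrq)
    · rcases hr.eq_or_lt with h1 | h1
      · rw [(degLead_sub_of_eq h1.symm hrd hd1).1]
        simp [hφ, degLead, ← h1, ← hd]
      · rw [degLead_sub_of_lt h1]
        simp [hφ, degLead, h1.ne']
  have hsub : C'.filter (fun t => d ≤ t.1) ⊆ (C.erase (degLead q)).image φ := by
    intro t ht
    rw [mem_filter, hC', mem_leadTerms] at ht
    obtain ⟨⟨ht1, -⟩, ht2⟩ := ht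
    have hpC : ∀ i, degLead (p i) ∈ C := fun i =>
      mem_leadTerms.2 ⟨Or.inl ⟨i, rfl⟩, hd1.trans (hp i)⟩
    have hPC : degLead P ∈ C := mem_leadTerms.2 ⟨Or.inr rfl, hd1.trans hP⟩
    rcases ht1 with ⟨(i | i) | _, rfl⟩ | rfl
    · exact key _ (by rw [natDegree_taylor]; exact hp i) (by rw [degLead_taylor]; exact hpC i) ht2
    · exact key _ (hp i) (hpC i) ht2
    · exact key _ hP hPC ht2
    · exact key _ (by rw [natDegree_taylor]; exact hP) (by rw [degLead_taylor]; exact hPC) ht2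
  have hle : (C'.filter (fun t => d ≤ t.1)).val.map Prod.fst + {d} ≤ C.val.map Prod.fst := by
    have h1 : C.val = degLead q ::ₘ (C.erase (degLead q)).val := by
      rw [erase_val, Multiset.cons_erase hq]
    rw [h1, Multiset.map_cons, add_comm, Multiset.singleton_add]
    refine Multiset.cons_le_cons _ ?_
    refine (Multiset.map_le_map (val_le_iff.2 hsub)).trans (le_of_eq ?_)
    rw [image_val_of_injOn hφi.injOn, Multiset.map_map]
    exact Multiset.map_congr rfl fun t _ => hφ1 t
  obtain ⟨W, hW⟩ := Multiset.le_iff_exists_add.1 hle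
  refine ⟨(C'.filter (fun t => d ≤ t.1)).val.map Prod.fst,
    (C'.filter (fun t => ¬ d ≤ t.1)).val.map Prod.fst, {d} + W, ?_, ?_, ?_, ?_⟩
  · simp
  · rw [← Multiset.map_add, filter_val, filter_val, Multiset.filter_add_not]
  · rw [hW, add_assoc]
  · intro y hy
    obtain ⟨t, ht, rfl⟩ := Multiset.mem_map.1 hy
    refine ⟨d, by simp, ?_⟩
    have := (mem_filter.1 ht).2
    lia

lemma polyControl_of_map_leadTerms_eq [IsProbabilityMeasure μ] (hτ : IsAction τ μ)
    (M : Multiset ℕ) : ∀ (ι : Type) [Fintype ι] (p : ι → ℤ[X]) (P : ℤ[X]),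
    (leadTerms p P).val.map Prod.fst = M → (∀ i, 1 ≤ (p i).natDegree) → 1 ≤ P.natDegree →
    (∀ i, (p i).natDegree ≤ P.natDegree) → (∀ i, 1 ≤ (P - p i).natDegree) →
    PolyControl μ τ p P := by
  classical
  induction M using (Multiset.wellFounded_isDershowitzMannaLT (α := ℕ)).induction with
  | _ M ih =>
  intro ι _ p P hM hp hP hpP hne
  rcases hP.eq_or_lt with hP1 | hP1
  · exact polyControl_linear hτ p P hP1.symm (fun i => by rw [hP1]; exact hpP i) hne
  obtain ⟨d, hd⟩ : ∃ d, P.natDegree = d + 1 := ⟨P.natDegree - 1, by lia⟩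
  have hd1 : 1 ≤ d := by lia
  have ha : P.coeff (d + 1) ≠ 0 := by
    rw [← hd, coeff_natDegree, leadingCoeff_ne_zero]; rintro rfl; simp at hd
  set r : Option ι → ℤ[X] := fun o => o.elim P p with hr
  set K : Finset ℤ := univ.image fun o => ((r o).coeff d - P.coeff d) / ((d + 1) * P.coeff (d + 1))
    with hK
  have hrD : ∀ o, (r o).natDegree ≤ d + 1 := by
    rintro (_ | i)
    · exact hd.le
    · exact hd ▸ hpP i
  have hT := fun (k : ℤ) (q : ℤ[X]) hq => natDegree_taylor_sub_le q k d hq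
  have hTD : ∀ (k : ℤ) (q : ℤ[X]), q.natDegree ≤ d + 1 →
      (taylor k q).coeff (d + 1) = q.coeff (d + 1) := by
    intro k q hq
    have h1 := coeff_eq_zero_of_natDegree_lt (lt_of_le_of_lt (hT k q hq).1 (Nat.lt_succ_self d))
    rw [coeff_sub] at h1; linarith
  have hTd : ∀ k ∉ K, ∀ o, (taylor k P - r o).coeff d ≠ 0 := by
    intro k hk o h0
    have h1 := (hT k P hd.le).2
    rw [coeff_sub] at h0 h1
    refine hk (mem_image.2 ⟨o, mem_univ _, ?_⟩)
    have h2 : (r o).coeff d - P.coeff d = ((d + 1) * P.coeff (d + 1)) * k := by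
      linarith
    rw [h2, Int.mul_ediv_cancel_left]
    exact mul_ne_zero (by positivity) ha
  have hTr : ∀ k ∉ K, ∀ o, 1 ≤ (taylor k P - r o).natDegree := fun k hk o =>
    hd1.trans (le_natDegree_of_ne_zero (hTd k hk o))
  have step : ∀ q : ℤ[X], degLead q ∈ leadTerms p P → (∀ i, q.natDegree ≤ (p i).natDegree) →
      q.natDegree ≤ P.natDegree →
      (∀ k ∉ K, 1 ≤ (taylor k P - q).natDegree ∧
        (∀ o, (taylor k (r o) - q).natDegree ≤ (taylor k P - q).natDegree) ∧
        ∀ o, (r o - q).natDegree ≤ (taylor k P - q).natDegree) → PolyControl μ τ p P := by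
    intro q hq hqp hqP h
    refine polyControl_of_vdc hτ p P q K fun k hk => polyControl_of_subtype hτ _ _ ?_
    obtain ⟨h1, h2, h3⟩ := h k hk
    have hlt := leadTerms_vdcFamily_lt p P q k hq hqp hqP
    rw [hM] at hlt
    refine ih _ hlt _ _ _ ?_ (fun i => i.2) h1 ?_ ?_
    · congr 2
      ext t
      simp only [mem_leadTerms, Subtype.exists]
      constructor
      · rintro ⟨⟨i, _, hi⟩ | h, ht⟩
        · exact ⟨Or.inl ⟨i, hi⟩, ht⟩
        · exact ⟨Or.inr h, ht⟩
      · rintro ⟨⟨i, hi⟩ | h, ht⟩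
        · exact ⟨Or.inl ⟨i, by rw [← hi] at ht; exact ht, hi⟩, ht⟩
        · exact ⟨Or.inr h, ht⟩
    · rintro ⟨(i | i) | _, _⟩
      · exact h2 (some i)
      · exact h3 (some i)
      · exact h3 none
    · rintro ⟨(i | i) | _, _⟩
      · change 1 ≤ (taylor k P - q - (taylor k (p i) - q)).natDegree
        rw [sub_sub_sub_cancel_right, ← map_sub, natDegree_taylor]; exact hne i
      · change 1 ≤ (taylor k P - q - (p i - q)).natDegree
        rw [sub_sub_sub_cancel_right]; exact hTr k hk (some i)
      · change 1 ≤ (taylor k P - q - (P - q)).natDegree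
        rw [sub_sub_sub_cancel_right]; exact hTr k hk none
  by_cases hA : ∃ i, (p i).coeff (d + 1) ≠ P.coeff (d + 1)
  · obtain ⟨i, hi, hmin⟩ := exists_min_image
      (univ.filter fun i => (p i).coeff (d + 1) ≠ P.coeff (d + 1)) (fun i => (p i).natDegree)
      (by obtain ⟨i, hi⟩ := hA; exact ⟨i, by simpa using hi⟩)
    have hi' : (p i).coeff (d + 1) ≠ P.coeff (d + 1) := (mem_filter.1 hi).2
    have hiD : (p i).natDegree ≤ d + 1 := hrD (some i)
    refine step (p i) (mem_leadTerms.2 ⟨Or.inl ⟨i, rfl⟩, hp i⟩) (fun j => ?_) (hpP i)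
      fun k hk => ?_
    · by_cases hj : (p j).coeff (d + 1) = P.coeff (d + 1)
      · exact hiD.trans (le_natDegree_of_ne_zero (by rw [hj]; exact ha))
      · exact hmin j (by simpa using hj)
    · have h1 : d + 1 ≤ (taylor k P - p i).natDegree := by
        refine le_natDegree_of_ne_zero ?_
        rw [coeff_sub, hTD k P hd.le]
        exact sub_ne_zero.2 hi'.symm
      refine ⟨by lia, fun o => le_trans ?_ h1, fun o => le_trans ?_ h1⟩
      · refine (natDegree_sub_le _ _).trans (max_le ?_ hiD)
        rw [natDegree_taylor]; exact hrD o
      · exact (natDegree_sub_le _ _).trans (max_le (hrD o) hiD)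
  · push Not at hA
    have hrc : ∀ o, (r o).coeff (d + 1) = P.coeff (d + 1) := by
      rintro (_ | i)
      · rfl
      · exact hA i
    have hle : ∀ s : ℤ[X], s.natDegree ≤ d + 1 → s.coeff (d + 1) = P.coeff (d + 1) →
        (s - P).natDegree ≤ d := by
      intro s hs hsc
      rw [natDegree_le_iff_coeff_eq_zero]
      intro N hN
      rcases (Nat.succ_le_of_lt hN).eq_or_lt with h | h
      · rw [← h, coeff_sub, hsc, sub_self]
      · rw [coeff_sub, coeff_eq_zero_of_natDegree_lt (by lia),
          coeff_eq_zero_of_natDegree_lt (by lia), sub_zero]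
    refine step P (mem_leadTerms.2 ⟨Or.inr rfl, hP⟩) (fun j => ?_) le_rfl fun k hk => ?_
    · rw [hd]; exact le_natDegree_of_ne_zero (by rw [hA j]; exact ha)
    · have h1 : d ≤ (taylor k P - P).natDegree := le_natDegree_of_ne_zero (hTd k hk none)
      refine ⟨by lia, fun o => le_trans (hle _ ?_ ?_) h1,
          fun o => le_trans (hle _ (hrD o) (hrc o)) h1⟩
      · rw [natDegree_taylor]; exact hrD o
      · rw [hTD k _ (hrD o)]; exact hrc o

/-- Polynomial averages are controlled by box correlations of any member of maximal degree which
differs from the others by nonconstant polynomials. -/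
theorem polyControl [IsProbabilityMeasure μ] (hτ : IsAction τ μ)
    {ι : Type} [Fintype ι] (p : ι → ℤ[X]) (P : ℤ[X]) (hP : 1 ≤ P.natDegree)
    (hpP : ∀ i, (p i).natDegree ≤ P.natDegree) (hne : ∀ i, 1 ≤ (P - p i).natDegree) :
    PolyControl μ τ p P := by
  classical
  exact polyControl_of_subtype hτ p P (polyControl_of_map_leadTerms_eq hτ _ _ _ _ rfl (fun i => i.2) hP
    (fun i => hpP i) fun i => hne i)

end

/-! ### Eigenvectors of isometries with large correlations -/

lemma sum_ee_div (M : ℕ) (hM : 0 < M) (k : ℤ) :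
    ∑ j ∈ range M, ee (k * (j / M : ℝ)) = if (M : ℤ) ∣ k then (M : ℂ) else 0 := by
  have hM' : (M : ℝ) ≠ 0 := by positivity
  have hpow : ∀ j : ℕ, ee (k * (j / M : ℝ)) = ee (k / M : ℝ) ^ j := by
    intro j
    induction j with
    | zero => simp [ee_zero]
    | succ j ih => rw [pow_succ, ← ih, ← ee_add]; congr 1; push_cast; ring
  split_ifs with h
  · obtain ⟨l, rfl⟩ := h
    have : ee (((M : ℤ) * l : ℤ) / M : ℝ) = 1 := by
      rw [ee_eq_one_iff]; exact ⟨l, by push_cast; field_simp⟩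
    simp only [hpow, this, one_pow, sum_const, card_range, nsmul_eq_mul, mul_one]
  · have hne : ee (k / M : ℝ) ≠ 1 := by
      rw [Ne, ee_eq_one_iff]
      rintro ⟨l, hl⟩
      rw [div_eq_iff hM'] at hl
      exact h ⟨l, by rw [mul_comm]; exact_mod_cast hl⟩
    simp only [hpow]
    rw [geom_sum_eq hne, ← hpow]
    have : ee (k * (M / M : ℝ)) = 1 := by rw [div_self hM', mul_one]; exact ee_int k
    rw [this]; simp

lemma discrete_parseval (M : ℕ) (hM : 0 < M) (s : Finset ℤ)
    (hs : ∀ k ∈ s, ∀ l ∈ s, (M : ℤ) ∣ k - l → k = l) (c : ℤ → ℂ) :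
    ∑ j ∈ range M, ‖∑ k ∈ s, c k * ee (k * (j / M : ℝ))‖ ^ 2 = M * ∑ k ∈ s, ‖c k‖ ^ 2 := by
  have h1 : ∀ j : ℕ, ((‖∑ k ∈ s, c k * ee (k * (j / M : ℝ))‖ ^ 2 : ℝ) : ℂ) =
      ∑ k ∈ s, ∑ l ∈ s, c k * (starRingEnd ℂ) (c l) * ee ((k - l : ℤ) * (j / M : ℝ)) := by
    intro j
    rw [← Complex.normSq_eq_norm_sq, ← Complex.mul_conj, map_sum, sum_mul_sum]
    refine sum_congr rfl fun k _ => sum_congr rfl fun l _ => ?_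
    push_cast
    rw [map_mul, sub_mul, ee_sub]; ring
  have h2 : ((∑ j ∈ range M, ‖∑ k ∈ s, c k * ee (k * (j / M : ℝ))‖ ^ 2 : ℝ) : ℂ) =
      ((M * ∑ k ∈ s, ‖c k‖ ^ 2 : ℝ) : ℂ) := by
    rw [Complex.ofReal_sum]
    simp only [h1]
    rw [sum_comm]
    rw [Complex.ofReal_mul, Complex.ofReal_sum, Complex.ofReal_natCast, mul_sum]
    refine sum_congr rfl fun k hk => ?_
    rw [sum_comm, sum_eq_single k]
    · rw [← mul_sum, sum_ee_div M hM]
      simp only [sub_self, dvd_zero, if_true]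
      rw [Complex.mul_conj, Complex.normSq_eq_norm_sq]; push_cast; ring
    · intro l hl hlk
      rw [← mul_sum, sum_ee_div M hM, if_neg, mul_zero]
      exact fun h => hlk (hs k hk l hl h).symm
    · exact fun h => absurd hk h
  exact_mod_cast h2

section

variable {E : Type*} [NormedAddCommGroup E] [InnerProductSpace ℂ E]

/-- The exponential sum of the orbit of `x` with frequency `θ`. -/
noncomputable def orbitSum (U : E →ₗᵢ[ℂ] E) (x : E) (θ : ℝ) (N : ℕ) : E :=
  ∑ n ∈ range N, ee (n * θ) • (U ^ n) x

lemma norm_pow_apply (U : E →ₗᵢ[ℂ] E) (n : ℕ) (x : E) : ‖(U ^ n) x‖ = ‖x‖ := (U ^ n).norm_map x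

lemma exists_large_orbitSum (U : E →ₗᵢ[ℂ] E) (x : E) (hx : ‖x‖ ≤ 1) (a : ℤ → ℂ)
    (ha : ∀ n n' : ℕ, inner ℂ ((U ^ n') x) ((U ^ n) x) = a (n - n')) (L : ℕ) (hL : 0 < L) :
    ∃ θ ∈ Set.Icc (0 : ℝ) 1, (L : ℝ) / 4 * ∑ k ∈ Icc (-(L : ℤ)) L, ‖a k‖ ^ 2 ≤
      ‖orbitSum U x θ (2 * L)‖ ^ 2 := by
  set N := 2 * L with hN
  set M := 2 * N + 1 with hM
  set s := Icc (-(N : ℤ)) N with hs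
  set r : ℤ → ℕ := fun k => #((range N ×ˢ range N).filter fun q => (q.1 : ℤ) - q.2 = k) with hr
  have hT : ∀ θ : ℝ, ((‖orbitSum U x θ N‖ ^ 2 : ℝ) : ℂ) = ∑ k ∈ s, r k * a k * ee (k * θ) := by
    intro θ
    have h1 : ((‖orbitSum U x θ N‖ ^ 2 : ℝ) : ℂ) = inner ℂ (orbitSum U x θ N) (orbitSum U x θ N) := by
      rw [inner_self_eq_norm_sq_to_K]; push_cast; rfl
    have h2 : inner ℂ (orbitSum U x θ N) (orbitSum U x θ N) =
        ∑ q ∈ range N ×ˢ range N, a (q.1 - q.2 : ℤ) * ee ((q.1 - q.2 : ℤ) * θ) := by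
      unfold orbitSum
      rw [sum_inner, sum_product_right]
      refine sum_congr rfl fun n' _ => ?_
      rw [inner_sum]
      refine sum_congr rfl fun n _ => ?_
      rw [inner_smul_left, inner_smul_right, ha]
      push_cast
      rw [sub_mul, ee_sub]; ring
    rw [h1, h2, ← sum_fiberwise_of_maps_to (t := s) (g := fun q : ℕ × ℕ => (q.1 : ℤ) - q.2)]
    · refine sum_congr rfl fun k _ => ?_
      rw [hr, sum_congr rfl (g := fun _ => a k * ee (k * θ)), sum_const, nsmul_eq_mul, mul_assoc]
      intro q hq
      rw [(mem_filter.1 hq).2]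
    · intro q hq
      rw [mem_product, mem_range, mem_range] at hq
      exact mem_Icc.2 ⟨by lia, by lia⟩
  have hMpos : 0 < M := by lia
  have hM0 : (0 : ℝ) < M := by exact_mod_cast hMpos
  have hsep : ∀ k ∈ s, ∀ l ∈ s, (M : ℤ) ∣ k - l → k = l := by
    intro k hk l hl hd
    rw [mem_Icc] at hk hl
    have := Int.eq_zero_of_abs_lt_dvd hd (by rw [abs_lt]; constructor <;> lia)
    lia
  have hsq : ∑ j ∈ range M, (‖orbitSum U x (j / M) N‖ ^ 2) ^ 2 = M * ∑ k ∈ s, ‖r k * a k‖ ^ 2 := by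
    rw [← discrete_parseval M hMpos s hsep]
    refine sum_congr rfl fun j _ => ?_
    rw [← hT, Complex.norm_real, Real.norm_of_nonneg (by positivity)]
  have hsum : ∑ j ∈ range M, ‖orbitSum U x (j / M) N‖ ^ 2 ≤ M * N := by
    have h1 : ((∑ j ∈ range M, ‖orbitSum U x (j / M) N‖ ^ 2 : ℝ) : ℂ) = M * (r 0 * a 0) := by
      rw [Complex.ofReal_sum]
      simp only [hT]
      rw [sum_comm, sum_eq_single 0]
      · rw [← mul_sum, sum_ee_div M hMpos]; simp; ring
      · intro k hk hk0
        rw [← mul_sum, sum_ee_div M hMpos, if_neg, mul_zero]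
        intro hd
        exact hk0 (hsep k hk 0 (mem_Icc.2 ⟨by lia, by lia⟩) (by simpa using hd))
      · intro h; exact absurd (mem_Icc.2 ⟨by lia, by lia⟩) h
    have hr0 : r 0 ≤ N := by
      rw [hr]
      refine (card_le_card_of_injOn (t := range N) Prod.fst ?_ ?_).trans (card_range N).le
      · intro q hq; exact (mem_product.1 (mem_filter.1 hq).1).1
      · intro q hq q' hq' h
        have := (mem_filter.1 hq).2
        have := (mem_filter.1 hq').2
        exact Prod.ext h (by lia)
    have ha0 : ‖a 0‖ ≤ 1 := by
      have := ha 0 0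
      simp only [pow_zero, CharP.cast_eq_zero, sub_self] at this
      rw [← this]
      refine (norm_inner_le_norm _ _).trans ?_
      exact mul_le_one₀ hx (norm_nonneg _) hx
    calc _ ≤ ‖((∑ j ∈ range M, ‖orbitSum U x (j / M) N‖ ^ 2 : ℝ) : ℂ)‖ := by
          rw [Complex.norm_real]; exact le_abs_self _
      _ = M * (r 0 * ‖a 0‖) := by rw [h1]; simp
      _ ≤ M * (N * 1) := by gcongr
      _ = _ := by ring
  have hrL : ∀ k ∈ Icc (-(L : ℤ)) L, L ≤ r k := by
    intro k hk
    rw [mem_Icc] at hk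
    rw [hr]
    refine (card_range L).ge.trans (card_le_card_of_injOn
      (fun i => (i + k.toNat, i + (-k).toNat)) ?_ ?_)
    · intro i hi
      have hi := mem_range.1 hi
      simp only [coe_filter, Set.mem_ofPred_eq, mem_product, mem_range]
      refine ⟨⟨by lia, by lia⟩, ?_⟩
      push_cast; lia
    · intro i _ j _ h
      have := congrArg Prod.fst h
      simp only at this; lia
  by_contra! hcon
  set t := (L : ℝ) / 4 * ∑ k ∈ Icc (-(L : ℤ)) L, ‖a k‖ ^ 2 with ht
  have ht0 : 0 ≤ t := by positivity
  have hlt : ∀ j ∈ range M, ‖orbitSum U x (j / M) N‖ ^ 2 < t := fun j hj =>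
    hcon _ ⟨by positivity, by
      rw [div_le_one hM0]; exact_mod_cast (mem_range.1 hj).le⟩
  have h0t : 0 < t := lt_of_le_of_lt (by positivity) (hlt 0 (mem_range.2 hMpos))
  have h1 : M * ((L : ℝ) ^ 2 * ∑ k ∈ Icc (-(L : ℤ)) L, ‖a k‖ ^ 2) ≤ M * ∑ k ∈ s, ‖r k * a k‖ ^ 2 := by
    gcongr
    rw [mul_sum]
    refine le_trans (sum_le_sum fun k hk => ?_)
      (sum_le_sum_of_subset_of_nonneg (s := Icc (-(L : ℤ)) L)
      (Icc_subset_Icc (by lia) (by lia)) fun _ _ _ => by positivity)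
    rw [norm_mul, mul_pow, Complex.norm_natCast]
    have : (L : ℝ) ≤ r k := by exact_mod_cast hrL k hk
    gcongr
  have h2 : ∑ j ∈ range M, (‖orbitSum U x (j / M) N‖ ^ 2) ^ 2 ≤ t * (M * N) := by
    refine le_trans (le_of_le_of_eq (sum_le_sum fun j hj => ?_)
      (mul_sum _ (fun j : ℕ => ‖orbitSum U x (j / M) N‖ ^ 2) t).symm) (by gcongr)
    have := hlt j hj
    rw [pow_two (‖orbitSum U x (j / M) N‖ ^ 2)]
    gcongr
  rw [hsq] at h2
  have h3 := h1.trans h2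
  have hN' : (N : ℝ) = 2 * L := by rw [hN]; push_cast; ring
  have hL0 : (0 : ℝ) < L := by exact_mod_cast hL
  rw [hN'] at h3
  have h4 : (L : ℝ) ^ 2 * ∑ k ∈ Icc (-(L : ℤ)) L, ‖a k‖ ^ 2 = 4 * L * t := by rw [ht]; ring
  rw [h4] at h3
  have : 0 < M * L * t := by positivity
  nlinarith

lemma norm_orbitSum_le (U : E →ₗᵢ[ℂ] E) (x : E) (θ : ℝ) (N : ℕ) :
    ‖orbitSum U x θ N‖ ≤ N * ‖x‖ := by
  refine (norm_sum_le_of_le (f := fun n : ℕ => ee (n * θ) • (U ^ n) x) _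
    (fun n _ => (by rw [norm_smul, norm_ee, one_mul, norm_pow_apply] : _ ≤ ‖x‖))).trans ?_
  rw [sum_const, card_range, nsmul_eq_mul]

lemma orbitSum_add (U : E →ₗᵢ[ℂ] E) (x : E) (θ : ℝ) (M N : ℕ) :
    orbitSum U x θ (M + N) = orbitSum U x θ M + ee (M * θ) • (U ^ M) (orbitSum U x θ N) := by
  unfold orbitSum
  rw [sum_range_add, map_sum, smul_sum]
  congr 1
  refine sum_congr rfl fun n _ => ?_
  rw [map_smul, smul_smul, ← ee_add, pow_add]
  push_cast
  rw [add_mul]; rfl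

lemma norm_orbitSum_mul_le (U : E →ₗᵢ[ℂ] E) (x : E) (θ : ℝ) (N q : ℕ) :
    ‖orbitSum U x θ (N * q)‖ ≤ q * ‖orbitSum U x θ N‖ := by
  induction q with
  | zero => simp [orbitSum]
  | succ q ih =>
    rw [Nat.mul_succ, orbitSum_add]
    refine (norm_add_le _ _).trans ?_
    rw [norm_smul, norm_ee, one_mul, norm_pow_apply]
    push_cast
    linarith

lemma continuous_orbitSum (U : E →ₗᵢ[ℂ] E) (x : E) (N : ℕ) :
    Continuous fun θ => orbitSum U x θ N := by
  unfold orbitSum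
  refine continuous_finsetSum _ fun n _ => Continuous.smul ?_ continuous_const
  exact continuous_ee.comp (continuous_const.mul continuous_id)

lemma exists_frequency (U : E →ₗᵢ[ℂ] E) (x : E) (hx : ‖x‖ ≤ 1) {κ : ℝ}
    (h : ∃ᶠ N : ℕ in atTop, ∃ θ ∈ Set.Icc (0 : ℝ) 1, κ * N ≤ ‖orbitSum U x θ N‖) :
    ∃ θ : ℝ, ∀ N, κ * N ≤ ‖orbitSum U x θ N‖ := by
  obtain ⟨ns, hns, hth⟩ := extraction_of_frequently_atTop h
  choose θ hθ hκ using hth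
  obtain ⟨t, -, φ, hφ, hlim⟩ := isCompact_Icc.tendsto_subseq hθ
  refine ⟨t, fun N => ?_⟩
  rcases N.eq_zero_or_pos with rfl | hN
  · simp
  have hN0 : (0 : ℝ) < N := by exact_mod_cast hN
  set M : ℕ → ℕ := fun i => ns (φ i) with hM
  have hMt : Tendsto (fun i => (M i : ℝ)) atTop atTop :=
    tendsto_natCast_atTop_atTop.comp (hns.comp hφ).tendsto_atTop
  have h1 : Tendsto (fun i => ‖orbitSum U x (θ (φ i)) N‖) atTop (nhds ‖orbitSum U x t N‖) :=
    ((continuous_orbitSum U x N).norm.tendsto t).comp hlim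
  have h2 : Tendsto (fun i => κ * N - N ^ 2 / (M i : ℝ)) atTop (nhds (κ * N - 0)) :=
    tendsto_const_nhds.sub (tendsto_const_nhds.div_atTop hMt)
  rw [sub_zero] at h2
  refine le_of_tendsto_of_tendsto h2 h1 ?_
  filter_upwards [hMt.eventually_gt_atTop 0] with i hi
  have h3 := hκ (φ i)
  change κ * (M i : ℝ) ≤ ‖orbitSum U x (θ (φ i)) (M i)‖ at h3
  rw [← Nat.div_add_mod (M i) N, orbitSum_add] at h3
  have h4 := h3.trans (norm_add_le _ _)
  rw [norm_smul, norm_ee, one_mul, norm_pow_apply, Nat.div_add_mod] at h4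
  have h5 := norm_orbitSum_mul_le U x (θ (φ i)) N (M i / N)
  have h6 := norm_orbitSum_le U x (θ (φ i)) (M i % N)
  have h7 : ((M i % N : ℕ) : ℝ) ≤ N := by exact_mod_cast (Nat.mod_lt _ hN).le
  have h8 : ((M i / N : ℕ) : ℝ) ≤ M i / N := Nat.cast_div_le
  have h9 : κ * M i ≤ M i / N * ‖orbitSum U x (θ (φ i)) N‖ + N := by
    have : ((M i % N : ℕ) : ℝ) * ‖x‖ ≤ N * 1 := by gcongr
    have : ((M i / N : ℕ) : ℝ) * ‖orbitSum U x (θ (φ i)) N‖ ≤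
      M i / N * ‖orbitSum U x (θ (φ i)) N‖ := by gcongr
    linarith
  have h10 : κ * N - N ^ 2 / (M i : ℝ) = (κ * M i - N) * (N / M i) := by field_simp
  rw [h10]
  calc (κ * M i - N) * (N / M i) ≤ (M i / N * ‖orbitSum U x (θ (φ i)) N‖) * (N / M i) := by
        gcongr; linarith
    _ = _ := by field_simp

lemma exists_eigenvector [CompleteSpace E] (U : E →ₗᵢ[ℂ] E) (x : E) {κ : ℝ} {θ : ℝ}
    (h : ∀ N, κ * N ≤ ‖orbitSum U x θ N‖) :
    ∃ w : E, U w = ee (-θ) • w ∧ κ ≤ ‖w‖ ∧ inner ℂ w x = ((‖w‖ ^ 2 : ℝ) : ℂ) := by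
  set V : E →L[ℂ] E := ee θ • U.toContinuousLinearMap with hV
  have hVn : ‖V‖ ≤ 1 := by
    refine ContinuousLinearMap.opNorm_le_bound _ zero_le_one fun y => ?_
    rw [hV, smul_apply, norm_smul, norm_ee]
    simp
  have hiter : ∀ n : ℕ, V^[n] x = ee (n * θ) • (U ^ n) x := by
    intro n
    induction n with
    | zero => simp [ee_zero]
    | succ n ih =>
      rw [Function.iterate_succ_apply', ih, map_smul, hV, smul_apply, smul_smul,
        ← ee_add, pow_succ']
      push_cast
      rw [add_mul, one_mul]; rfl
  have hlim := ContinuousLinearMap.tendsto_birkhoffAverage_orthogonalProjection V hVn x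
  set K := V.eqLocus (1 : E →L[ℂ] E) with hK
  set w := K.starProjection x with hw
  have hwK : w ∈ K := K.starProjection_apply_mem x
  refine ⟨w, ?_, ?_, ?_⟩
  · have h1 : V w = w := by simpa [hK] using hwK
    rw [hV, smul_apply] at h1
    calc U w = ee (-θ) • (ee θ • U w) := by rw [smul_smul, ← ee_add]; simp
      _ = ee (-θ) • w := by rw [show ee θ • U w = w from h1]
  · refine ge_of_tendsto hlim.norm ?_
    filter_upwards [eventually_gt_atTop 0] with N hN
    have hN0 : (0 : ℝ) < N := by exact_mod_cast hN
    rw [birkhoffAverage, birkhoffSum, norm_smul, norm_inv, Complex.norm_natCast,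
      inv_mul_eq_div, le_div_iff₀ hN0]
    refine (h N).trans (le_of_eq ?_)
    simp only [orbitSum, hiter, id]
  · have h1 := K.starProjection_inner_eq_zero x w hwK
    rw [← hw, inner_sub_left, sub_eq_zero] at h1
    rw [← inner_conj_symm, h1, inner_self_eq_norm_sq_to_K]
    simp

end

/-! ### Eigenfunctions and the inverse theorem for the second seminorm -/

/-- Unimodular eigenfunctions, with the eigenvalue equation holding everywhere. -/
structure IsEig {X : Type*} [MeasurableSpace X] (τ : ℤ → X → X) (μ : Measure X) (θ : ℝ)
    (χ : X → ℂ) : Prop where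
  b1 : B1 χ
  eig : ∀ x, χ (τ 1 x) = ee θ * χ x
  norm_ae : ∀ᵐ x ∂μ, ‖χ x‖ = 1

section

variable {X : Type*} [MeasurableSpace X] {μ : Measure X} {τ : ℤ → X → X}

namespace IsEig

variable {θ θ' : ℝ} {χ χ' : X → ℂ}

lemma one : IsEig τ μ 0 (fun _ => 1) := ⟨B1.one, by simp, by simp⟩

lemma mul (h : IsEig τ μ θ χ) (h' : IsEig τ μ θ' χ') :
    IsEig τ μ (θ + θ') (fun x => χ x * χ' x) where
  b1 := h.b1.mul h'.b1
  eig x := by rw [h.eig, h'.eig, ee_add]; ring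
  norm_ae := by
    filter_upwards [h.norm_ae, h'.norm_ae] with x hx hx'
    rw [norm_mul, hx, hx', one_mul]

lemma conj (h : IsEig τ μ θ χ) : IsEig τ μ (-θ) (fun x => (starRingEnd ℂ) (χ x)) where
  b1 := h.b1.conj
  eig x := by rw [h.eig, ee_neg, map_mul]
  norm_ae := by
    filter_upwards [h.norm_ae] with x hx
    rw [RCLike.norm_conj, hx]

lemma congr (h : IsEig τ μ θ χ) (he : ee θ = ee θ') : IsEig τ μ θ' χ :=
  ⟨h.b1, fun x => by rw [h.eig, he], h.norm_ae⟩

lemma apply (hτ : IsAction τ μ) (h : IsEig τ μ θ χ) (n : ℤ) (x : X) :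
    χ (τ n x) = ee (n * θ) * χ x := by
  induction n using Int.induction_on with
  | zero => simp [hτ.zero]
  | succ n ih =>
    rw [add_comm, hτ.add, h.eig, ih, ← mul_assoc, ← ee_add]
    push_cast; ring_nf
  | pred n ih =>
    have h1 := h.eig (τ (-(n : ℤ) - 1) x)
    rw [← hτ.add, show (1 : ℤ) + (-(n : ℤ) - 1) = -n by ring, ih] at h1
    apply mul_left_cancel₀ (ee_ne_zero θ)
    rw [← h1, ← mul_assoc, ← ee_add]
    push_cast; ring_nf

/-- Eigenfunctions for the same eigenvalue are proportional. -/
lemma ae_eq_const_mul [IsProbabilityMeasure μ] (he : Ergodic (τ 1) μ) (h : IsEig τ μ θ χ)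
    (h' : IsEig τ μ θ χ') : ∃ c : ℂ, ‖c‖ = 1 ∧ χ' =ᵐ[μ] fun x => c * χ x := by
  obtain ⟨c, hc⟩ := he.ae_eq_const_of_ae_eq_comp_ae
    (g := fun x => χ' x * (starRingEnd ℂ) (χ x)) (h'.b1.mul h.b1.conj).meas.aestronglyMeasurable
    (Eventually.of_forall fun x => by
      simp only [Function.comp]
      rw [h.eig, h'.eig, map_mul]
      have : ee θ * (starRingEnd ℂ) (ee θ) = 1 := by
        rw [Complex.mul_conj, Complex.normSq_eq_norm_sq]; simp
      linear_combination (χ' x * (starRingEnd ℂ) (χ x)) * this)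
  refine ⟨c, ?_, ?_⟩
  · obtain ⟨x, h1, h2, h3⟩ := (hc.and (h.norm_ae.and h'.norm_ae)).exists
    simp only [Function.const_apply] at h1
    rw [← h1, norm_mul, RCLike.norm_conj, h2, h3, one_mul]
  · filter_upwards [hc, h.norm_ae] with x h1 h2
    simp only [Function.const_apply] at h1
    rw [← h1, mul_assoc, mul_comm ((starRingEnd ℂ) (χ x)), Complex.mul_conj,
      Complex.normSq_eq_norm_sq, h2]
    simp

/-- An almost everywhere eigenfunction can be modified into a strict one. -/
lemma exists_of_ae (hτ : IsAction τ μ) {w : X → ℂ} (hw : AEStronglyMeasurable w μ)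
    (h1 : ∀ᵐ x ∂μ, w (τ 1 x) = ee θ * w x) (h2 : ∀ᵐ x ∂μ, ‖w x‖ = 1) :
    ∃ χ, IsEig τ μ θ χ ∧ χ =ᵐ[μ] w := by
  set v := hw.mk w with hv
  have hvm : Measurable v := hw.stronglyMeasurable_mk.measurable
  have hvw : w =ᵐ[μ] v := hw.ae_eq_mk
  set G : Set X := {x | ∀ n : ℤ, v (τ (n + 1) x) = ee θ * v (τ n x) ∧ ‖v (τ n x)‖ = 1} with hG
  have hGm : MeasurableSet G := by
    have : G = ⋂ n : ℤ, ({x | v (τ (n + 1) x) = ee θ * v (τ n x)} ∩ {x | ‖v (τ n x)‖ = 1}) := by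
      ext x; simp [hG]
    rw [this]
    refine MeasurableSet.iInter fun n => MeasurableSet.inter ?_ ?_
    · exact measurableSet_eq_fun (hvm.comp (hτ.meas _))
        ((hvm.comp (hτ.meas _)).const_mul _)
    · exact measurableSet_eq_fun (hvm.comp (hτ.meas _)).norm measurable_const
  have hGae : ∀ᵐ x ∂μ, x ∈ G := by
    have h3 : ∀ᵐ x ∂μ, v (τ 1 x) = ee θ * v x ∧ ‖v x‖ = 1 := by
      filter_upwards [h1, h2, hvw, (hτ.mp 1).quasiMeasurePreserving.ae hvw] with x a b c d
      exact ⟨by rw [← d, ← c, a], by rw [← c, b]⟩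
    rw [hG]
    simp only [Set.mem_ofPred_eq]
    rw [ae_all_iff]
    intro n
    filter_upwards [(hτ.mp n).quasiMeasurePreserving.ae h3] with x hx
    rw [add_comm, hτ.add]; exact hx
  have hGinv : ∀ x, τ 1 x ∈ G ↔ x ∈ G := by
    intro x
    simp only [hG, Set.mem_ofPred_eq, ← hτ.add]
    constructor
    · intro h n
      have := h (n - 1)
      simpa [sub_add_cancel] using this
    · intro h n
      exact h (n + 1)
  classical
  refine ⟨G.indicator v, ⟨⟨hvm.indicator hGm, fun x => ?_⟩, fun x => ?_, ?_⟩, ?_⟩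
  · by_cases hx : x ∈ G
    · rw [Set.indicator_of_mem hx]
      have := (hx 0).2
      rw [hτ.zero] at this; exact this.le
    · rw [Set.indicator_of_notMem hx]; simp
  · by_cases hx : x ∈ G
    · rw [Set.indicator_of_mem hx, Set.indicator_of_mem ((hGinv x).2 hx)]
      have := (hx 0).1
      rwa [hτ.zero, zero_add] at this
    · rw [Set.indicator_of_notMem hx, Set.indicator_of_notMem (fun h => hx ((hGinv x).1 h))]; simp
  · filter_upwards [hGae] with x hx
    rw [Set.indicator_of_mem hx]
    have := (hx 0).2
    rwa [hτ.zero] at this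
  · filter_upwards [hGae, hvw] with x hx h
    rw [Set.indicator_of_mem hx, h]

end IsEig

/-- The inverse theorem: large average correlations force correlation with an eigenfunction. -/
theorem exists_isEig_of_correlations [IsProbabilityMeasure μ] (hτ : IsAction τ μ)
    (he : Ergodic (τ 1) μ) {E : X → ℂ} (hE : B1 E) {B : ℤ} (hB : B ≠ 0) {δ : ℝ} (hδ : 0 < δ)
    (h : ∃ᶠ H : ℕ in atTop, δ * (2 * H + 1) ≤ ∑ k ∈ Icc (-(H : ℤ)) H,
      ‖∫ x, (starRingEnd ℂ) (E x) * E (τ (B * k) x) ∂μ‖ ^ 2) :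
    ∃ θ χ, IsEig τ μ θ χ ∧ (Real.sqrt (δ / (8 * |B|)) : ℝ) ≤ ‖∫ x, E x * χ x ∂μ‖ := by
  have hEL : MemLp E 2 μ := MemLp.of_bound hE.meas.aestronglyMeasurable 1
    (Eventually.of_forall hE.norm_le)
  set U : Lp ℂ 2 μ →ₗᵢ[ℂ] Lp ℂ 2 μ := Lp.compMeasurePreservingₗᵢ ℂ (τ 1) (hτ.mp 1) with hU
  set y : Lp ℂ 2 μ := hEL.toLp E with hy
  have hyn : ‖y‖ ≤ 1 := by
    have h1 := Lp.norm_le_of_ae_bound (f := y) zero_le_one (by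
      filter_upwards [hEL.coeFn_toLp] with x hx
      rw [hx]; exact hE.norm_le x)
    simpa [measureUnivNNReal] using h1
  have hUn : ∀ n : ℕ, (U ^ n) y =ᵐ[μ] fun x => E (τ n x) := by
    intro n
    induction n with
    | zero => simpa [hτ.zero] using hEL.coeFn_toLp
    | succ n ih =>
      rw [pow_succ']
      have h1 : U ((U ^ n) y) =ᵐ[μ] ((U ^ n) y : X → ℂ) ∘ τ 1 :=
        Lp.coeFn_compMeasurePreserving _ (hτ.mp 1)
      refine h1.trans ?_
      filter_upwards [(hτ.mp 1).quasiMeasurePreserving.ae ih] with x hx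
      simp only [Function.comp, hx, ← hτ.add]
      push_cast; rfl
  set a : ℤ → ℂ := fun k => ∫ x, (starRingEnd ℂ) (E x) * E (τ k x) ∂μ with ha
  have hcorr : ∀ n n' : ℕ, inner ℂ ((U ^ n') y) ((U ^ n) y) = a ((n : ℤ) - n') := by
    intro n n'
    rw [L2.inner_def]
    have h1 : ∫ x, inner ℂ ((U ^ n') y x) ((U ^ n) y x) ∂μ
        = ∫ x, (starRingEnd ℂ) (E (τ n' x)) * E (τ n x) ∂μ := by
      refine integral_congr_ae ?_
      filter_upwards [hUn n, hUn n'] with x h1 h2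
      rw [h1, h2, RCLike.inner_apply, mul_comm]
    have h5 := hτ.integral_comp n' (fun x => (starRingEnd ℂ) (E x) * E (τ (n - n') x))
    simp only [← hτ.add, sub_add_cancel] at h5
    rw [h1, h5]
  have hBpos : (0 : ℝ) < |(B : ℝ)| := abs_pos.2 (by exact_mod_cast hB)
  have hBn : 0 < B.natAbs := Int.natAbs_pos.2 hB
  set κ := Real.sqrt (δ / (8 * |B|)) with hκ
  have hκ0 : 0 < κ := Real.sqrt_pos.2 (by push_cast; positivity)
  have hκ2 : κ ^ 2 = δ / (8 * |B|) := Real.sq_sqrt (by push_cast; positivity)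
  have hfreq : ∃ᶠ N : ℕ in atTop, ∃ θ ∈ Set.Icc (0 : ℝ) 1, κ * N ≤ ‖orbitSum U y θ N‖ := by
    have ht : Tendsto (fun H : ℕ => 2 * (B.natAbs * H)) atTop atTop :=
      tendsto_atTop_mono (fun H => show H ≤ _ by nlinarith) tendsto_id
    refine ht.frequently ((h.and_eventually (eventually_gt_atTop 0)).mono ?_)
    rintro H ⟨hH, hH0⟩
    obtain ⟨θ, hθ, h2⟩ := exists_large_orbitSum U y hyn a hcorr (B.natAbs * H)
      (by positivity)
    refine ⟨θ, hθ, ?_⟩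
    refine le_of_sq_le_sq ?_ (norm_nonneg _)
    refine le_trans ?_ h2
    have hsub : ∑ k ∈ Icc (-(H : ℤ)) H, ‖a (B * k)‖ ^ 2
        ≤ ∑ k ∈ Icc (-((B.natAbs * H : ℕ) : ℤ)) (B.natAbs * H : ℕ), ‖a k‖ ^ 2 := by
      rw [← sum_image (s := Icc (-(H : ℤ)) H) (f := fun k => ‖a k‖ ^ 2) (g := fun k => B * k)
        (fun _ _ _ _ hh => mul_left_cancel₀ hB hh)]
      refine sum_le_sum_of_subset_of_nonneg ?_ fun _ _ _ => by positivity
      intro z hz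
      obtain ⟨k, hk, rfl⟩ := mem_image.1 hz
      have hk' : |k| ≤ H := abs_le.2 (mem_Icc.1 hk)
      refine mem_Icc.2 (abs_le.1 ?_)
      rw [abs_mul]
      push_cast
      rw [← Int.natCast_natAbs B]
      push_cast
      gcongr
    have hBe : |(B : ℝ)| = (B.natAbs : ℝ) := by
      rw [Nat.cast_natAbs]; push_cast; rfl
    rw [mul_pow, hκ2]
    push_cast
    rw [hBe]
    have hb : (0 : ℝ) < B.natAbs := by exact_mod_cast hBn
    have hh : δ * (2 * H) ≤ ∑ k ∈ Icc (-((B.natAbs * H : ℕ) : ℤ)) (B.natAbs * H : ℕ), ‖a k‖ ^ 2 :=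
      le_trans (by linarith) (hH.trans hsub)
    push_cast at hh
    calc δ / (8 * (B.natAbs : ℝ)) * (2 * (B.natAbs * H)) ^ 2
        = (B.natAbs * H : ℝ) / 4 * (δ * (2 * H)) := by field_simp; ring
      _ ≤ _ := by gcongr
  obtain ⟨θ, hθ⟩ := exists_frequency U y hyn hfreq
  obtain ⟨w, hw1, hw2, hw3⟩ := exists_eigenvector U y hθ
  have hwτ : ∀ᵐ x ∂μ, w (τ 1 x) = ee (-θ) * w x := by
    have h1 : U w =ᵐ[μ] (w : X → ℂ) ∘ τ 1 := Lp.coeFn_compMeasurePreserving _ (hτ.mp 1)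
    rw [hw1] at h1
    filter_upwards [h1, Lp.coeFn_smul (ee (-θ)) w] with x h2 h3
    rw [h3] at h2
    simpa using h2.symm
  have hwm : AEStronglyMeasurable (w : X → ℂ) μ := (Lp.memLp w).aestronglyMeasurable
  obtain ⟨ρ, hρ⟩ := he.ae_eq_const_of_ae_eq_comp_ae (g := fun x => ‖w x‖) hwm.norm
    (by filter_upwards [hwτ] with x hx; simp [Function.comp, hx])
  have hρn : ρ = ‖w‖ := by
    obtain ⟨x, hx⟩ := hρ.exists
    have hρ0 : 0 ≤ ρ := by
      simp only [Function.const_apply] at hx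
      rw [← hx]; positivity
    rw [Lp.norm_def, eLpNorm_congr_norm_ae (g := fun _ => ρ) (by
      filter_upwards [hρ] with x hx
      rw [hx, Function.const_apply, Real.norm_of_nonneg hρ0]),
      eLpNorm_const _ (by norm_num) (IsProbabilityMeasure.ne_zero μ)]
    simp [abs_of_nonneg hρ0]
  have hρ0 : 0 < ρ := by rw [hρn]; linarith
  obtain ⟨χ, hχ, hχw⟩ := IsEig.exists_of_ae (θ := -θ) hτ (w := fun x => (ρ : ℂ)⁻¹ * w x)
    (hwm.const_mul _)
    (by filter_upwards [hwτ] with x hx; rw [hx]; ring)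
    (by
      filter_upwards [hρ] with x hx
      simp only [Function.const_apply] at hx
      rw [norm_mul, hx, norm_inv, Complex.norm_real, Real.norm_of_nonneg hρ0.le,
        inv_mul_cancel₀ hρ0.ne'])
  refine ⟨- -θ, _, hχ.conj, ?_⟩
  have h1 : ∫ x, E x * (starRingEnd ℂ) (χ x) ∂μ = ρ := by
    have h2 : ∫ x, E x * (starRingEnd ℂ) (χ x) ∂μ = (ρ : ℂ)⁻¹ * inner ℂ w y := by
      rw [L2.inner_def, ← integral_const_mul]
      refine integral_congr_ae ?_
      filter_upwards [hχw, hEL.coeFn_toLp] with x h3 h4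
      rw [h3, h4, RCLike.inner_apply]
      simp only [map_mul, map_inv₀, Complex.conj_ofReal]; ring
    rw [h2, hw3, ← hρn]
    push_cast
    field_simp
  rw [h1, Complex.norm_real, Real.norm_of_nonneg hρ0.le, hρn]
  exact hw2

end

/-! ### Box Cauchy-Schwarz for averages -/

section

variable {X : Type*} [MeasurableSpace X] {μ : Measure X}
  {m : (ℤ → ℂ) →ₗ[ℂ] ℂ}

lemma IsMean.norm_pow_le (hm : IsMean m) (k : ℕ) {F : ℤ → ℂ} {C : ℝ} (hF : ∀ n, ‖F n‖ ≤ C) :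
    ‖m F‖ ^ 2 ^ k ≤ (m (fun n => ((‖F n‖ ^ 2 ^ k : ℝ) : ℂ))).re := by
  induction k generalizing F C with
  | zero =>
    simp only [pow_zero, pow_one]
    exact hm.norm_le_re (D := C) (fun n => by simpa using hF n) (fun n => by simp)
  | succ k ih =>
    have h1 := ih (F := fun n => ((‖F n‖ ^ 2 : ℝ) : ℂ)) (C := C ^ 2) (fun n => by
      rw [Complex.norm_real, Real.norm_of_nonneg (by positivity)]
      have := hF n
      gcongr)
    have h2 : ∀ n, ‖((‖F n‖ ^ 2 : ℝ) : ℂ)‖ ^ 2 ^ k = ‖F n‖ ^ 2 ^ (k + 1) := fun n => by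
      rw [Complex.norm_real, Real.norm_of_nonneg (by positivity), ← pow_mul, pow_succ 2 k,
        mul_comm 2]
    simp only [h2] at h1
    refine le_trans ?_ h1
    rw [pow_succ 2 k, mul_comm, pow_mul]
    gcongr
    exact (hm.norm_sq_le hF).trans (Complex.re_le_norm _)

lemma norm_integral_pow_le [IsProbabilityMeasure μ] (k : ℕ) {f : X → ℂ} {C : ℝ}
    (hf : Measurable f) (hC : ∀ x, ‖f x‖ ≤ C) :
    ‖∫ x, f x ∂μ‖ ^ 2 ^ k ≤ ∫ x, ‖f x‖ ^ 2 ^ k ∂μ := by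
  induction k generalizing f C with
  | zero => simpa using norm_integral_le_integral_norm f
  | succ k ih =>
    have h1 := ih (f := fun x => ((‖f x‖ ^ 2 : ℝ) : ℂ)) (C := C ^ 2)
      (Complex.measurable_ofReal.comp (hf.norm.pow_const 2)) (fun n => by
      rw [Complex.norm_real, Real.norm_of_nonneg (by positivity)]
      have := hC n
      gcongr)
    have h2 : ∀ n, ‖((‖f n‖ ^ 2 : ℝ) : ℂ)‖ ^ 2 ^ k = ‖f n‖ ^ 2 ^ (k + 1) := fun n => by
      rw [Complex.norm_real, Real.norm_of_nonneg (by positivity), ← pow_mul, pow_succ 2 k,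
        mul_comm 2]
    simp only [h2] at h1
    refine le_trans ?_ h1
    rw [pow_succ 2 k, mul_comm, pow_mul, integral_complex_ofReal]
    gcongr
    rw [Complex.norm_real]
    exact (norm_integral_sq_le hf hC).trans (le_abs_self _)

/-- Box Cauchy-Schwarz inside an average of integrals. -/
theorem box_cauchy_schwarz_mean [IsProbabilityMeasure μ] (hm : IsMean m) (r : ℕ)
    (Ω : Fin (r + 1) → Finset ℤ) (φ : ℤ → X → (Fin (r + 1) → ℤ) → ℂ)
    (b : X → (Fin (r + 1) → ℤ) → ℂ) (hφ : ∀ n k, B1 fun x => φ n x k)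
    (hb : ∀ k, B1 fun x => b x k) (hb' : ∀ x, Low (b x)) {c : ℝ} (hc : 0 ≤ c)
    (h : c * #(Fintype.piFinset Ω) ≤
      ‖m (fun n => ∑ h ∈ Fintype.piFinset Ω, ∫ x, φ n x h * b x h ∂μ)‖) :
    c ^ 2 ^ (r + 1) * (#(Fintype.piFinset Ω) : ℝ) ^ 2 ≤
      ∑ h ∈ Fintype.piFinset Ω, ∑ h' ∈ Fintype.piFinset Ω,
        (m (fun n => ∫ x, cube (r + 1) (φ n x) h h' ∂μ)).re := by
  set P := Fintype.piFinset Ω with hP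
  rcases P.eq_empty_or_nonempty with h0 | h0
  · simp [h0]
  have hp : (0 : ℝ) < #P := by exact_mod_cast h0.card_pos
  set N := 2 ^ (r + 1) with hN
  set S : ℤ → X → ℂ := fun n x => ∑ h ∈ P, φ n x h * b x h with hS
  have hSm : ∀ n, Measurable (S n) := fun n =>
    Finset.measurable_fun_sum _ fun k _ => ((hφ n k).mul (hb k)).meas
  have hSb : ∀ n x, ‖S n x‖ ≤ #P := fun n x => by
    refine (norm_sum_le _ _).trans ?_
    refine (sum_le_sum fun k _ => ((hφ n k).mul (hb k)).norm_le x).trans (by simp)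
  have hcube : ∀ n h h', B1 fun x => cube (r + 1) (φ n x) h h' := fun n h h' =>
    B1.cube _ (hφ n) h h'
  have e1 : ∀ n, ∑ h ∈ P, ∫ x, φ n x h * b x h ∂μ = ∫ x, S n x ∂μ := fun n =>
    (integral_finsetSum _ fun k _ => ((hφ n k).mul (hb k)).integrable).symm
  simp only [e1] at h
  have hI : ∀ n, ‖∫ x, S n x ∂μ‖ ≤ #P := fun n => by
    have := norm_integral_le_of_norm_le_const (μ := μ) (Eventually.of_forall (hSb n))
    simpa using this
  set K : ℝ := (#P : ℝ) ^ N / (#P : ℝ) ^ 2 with hK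
  have h2 := hm.norm_pow_le (r + 1) hI
  have h3 : (m (fun n => ((‖∫ x, S n x ∂μ‖ ^ 2 ^ (r + 1) : ℝ) : ℂ))).re ≤
      (m (fun n => (K : ℂ) * ∑ h ∈ P, ∑ h' ∈ P, ∫ x, cube (r + 1) (φ n x) h h' ∂μ)).re := by
    refine hm.re_mono (C := (#P : ℝ) ^ N) (D := K * (#P * #P)) (fun n => ?_) (fun n => ?_)
      (fun n => ?_)
    · rw [Complex.norm_real, Real.norm_of_nonneg (by positivity)]
      have := hI n
      gcongr
    · rw [norm_mul, Complex.norm_real, Real.norm_of_nonneg (by positivity)]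
      gcongr
      refine (norm_sum_le _ _).trans ((sum_le_sum (g := fun _ => (#P : ℝ)) fun h _ => ?_).trans
        (by simp))
      refine (norm_sum_le _ _).trans ((sum_le_sum fun h' _ => (hcube n h h').norm_integral_le).trans
        (by simp))
    · rw [Complex.ofReal_re]
      refine (norm_integral_pow_le (r + 1) (hSm n) (hSb n)).trans ?_
      have e2 : (K : ℂ) * ∑ h ∈ P, ∑ h' ∈ P, ∫ x, cube (r + 1) (φ n x) h h' ∂μ =
          ∫ x, (K : ℂ) * ∑ h ∈ P, ∑ h' ∈ P, cube (r + 1) (φ n x) h h' ∂μ := by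
        rw [integral_const_mul, integral_finsetSum _ fun h _ => integrable_finsetSum _ fun h' _ =>
          (hcube n h h').integrable]
        congr 1
        refine sum_congr rfl fun h _ => ?_
        rw [integral_finsetSum _ fun h' _ => (hcube n h h').integrable]
      have hintg : Integrable (fun x => (K : ℂ) * ∑ h ∈ P, ∑ h' ∈ P, cube (r + 1) (φ n x) h h') μ :=
        (integrable_finsetSum _ fun h _ => integrable_finsetSum _ fun h' _ =>
          (hcube n h h').integrable).const_mul _
      rw [e2, ← RCLike.re_eq_complex_re, ← integral_re hintg]
      refine integral_mono ?_ hintg.re fun x => ?_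
      · refine Integrable.of_bound ((hSm n).norm.pow_const _).aestronglyMeasurable ((#P : ℝ) ^ N)
          (Eventually.of_forall fun x => ?_)
        rw [Real.norm_of_nonneg (by positivity)]
        have := hSb n x
        gcongr
      · beta_reduce
        have h4 := box_cauchy_schwarz r Ω (φ n x) (b x) (hb' x)
        rw [RCLike.re_eq_complex_re, Complex.re_ofReal_mul, hK, div_mul_eq_mul_div,
          le_div_iff₀ (by positivity), mul_comm]
        exact h4
  have h5 : (m (fun n => (K : ℂ) * ∑ h ∈ P, ∑ h' ∈ P, ∫ x, cube (r + 1) (φ n x) h h' ∂μ)).re =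
      K * ∑ h ∈ P, ∑ h' ∈ P, (m (fun n => ∫ x, cube (r + 1) (φ n x) h h' ∂μ)).re := by
    rw [IsMean.map_mul_left, Complex.re_ofReal_mul, IsMean.map_sum']
    simp only [IsMean.map_sum', Complex.re_sum]
  have h6 : (c * #P) ^ N ≤ K * ∑ h ∈ P, ∑ h' ∈ P,
      (m (fun n => ∫ x, cube (r + 1) (φ n x) h h' ∂μ)).re := by
    rw [← h5]
    refine le_trans ?_ (h2.trans h3)
    gcongr
  rw [mul_pow, hK, div_mul_eq_mul_div, le_div_iff₀ (by positivity)] at h6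
  have h7 : (0 : ℝ) < (#P : ℝ) ^ N := by positivity
  refine le_of_mul_le_mul_left ?_ h7
  linarith

end

/-! ### Degree lowering -/

section

variable {X : Type*} [MeasurableSpace X] {μ : Measure X} {τ : ℤ → X → X}
  {m : (ℤ → ℂ) →ₗ[ℂ] ℂ}

lemma card_box {s : ℕ} (H : Fin s → ℕ) : (#(box H) : ℝ) = ∏ j, (2 * (H j : ℝ) + 1) := by
  rw [box, Fintype.card_piFinset]
  push_cast
  refine prod_congr rfl fun j _ => ?_
  rw [Int.card_Icc]
  have : ((H j : ℤ) + 1 - -(H j : ℤ)).toNat = 2 * H j + 1 := by omega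
  rw [this]; push_cast; ring

lemma IsEig.cube (r : ℕ) {θ : (Fin r → ℤ) → ℝ} {χ : (Fin r → ℤ) → X → ℂ}
    (h : ∀ k, IsEig τ μ (θ k) (χ k)) (v v' : Fin r → ℤ) :
    IsEig τ μ (cubeSum r θ v v') (fun x => cube r (fun k => χ k x) v v') := by
  induction r with
  | zero => exact h _
  | succ r ih =>
    have h1 := (ih (fun k => h (Fin.cons (v 0) k)) (Fin.tail v) (Fin.tail v')).conj.mul
      (ih (fun k => h (Fin.cons (v' 0) k)) (Fin.tail v) (Fin.tail v'))
    rw [cubeSum, sub_eq_neg_add]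
    exact h1

/-- A large fraction of terms is large when the sum is large. -/
lemma card_filter_ge {ι : Type*} (s : Finset ι) (f : ι → ℝ) {c M : ℝ} (hc : 0 ≤ c) (hM : 0 < M)
    (hf : ∀ i ∈ s, f i ≤ M) (h : c * M * #s ≤ ∑ i ∈ s, f i) :
    c / 2 * #s ≤ #(s.filter fun i => c / 2 * M ≤ f i) := by
  rw [← sum_filter_add_sum_filter_not s (fun i => c / 2 * M ≤ f i)] at h
  have h1 : ∑ i ∈ s with c / 2 * M ≤ f i, f i ≤ #(s.filter fun i => c / 2 * M ≤ f i) * M := by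
    refine (sum_le_sum fun i hi => hf i (mem_filter.1 hi).1).trans (by simp)
  have h2 : ∑ i ∈ s with ¬ c / 2 * M ≤ f i, f i ≤ #s * (c / 2 * M) := by
    refine (sum_le_sum fun i hi => (not_le.1 (mem_filter.1 hi).2).le).trans ?_
    rw [sum_const, nsmul_eq_mul]
    gcongr
    exact filter_subset _ _
  have h3 : (c / 2 * #s) * M ≤ #(s.filter fun i => c / 2 * M ≤ f i) * M := by linarith
  exact le_of_mul_le_mul_right h3 hM

lemma exists_eigenfunctions [IsProbabilityMeasure μ] (hτ : IsAction τ μ) (he : Ergodic (τ 1) μ)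
    {s : ℕ} {B : ℤ} (hB : B ≠ 0) {δ : ℝ} (hδ : 0 < δ) {D : X → ℂ} (hD : B1 D)
    (h : Theta τ μ (s + 1) B δ D) (H : Fin s → ℕ) :
    ∃ A ⊆ box H, δ / 2 * #(box H) ≤ #A ∧ ∀ v ∈ A, ∃ θ χ, IsEig τ μ θ χ ∧
      Real.sqrt (δ / 2 / (8 * |B|)) ≤ ‖∫ x, cubeProd τ s B D 0 v x * χ x ∂μ‖ := by
  classical
  set c : ℕ → (Fin s → ℤ) → ℝ := fun H₀ v => ∑ a ∈ Icc (-(H₀ : ℤ)) H₀,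
    ‖∫ x, (starRingEnd ℂ) (cubeProd τ s B D 0 v x) * cubeProd τ s B D 0 v (τ (B * a) x) ∂μ‖ ^ 2
    with hc
  set A : ℕ → Finset (Fin s → ℤ) := fun H₀ =>
    (box H).filter fun v => δ / 2 * (2 * H₀ + 1) ≤ c H₀ v with hA
  have hcle : ∀ H₀ v, c H₀ v ≤ 2 * H₀ + 1 := by
    intro H₀ v
    have : ∀ a ∈ Icc (-(H₀ : ℤ)) H₀, ‖∫ x, (starRingEnd ℂ) (cubeProd τ s B D 0 v x) *
        cubeProd τ s B D 0 v (τ (B * a) x) ∂μ‖ ^ 2 ≤ 1 := fun a _ => by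
      have h1 := (B1.mul (hD.cubeProd hτ s B 0 v).conj
        ((hD.cubeProd hτ s B 0 v).comp (hτ.meas (B * a)))).norm_integral_le (μ := μ)
      exact pow_le_one₀ (norm_nonneg _) h1
    refine (sum_le_sum this).trans ?_
    rw [sum_const, Int.card_Icc, nsmul_eq_mul, mul_one]
    have : ((H₀ : ℤ) + 1 - -(H₀ : ℤ)).toNat = 2 * H₀ + 1 := by omega
    rw [this]; push_cast; exact le_refl _
  have hAcard : ∀ H₀, δ / 2 * #(box H) ≤ #(A H₀) := by
    intro H₀
    refine card_filter_ge (box H) (c H₀) hδ.le (by positivity) (fun v _ => hcle H₀ v) ?_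
    have h1 := h (Fin.cons H₀ H)
    rw [theta_sum_succ hτ, Fin.prod_univ_succ, sum_comm] at h1
    simp only [Fin.cons_zero, Fin.cons_succ, Fin.tail_cons] at h1
    rw [card_box, mul_assoc]
    refine h1.trans (le_of_eq ?_)
    refine sum_congr rfl fun v _ => sum_congr rfl fun a _ => ?_
    congr 3
    ext x
    rw [← cubeProd_translate hτ]
    simp only [cubeProd, cube_mul, cube_conj]
  obtain ⟨A', hA', hfr⟩ : ∃ A' ∈ (box H).powerset, ∃ᶠ H₀ in atTop, A H₀ = A' := by
    by_contra! hcon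
    have h1 := (eventually_all_finset (box H).powerset).2 hcon
    obtain ⟨H₀, h2⟩ := h1.exists
    exact h2 (A H₀) (mem_powerset.2 (filter_subset _ _)) rfl
  refine ⟨A', mem_powerset.1 hA', ?_, fun v hv => ?_⟩
  · obtain ⟨H₀, rfl⟩ := hfr.exists
    exact hAcard H₀
  · refine exists_isEig_of_correlations hτ he (hD.cubeProd hτ s B 0 v) hB (half_pos hδ) ?_
    refine hfr.mono fun H₀ h1 => ?_
    rw [← h1] at hv
    exact (mem_filter.1 hv).2

/-- `D` represents the averages of `w n • f₀ ∘ τ (-P n) • ∏ f i ∘ τ (p i n - P n)`. -/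
def IsDual (τ : ℤ → X → X) (μ : Measure X) (m : (ℤ → ℂ) →ₗ[ℂ] ℂ) {ι : Type} (S : Finset ι)
    (p : ι → ℤ → ℤ) (P : ℤ → ℤ) (D : X → ℂ) : Prop :=
  ∃ (w : ℤ → ℂ) (f₀ : X → ℂ) (f : ι → X → ℂ), (∀ n, ‖w n‖ = 1) ∧ B1 f₀ ∧ (∀ i, B1 (f i)) ∧
    ∀ φ : X → ℂ, Measurable φ → (∃ C : ℝ, ∀ x, ‖φ x‖ ≤ C) → ∫ x, φ x * D x ∂μ =
      m (fun n => ∫ x, φ x * (w n * (f₀ (τ (-P n) x) * ∏ i ∈ S, f i (τ (p i n - P n) x))) ∂μ)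

/-- Large twisted averages force the frequency of the twist to be rational with bounded
denominator. -/
def TwistControl (τ : ℤ → X → X) (μ : Measure X) {ι : Type} (S : Finset ι)
    (p : ι → ℤ → ℤ) (P : ℤ → ℤ) : Prop :=
  ∀ c : ℝ, 0 < c → ∃ b : ℕ, 0 < b ∧ ∀ (m : (ℤ → ℂ) →ₗ[ℂ] ℂ)
    (f₀ : X → ℂ) (f : ι → X → ℂ) (α : ℝ), IsMean m → B1 f₀ → (∀ i, B1 (f i)) →
    c ≤ ‖m (fun n => ee (α * P n) * ∫ x, f₀ x * ∏ i ∈ S, f i (τ (p i n) x) ∂μ)‖ →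
    ∃ z : ℤ, (b : ℝ) * α = z

lemma twist_of_cube (hτ : IsAction τ μ) {ι : Type} (S : Finset ι)
    (p : ι → ℤ → ℤ) (P : ℤ → ℤ) {w : ℤ → ℂ} (hw : ∀ n, ‖w n‖ = 1) (f₀ : X → ℂ) (f : ι → X → ℂ)
    (r : ℕ) (B : ℤ) {θ : (Fin (r + 1) → ℤ) → ℝ} {χ : (Fin (r + 1) → ℤ) → X → ℂ}
    (hχ : ∀ k, IsEig τ μ (θ k) (χ k)) (a : (Fin (r + 1) → ℤ) → ℂ) (v v' : Fin (r + 1) → ℤ)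
    (n : ℤ) :
    ∫ x, PolyConfig.cube (r + 1) (fun k => (w n * (f₀ (τ (-P n) (τ (B * ∑ j, k j) x)) *
        ∏ i ∈ S, f i (τ (p i n - P n) (τ (B * ∑ j, k j) x)))) * (a k * χ k x)) v v' ∂μ =
      PolyConfig.cube (r + 1) a v v' * (ee (cubeSum (r + 1) θ v v' * P n) *
        ∫ x, (cubeProd τ (r + 1) B f₀ v v' x * PolyConfig.cube (r + 1) (fun k => χ k x) v v') *
          ∏ i ∈ S, cubeProd τ (r + 1) B (f i) v v' (τ (p i n) x) ∂μ) := by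
  rw [← hτ.integral_comp (P n), ← integral_const_mul, ← integral_const_mul]
  congr 1; ext x
  simp only [cube_mul, cube_prod, cube_succ_const _ _ (hw n), one_mul]
  have h1 : ∀ k : Fin (r + 1) → ℤ,
      τ (-P n) (τ (B * ∑ j, k j) (τ (P n) x)) = τ (B * ∑ j, k j) x := fun k => by
    simp only [← hτ.add]; congr 1; ring
  have h2 : ∀ i (k : Fin (r + 1) → ℤ),
      τ (p i n - P n) (τ (B * ∑ j, k j) (τ (P n) x)) = τ (B * ∑ j, k j) (τ (p i n) x) :=
    fun i k => by
      simp only [← hτ.add]; congr 1; ring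
  simp only [h1, h2, (IsEig.cube (r + 1) hχ v v').apply hτ, cubeProd]
  rw [mul_comm (P n : ℝ)]
  ring

end

section

variable {X : Type*} [MeasurableSpace X] {μ : Measure X} {τ : ℤ → X → X}
  {m : (ℤ → ℂ) →ₗ[ℂ] ℂ}

/-- From eigenfunctions correlating with cubes of a dual function, produce a base vertex for which
many cubes of eigenfunctions appear in a twisted average. -/
lemma exists_base_vertex [IsProbabilityMeasure μ] (hm : IsMean m) (hτ : IsAction τ μ)
    {ι : Type} (S : Finset ι) (p : ι → ℤ → ℤ) (P : ℤ → ℤ) {D : X → ℂ} (hD : B1 D)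
    (hdual : IsDual τ μ m S p P D) (r : ℕ) (B : ℤ) (H : Fin (r + 1) → ℕ)
    {θ : (Fin (r + 1) → ℤ) → ℝ} {χ : (Fin (r + 1) → ℤ) → X → ℂ}
    (hχ : ∀ k, IsEig τ μ (θ k) (χ k)) (a : (Fin (r + 1) → ℤ) → ℂ) (ha : ∀ k, ‖a k‖ ≤ 1) {c : ℝ}
    (hc : 0 < c)
    (h : c * #(box H) ≤
      ‖∑ v ∈ box H, ∫ x, cubeProd τ (r + 1) B D 0 v x * (a v * χ v x) ∂μ‖) :
    ∃ v₀, ∃ A ⊆ box H, c ^ 2 ^ (r + 1) / 2 * #(box H) ≤ #A ∧ ∀ v ∈ A, a v ≠ 0 ∧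
      ∃ (f₀ : X → ℂ) (f : ι → X → ℂ), B1 f₀ ∧ (∀ i, B1 (f i)) ∧ c ^ 2 ^ (r + 1) / 2 ≤
        ‖m (fun n => ee (cubeSum (r + 1) θ v₀ v * P n) *
          ∫ x, f₀ x * ∏ i ∈ S, f i (τ (p i n) x) ∂μ)‖ := by
  classical
  obtain ⟨w, f₀, f, hw, hf₀, hf, hdual⟩ := hdual
  set g : ℤ → X → ℂ := fun n x => w n * (f₀ (τ (-P n) x) * ∏ i ∈ S, f i (τ (p i n - P n) x))
    with hg
  have hgB : ∀ n, B1 (g n) := fun n => (B1.const (hw n).le).mul ((hf₀.comp (hτ.meas _)).mul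
    (B1.prod S fun i _ => (hf i).comp (hτ.meas _)))
  set φ : ℤ → X → (Fin (r + 1) → ℤ) → ℂ := fun n x k =>
    g n (τ (B * ∑ j, k j) x) * (a k * χ k x) with hφ
  have hφB : ∀ n k, B1 fun x => φ n x k := fun n k =>
    ((hgB n).comp (hτ.meas _)).mul ((B1.const (ha k)).mul (hχ k).b1)
  set b : X → (Fin (r + 1) → ℤ) → ℂ := fun x k =>
    cubeRest (r + 1) (fun k => D (τ (B * ∑ j, k j) x)) 0 k with hb
  have hbB : ∀ k, B1 fun x => b x k := fun k =>
    B1.cubeRest (r + 1) (fun k => hD.comp (hτ.meas _)) 0 k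
  have hbL : ∀ x, Low (b x) := fun x => low_cubeRest _ (fun k => hD.norm_le _) 0
  have e1 : ∀ v, ∫ x, cubeProd τ (r + 1) B D 0 v x * (a v * χ v x) ∂μ =
      m (fun n => ∫ x, φ n x v * b x v ∂μ) := by
    intro v
    have hR : B1 (fun x => b x v * (a v * χ v x)) :=
      (hbB v).mul ((B1.const (ha v)).mul (hχ v).b1)
    set t := B * ∑ j, v j with ht
    have hR' : B1 (fun x => b (τ (-t) x) v * (a v * χ v (τ (-t) x))) := hR.comp (hτ.meas (-t))
    have h1 := hdual _ hR'.meas ⟨1, hR'.norm_le⟩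
    rw [← hτ.integral_comp t] at h1
    have h2 : ∀ n, ∫ x, b (τ (-t) x) v * (a v * χ v (τ (-t) x)) * g n x ∂μ =
        ∫ x, φ n x v * b x v ∂μ := fun n => by
      rw [← hτ.integral_comp t]
      simp only [hτ.apply_neg, hφ]
      congr 1; ext x; ring
    simp only [hτ.apply_neg] at h1
    rw [show (fun n => ∫ x, φ n x v * b x v ∂μ) = fun n => _ from funext fun n => (h2 n).symm,
      ← h1]
    congr 1; ext x
    rw [cubeProd, cube_eq_mul_cubeRest]
    ring
  simp only [e1, ← IsMean.map_sum'] at h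
  have h1 := box_cauchy_schwarz_mean hm r (fun j => Icc (-(H j : ℤ)) (H j)) φ b hφB hbB hbL hc.le h
  change c ^ 2 ^ (r + 1) * (#(box H) : ℝ) ^ 2 ≤ ∑ v ∈ box H, ∑ v' ∈ box H, _ at h1
  have hbox : (0 : ℝ) < #(box H) := by rw [card_box]; positivity
  obtain ⟨v₀, -, hv₀⟩ : ∃ v ∈ box H, c ^ 2 ^ (r + 1) * 1 * #(box H) ≤
      ∑ v' ∈ box H, (m (fun n => ∫ x, cube (r + 1) (φ n x) v v' ∂μ)).re := by
    refine exists_le_of_sum_le (by exact card_pos.1 (by exact_mod_cast hbox)) ?_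
    rw [sum_const, nsmul_eq_mul]
    refine le_trans (le_of_eq ?_) h1
    ring
  refine ⟨v₀, _, filter_subset _ _, card_filter_ge (box H) _ (by positivity) one_pos
    (fun v _ => ?_) hv₀, fun v hv => ?_⟩
  · refine (Complex.re_le_norm _).trans (hm.norm_le _ 1 fun n => ?_)
    exact (B1.cube (r + 1) (hφB n) v₀ v).norm_integral_le
  · have h2 := (mem_filter.1 hv).2
    simp only [mul_one, hφ, hg, twist_of_cube hτ S p P hw f₀ f r B hχ a, IsMean.map_mul_left] at h2
    have hpos : (0 : ℝ) < c ^ 2 ^ (r + 1) / 2 := by positivity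
    have hF₀ : B1 (fun x => cubeProd τ (r + 1) B f₀ v₀ v x *
        PolyConfig.cube (r + 1) (fun k => χ k x) v₀ v) :=
      (hf₀.cubeProd hτ _ _ _ _).mul (IsEig.cube (r + 1) hχ v₀ v).b1
    have h3 := h2.trans (Complex.re_le_norm _)
    rw [norm_mul] at h3
    refine ⟨fun h0 => ?_, _, _, hF₀, fun i => (hf i).cubeProd hτ (r + 1) B v₀ v, h3.trans ?_⟩
    · rw [cube_eq_mul_cubeRest, h0] at h3
      simp only [zero_mul, norm_zero] at h3
      linarith
    · exact mul_le_of_le_one_left (norm_nonneg _) (norm_cube_le _ ha _ _)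

/-- Many cubes of a dual function correlate with a fixed function times lower complexity terms. -/
lemma exists_low_structure [IsProbabilityMeasure μ] (hτ : IsAction τ μ)
    (he : Ergodic (τ 1) μ) {ι : Type} (S : Finset ι) (p : ι → ℤ → ℤ) (P : ℤ → ℤ)
    (hP : TwistControl τ μ S p P) (r : ℕ) {B : ℤ} (hB : B ≠ 0) {δ : ℝ} (hδ : 0 < δ) :
    ∃ κ > (0 : ℝ), ∃ η > (0 : ℝ), ∀ (m : (ℤ → ℂ) →ₗ[ℂ] ℂ) (D : X → ℂ), IsMean m → B1 D →
        IsDual τ μ m S p P D → Theta τ μ (r + 2) B δ D →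
      ∀ H : Fin (r + 1) → ℕ, ∃ A ⊆ box H, η * #(box H) ≤ #A ∧
        ∃ (ψ : X → ℂ) (b : X → (Fin (r + 1) → ℤ) → ℂ), B1 ψ ∧ (∀ k, B1 fun x => b x k) ∧
          (∀ x, Low (b x)) ∧
          ∀ v ∈ A, κ ≤ ‖∫ x, cubeProd τ (r + 1) B D 0 v x * (ψ x * b x v) ∂μ‖ := by
  classical
  set κ := Real.sqrt (δ / 2 / (8 * |B|)) with hκ
  have hBpos : (0 : ℝ) < |(B : ℝ)| := abs_pos.2 (by exact_mod_cast hB)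
  have hκ0 : 0 < κ := Real.sqrt_pos.2 (by push_cast; positivity)
  set c := κ * (δ / 2) with hc
  have hc0 : 0 < c := by positivity
  obtain ⟨q, hq0, hq⟩ := hP (c ^ 2 ^ (r + 1) / 2) (by positivity)
  have hq0' : (0 : ℝ) < q := by exact_mod_cast hq0
  refine ⟨κ, hκ0, c ^ 2 ^ (r + 1) / 2 / q, by positivity, fun m D hm hD hdual hΘ H => ?_⟩
  obtain ⟨A, hA, hAc, hAe⟩ := exists_eigenfunctions hτ he hB hδ hD hΘ H
  have hex : ∀ v, ∃ (θ : ℝ) (χ : X → ℂ) (a : ℂ), IsEig τ μ θ χ ∧ ‖a‖ ≤ 1 ∧ (v ∉ A → a = 0) ∧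
      (v ∈ A → κ ≤ ‖∫ x, cubeProd τ (r + 1) B D 0 v x * χ x ∂μ‖ ∧
        a * ∫ x, cubeProd τ (r + 1) B D 0 v x * χ x ∂μ =
          (‖∫ x, cubeProd τ (r + 1) B D 0 v x * χ x ∂μ‖ : ℝ)) := by
    intro v
    by_cases hv : v ∈ A
    · obtain ⟨θ, χ, h1, h2⟩ := hAe v hv
      set I := ∫ x, cubeProd τ (r + 1) B D 0 v x * χ x ∂μ with hI
      have hI0 : I ≠ 0 := norm_pos_iff.1 (hκ0.trans_le h2)
      have hI1 : (‖I‖ : ℂ) ≠ 0 := by exact_mod_cast (norm_ne_zero_iff.2 hI0)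
      refine ⟨θ, χ, ‖I‖ / I, h1, ?_, fun h => absurd hv h, fun _ => ⟨h2, ?_⟩⟩
      · rw [norm_div, Complex.norm_real, norm_norm, div_self (norm_ne_zero_iff.2 hI0)]
      · exact div_mul_cancel₀ _ hI0
    · exact ⟨0, _, 0, IsEig.one, by simp, fun _ => rfl, fun h => absurd h hv⟩
  choose θ χ a hχ ha ha0 haA using hex
  have hsum : c * #(box H) ≤
      ‖∑ v ∈ box H, ∫ x, cubeProd τ (r + 1) B D 0 v x * (a v * χ v x) ∂μ‖ := by
    have h1 : ∀ v, ∫ x, cubeProd τ (r + 1) B D 0 v x * (a v * χ v x) ∂μ =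
        ((if v ∈ A then ‖∫ x, cubeProd τ (r + 1) B D 0 v x * χ v x ∂μ‖ else 0 : ℝ) : ℂ) := by
      intro v
      have h2 : ∫ x, cubeProd τ (r + 1) B D 0 v x * (a v * χ v x) ∂μ =
          a v * ∫ x, cubeProd τ (r + 1) B D 0 v x * χ v x ∂μ := by
        rw [← integral_const_mul]
        congr 1; ext x; ring
      rw [h2]
      split_ifs with hv
      · exact (haA v hv).2
      · rw [ha0 v hv]; simp
    simp only [h1, ← Complex.ofReal_sum]
    rw [Complex.norm_real, Real.norm_of_nonneg
      (sum_nonneg fun v _ => by split_ifs <;> positivity), ← sum_filter,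
      filter_mem_eq_inter, inter_eq_right.2 hA]
    calc c * #(box H) = κ * (δ / 2 * #(box H)) := by rw [hc]; ring
      _ ≤ κ * #A := by gcongr
      _ = ∑ v ∈ A, κ := by rw [sum_const, nsmul_eq_mul, mul_comm]
      _ ≤ _ := sum_le_sum fun v hv => (haA v hv).1
  obtain ⟨v₀, A₁, hA₁, hA₁c, hA₁e⟩ := exists_base_vertex hm hτ S p P hD hdual r B H hχ a ha hc0 hsum
  have hrat : ∀ v ∈ A₁, ∃ z : ℤ, (q : ℝ) * cubeSum (r + 1) θ v₀ v = z := fun v hv => by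
    obtain ⟨-, f₀, f, hf₀, hf, h1⟩ := hA₁e v hv
    exact hq m f₀ f _ hm hf₀ hf h1
  choose! z hz using hrat
  have hbox : (0 : ℝ) < #(box H) := by rw [card_box]; positivity
  have hA₁pos : A₁.Nonempty := by
    rw [← card_pos]
    have : (0 : ℝ) < #A₁ := lt_of_lt_of_le (by positivity) hA₁c
    exact_mod_cast this
  -- pigeonhole the residue of the frequency
  obtain ⟨t, -, ht⟩ : ∃ t ∈ range q, c ^ 2 ^ (r + 1) / 2 / q * #(box H) ≤
      #(A₁.filter fun v => (z v % q).toNat = t) := by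
    refine exists_le_of_sum_le (by simpa using hq0.ne') ?_
    have h1 := card_eq_sum_card_fiberwise (s := A₁) (t := range q)
      (f := fun v => (z v % q).toNat) (fun v _ => by
        have h2 := Int.emod_nonneg (z v) (show (q : ℤ) ≠ 0 by exact_mod_cast hq0.ne')
        have h3 := Int.emod_lt_of_pos (z v) (show (0 : ℤ) < q by exact_mod_cast hq0)
        simp only [coe_range, Set.mem_Iio]
        omega)
    rw [sum_const, card_range, nsmul_eq_mul, ← Nat.cast_sum, ← h1]
    refine le_trans (le_of_eq ?_) hA₁c
    field_simp
  set A₂ := A₁.filter fun v => (z v % q).toNat = t with hA₂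
  have hA₂pos : A₂.Nonempty := by
    rw [← card_pos]
    have : (0 : ℝ) < #A₂ := lt_of_lt_of_le (by positivity) ht
    exact_mod_cast this
  obtain ⟨v₁, hv₁⟩ := hA₂pos
  refine ⟨A₂, (filter_subset _ _).trans hA₁, ht, fun x => PolyConfig.cube (r + 1)
    (fun k => χ k x) v₀ v₁, fun x k => (starRingEnd ℂ) (cubeRest (r + 1) (fun k => χ k x) v₀ k),
    (IsEig.cube (r + 1) hχ v₀ v₁).b1,
    fun k => (B1.cubeRest (r + 1) (fun k => (hχ k).b1) v₀ k).conj,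
    fun x => (low_cubeRest _ (fun k => (hχ k).b1.norm_le x) v₀).conj, fun v hv => ?_⟩
  have hvA : v ∈ A := by
    by_contra hcon
    exact (hA₁e v (mem_filter.1 hv).1).1 (ha0 v hcon)
  have hee : ee (cubeSum (r + 1) θ v₀ v) = ee (cubeSum (r + 1) θ v₀ v₁) := by
    have h1 := hz v (mem_filter.1 hv).1
    have h2 := hz v₁ (mem_filter.1 hv₁).1
    have h3 : z v % q = z v₁ % q := by
      have h4 := (mem_filter.1 hv).2
      have h5 := (mem_filter.1 hv₁).2
      have h6 := Int.emod_nonneg (z v) (show (q : ℤ) ≠ 0 by exact_mod_cast hq0.ne')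
      have h7 := Int.emod_nonneg (z v₁) (show (q : ℤ) ≠ 0 by exact_mod_cast hq0.ne')
      omega
    obtain ⟨y, hy⟩ := Int.ModEq.dvd (show z v₁ ≡ z v [ZMOD q] from h3.symm)
    have h8 : cubeSum (r + 1) θ v₀ v = cubeSum (r + 1) θ v₀ v₁ + y := by
      apply mul_left_cancel₀ hq0'.ne'
      rw [mul_add, h1, h2]
      have : (z v : ℝ) - z v₁ = q * y := by exact_mod_cast hy
      linarith
    rw [h8, ee_add, ee_int, mul_one]
  obtain ⟨u, hu, hu'⟩ := (IsEig.cube (r + 1) hχ v₀ v₁).ae_eq_const_mul he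
    ((IsEig.cube (r + 1) hχ v₀ v).congr hee)
  refine (haA v hvA).1.trans (le_of_eq ?_)
  have h9 : ∫ x, cubeProd τ (r + 1) B D 0 v x * χ v x ∂μ =
      u * ∫ x, cubeProd τ (r + 1) B D 0 v x * (PolyConfig.cube (r + 1) (fun k => χ k x) v₀ v₁ *
        (starRingEnd ℂ) (cubeRest (r + 1) (fun k => χ k x) v₀ v)) ∂μ := by
    rw [← integral_const_mul]
    refine integral_congr_ae ?_
    filter_upwards [hu', (IsEig.cube (r + 1) hχ v₀ v).norm_ae, (hχ v).norm_ae] with x h1 h2 h3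
    rw [cube_eq_mul_cubeRest] at h1 h2
    have h4 : ‖cubeRest (r + 1) (fun k => χ k x) v₀ v‖ = 1 := by
      rwa [norm_mul, h3, one_mul] at h2
    have h5 : cubeRest (r + 1) (fun k => χ k x) v₀ v *
        (starRingEnd ℂ) (cubeRest (r + 1) (fun k => χ k x) v₀ v) = 1 := by
      rw [Complex.mul_conj, Complex.normSq_eq_norm_sq, h4]; simp
    linear_combination (-cubeProd τ (r + 1) B D 0 v x * χ v x) * h5 +
      (cubeProd τ (r + 1) B D 0 v x *
        (starRingEnd ℂ) (cubeRest (r + 1) (fun k => χ k x) v₀ v)) * h1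
  rw [h9, norm_mul, hu, one_mul]

end

lemma Low.const {r : ℕ} {c : ℂ} (hc : ‖c‖ ≤ 1) : Low fun _ : Fin (r + 1) → ℤ => c := by
  refine ⟨fun j _ => if j = 0 then c else 1, fun j _ => ?_, fun _ _ _ => rfl, fun h => by simp⟩
  by_cases hj : j = 0
  · simpa [hj] using hc
  · simp [hj]

lemma sum_sub_le_card_mul_sum {s : ℕ} (H H' : Fin s → ℕ) (hH : ∀ j, 2 * H' j ≤ H j)
    (g : (Fin s → ℤ) → ℝ) (hg : ∀ k, 0 ≤ g k) :
    ∑ h ∈ box H', ∑ h' ∈ box H', g (h' - h) ≤ #(box H') * ∑ k ∈ box H, g k := by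
  classical
  rw [← nsmul_eq_mul]
  refine sum_le_card_nsmul _ _ _ fun h hh => ?_
  rw [← sum_image (s := box H') (g := fun h' => h' - h) (f := g)
    (fun x _ y _ hxy => sub_left_injective hxy)]
  refine sum_le_sum_of_subset_of_nonneg (fun k hk => ?_) fun _ _ _ => hg _
  obtain ⟨h', hh', rfl⟩ := mem_image.1 hk
  simp only [box, Fintype.mem_piFinset, mem_Icc, Pi.sub_apply] at hh hh' ⊢
  intro j
  have := hH j
  have := hh j
  have := hh' j
  omega

section

variable {X : Type*} [MeasurableSpace X] {μ : Measure X} {τ : ℤ → X → X}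
  {m : (ℤ → ℂ) →ₗ[ℂ] ℂ}

/-- If many cubes of `D` correlate with terms of lower complexity, the box correlations of `D`
are large. -/
lemma cube_correlations_of_low [IsProbabilityMeasure μ] (hm : IsMean m) (hτ : IsAction τ μ)
    {D : X → ℂ} (hD : B1 D) (r : ℕ) (B : ℤ) (H : Fin (r + 1) → ℕ) {ψ : X → ℂ} (hψ : B1 ψ)
    {b : X → (Fin (r + 1) → ℤ) → ℂ} (hb : ∀ k, B1 fun x => b x k) (hb' : ∀ x, Low (b x)) {c : ℝ}
    (hc : 0 ≤ c)
    (h : c * #(box H) ≤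
      ∑ v ∈ box H, ‖∫ x, cubeProd τ (r + 1) B D 0 v x * (ψ x * b x v) ∂μ‖ ^ 2) :
    c ^ 2 ^ (r + 1) * (#(box H) : ℝ) ^ 2 ≤
      ∑ h ∈ box H, ∑ h' ∈ box H, ‖∫ x, cubeProd τ (r + 1) B D h h' x ∂μ‖ ^ 2 := by
  set β : X → (Fin (r + 1) → ℤ) → ℂ := fun x v =>
    cubeRest (r + 1) (fun k => D (τ (B * ∑ j, k j) x)) 0 v * (ψ x * b x v) with hβ
  have hβB : ∀ v, B1 fun x => β x v := fun v =>
    (B1.cubeRest (r + 1) (fun k => hD.comp (hτ.meas _)) 0 v).mul (hψ.mul (hb v))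
  have hβL : ∀ x, Low (β x) := fun x =>
    (low_cubeRest _ (fun k => hD.norm_le _) 0).mul ((Low.const (hψ.norm_le x)).mul (hb' x))
  have key : ∀ g : X → ℂ, ∫ z, g z.1 * (starRingEnd ℂ) (g z.2) ∂μ.prod μ =
      ((‖∫ x, g x ∂μ‖ ^ 2 : ℝ) : ℂ) := fun g => by
    rw [integral_prod_mul (μ := μ) (ν := μ) g (fun y => (starRingEnd ℂ) (g y)), integral_conj,
      Complex.mul_conj, Complex.normSq_eq_norm_sq]
  have h1 := box_cauchy_schwarz_mean (μ := μ.prod μ) hm r (fun j => Icc (-(H j : ℤ)) (H j))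
    (fun _ z v => D (τ (B * ∑ j, v j) z.1) * (starRingEnd ℂ) (D (τ (B * ∑ j, v j) z.2)))
    (fun z v => β z.1 v * (starRingEnd ℂ) (β z.2 v))
    (fun _ v => ((hD.comp (hτ.meas _)).comp measurable_fst).mul
      ((hD.comp (hτ.meas _)).comp measurable_snd).conj)
    (fun v => ((hβB v).comp measurable_fst).mul ((hβB v).comp measurable_snd).conj)
    (fun z => (hβL z.1).mul (hβL z.2).conj) hc ?_
  · refine h1.trans (le_of_eq ?_)
    refine sum_congr rfl fun h _ => sum_congr rfl fun h' _ => ?_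
    rw [hm.const]
    have h2 : ∀ z : X × X, PolyConfig.cube (r + 1) (fun v => D (τ (B * ∑ j, v j) z.1) *
        (starRingEnd ℂ) (D (τ (B * ∑ j, v j) z.2))) h h' =
        cubeProd τ (r + 1) B D h h' z.1 * (starRingEnd ℂ) (cubeProd τ (r + 1) B D h h' z.2) :=
      fun z => by rw [cube_mul, cube_conj]; rfl
    simp only [h2]
    rw [key, Complex.ofReal_re]
  · rw [hm.const]
    have h2 : ∀ v, ∫ z : X × X, D (τ (B * ∑ j, v j) z.1) *
        (starRingEnd ℂ) (D (τ (B * ∑ j, v j) z.2)) *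
        (β z.1 v * (starRingEnd ℂ) (β z.2 v)) ∂μ.prod μ =
        ((‖∫ x, cubeProd τ (r + 1) B D 0 v x * (ψ x * b x v) ∂μ‖ ^ 2 : ℝ) : ℂ) := fun v => by
      rw [← key]
      congr 1; ext z
      simp only [cubeProd, cube_eq_mul_cubeRest, hβ, map_mul]
      ring
    simp only [h2, ← Complex.ofReal_sum]
    rw [Complex.norm_real]
    exact h.trans (Real.le_norm_self _)

lemma card_box_le (s : ℕ) (H : Fin s → ℕ) :
    (#(box H) : ℝ) ≤ 3 ^ s * #(box fun j => H j / 2) := by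
  rw [card_box, card_box]
  have : ∏ j : Fin s, (3 : ℝ) = 3 ^ s := by simp
  rw [← this, ← prod_mul_distrib]
  refine prod_le_prod (fun _ _ => by positivity) fun j _ => ?_
  have : 2 * H j + 1 ≤ 3 * (2 * (H j / 2) + 1) := by omega
  exact_mod_cast this

/-- **Degree lowering**: dual functions with large box correlations of some order have large box
correlations of the next lower order. -/
theorem degree_lowering [IsProbabilityMeasure μ] (hτ : IsAction τ μ)
    (he : Ergodic (τ 1) μ) {ι : Type} (S : Finset ι) (p : ι → ℤ → ℤ) (P : ℤ → ℤ)
    (hP : TwistControl τ μ S p P) (r : ℕ) {B : ℤ} (hB : B ≠ 0) {δ : ℝ} (hδ : 0 < δ) :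
    ∃ δ' > (0 : ℝ), ∀ (m : (ℤ → ℂ) →ₗ[ℂ] ℂ) (D : X → ℂ), IsMean m → B1 D → IsDual τ μ m S p P D →
        Theta τ μ (r + 2) B δ D →
      Theta τ μ (r + 1) B δ' D := by
  obtain ⟨κ, hκ, η, hη, hlow⟩ := exists_low_structure hτ he S p P hP r hB hδ
  refine ⟨(κ ^ 2 * η) ^ 2 ^ (r + 1) / 3 ^ (r + 1), by positivity, fun m D hm hD hdual hΘ H => ?_⟩
  set H' : Fin (r + 1) → ℕ := fun j => H j / 2 with hH'
  obtain ⟨A, hA, hAc, ψ, b, hψ, hb, hb', hAe⟩ := hlow m D hm hD hdual hΘ H'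
  have h1 := cube_correlations_of_low hm hτ hD r B H' hψ hb hb' (c := κ ^ 2 * η) (by positivity) ?_
  · have h0 : ∑ h ∈ box H', ∑ h' ∈ box H', ‖∫ x, cubeProd τ (r + 1) B D h h' x ∂μ‖ ^ 2 =
        ∑ h ∈ box H', ∑ h' ∈ box H', ‖∫ x, cubeProd τ (r + 1) B D 0 (h' - h) x ∂μ‖ ^ 2 :=
      sum_congr rfl fun h _ => sum_congr rfl fun h' _ => by rw [integral_cubeProd hτ _ _ _ h h']
    rw [h0] at h1
    have h2 := h1.trans (sum_sub_le_card_mul_sum H H' (fun j => by simp only [hH']; omega)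
      (fun k => ‖∫ x, cubeProd τ (r + 1) B D 0 k x ∂μ‖ ^ 2) fun _ => by positivity)
    have hbox : (0 : ℝ) < #(box H') := by rw [card_box]; positivity
    rw [← card_box]
    have h3 := card_box_le (r + 1) H
    have h4 : (κ ^ 2 * η) ^ 2 ^ (r + 1) * #(box H') ≤
        ∑ k ∈ box H, ‖∫ x, cubeProd τ (r + 1) B D 0 k x ∂μ‖ ^ 2 := by
      refine le_of_mul_le_mul_left (le_trans (le_of_eq ?_) h2) hbox
      ring
    refine le_trans ?_ h4
    rw [div_mul_eq_mul_div, div_le_iff₀ (by positivity), mul_assoc]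
    gcongr
    rw [mul_comm]
    exact h3
  · calc κ ^ 2 * η * #(box H') = κ ^ 2 * (η * #(box H')) := by ring
      _ ≤ κ ^ 2 * #A := by gcongr
      _ = ∑ v ∈ A, κ ^ 2 := by rw [sum_const, nsmul_eq_mul, mul_comm]
      _ ≤ ∑ v ∈ A, ‖∫ x, cubeProd τ (r + 1) B D 0 v x * (ψ x * b x v) ∂μ‖ ^ 2 :=
        sum_le_sum fun v hv => by have := hAe v hv; gcongr
      _ ≤ _ := sum_le_sum_of_subset_of_nonneg hA fun _ _ _ => by positivity

end

section

variable {X : Type*} [MeasurableSpace X] {μ : Measure X} {τ : ℤ → X → X}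

open Polynomial

lemma theta_one_of_theta [IsProbabilityMeasure μ] (hτ : IsAction τ μ)
    (he : Ergodic (τ 1) μ) {ι : Type} (S : Finset ι) (p : ι → ℤ → ℤ) (P : ℤ → ℤ)
    (hP : TwistControl τ μ S p P) (s : ℕ) {B : ℤ} (hB : B ≠ 0) {δ : ℝ} (hδ : 0 < δ) :
    ∃ δ' > (0 : ℝ), ∀ (m : (ℤ → ℂ) →ₗ[ℂ] ℂ) (D : X → ℂ), IsMean m → B1 D →
      IsDual τ μ m S p P D → Theta τ μ (s + 1) B δ D → Theta τ μ 1 B δ' D := by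
  induction s generalizing δ with
  | zero => exact ⟨δ, hδ, fun m D _ _ _ h => h⟩
  | succ s ih =>
    obtain ⟨δ₁, hδ₁, h1⟩ := degree_lowering hτ he S p P hP s hB hδ
    obtain ⟨δ₂, hδ₂, h2⟩ := ih hδ₁
    exact ⟨δ₂, hδ₂, fun m D hm hD hdual h => h2 m D hm hD hdual (h1 m D hm hD hdual h)⟩

lemma exists_isEig_of_theta_one [IsProbabilityMeasure μ] (hτ : IsAction τ μ)
    (he : Ergodic (τ 1) μ) {B : ℤ} (hB : B ≠ 0) {δ : ℝ} (hδ : 0 < δ) {D : X → ℂ} (hD : B1 D)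
    (h : Theta τ μ 1 B δ D) :
    ∃ θ χ, IsEig τ μ θ χ ∧ Real.sqrt (δ / 2 / (8 * |B|)) ≤ ‖∫ x, D x * χ x ∂μ‖ := by
  obtain ⟨A, hA, hAc, hAe⟩ := exists_eigenfunctions hτ he hB hδ hD h (0 : Fin 0 → ℕ)
  have hbox : (0 : ℝ) < #(box (0 : Fin 0 → ℕ)) := by rw [card_box]; positivity
  obtain ⟨v, hv⟩ : A.Nonempty := by
    rw [← card_pos]
    have : (0 : ℝ) < #A := lt_of_lt_of_le (by positivity) hAc
    exact_mod_cast this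
  obtain ⟨θ, χ, h1, h2⟩ := hAe v hv
  refine ⟨θ, χ, h1, h2.trans (le_of_eq ?_)⟩
  simp [cubeProd, PolyConfig.cube, hτ.zero]

/-- Large twisted multiple averages force rational twists and a correlation of `f₀` with an
eigenfunction of rational eigenvalue. -/
def CharControl (τ : ℤ → X → X) (μ : Measure X) {ι : Type} [Fintype ι] [DecidableEq ι]
    (p : ι → ℤ[X]) (S : Finset ι) : Prop :=
  ∀ c : ℝ, 0 < c → ∃ b : ℕ, 0 < b ∧ ∀ (m : (ℤ → ℂ) →ₗ[ℂ] ℂ) (f₀ : X → ℂ) (f : ι → X → ℂ)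
    (θ : ι → ℝ), IsMean m → B1 f₀ → (∀ i, B1 (f i)) →
    c ≤ ‖m (fun n => (∏ j ∈ Sᶜ, ee (θ j * ((p j).eval n : ℤ))) *
      ∫ x, f₀ x * ∏ i ∈ S, f i (τ ((p i).eval n) x) ∂μ)‖ →
    (∀ j ∉ S, ∃ z : ℤ, (b : ℝ) * θ j = z) ∧
      ∃ θ' χ, IsEig τ μ θ' χ ∧ (∃ z : ℤ, (b : ℝ) * θ' = z) ∧ ∫ x, f₀ x * χ x ∂μ ≠ 0

variable {ι : Type} [Fintype ι] [DecidableEq ι]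

lemma charControl_empty [IsProbabilityMeasure μ] (p : ι → ℤ[X]) (hp : LinearIndependent ℤ p)
    (hp0 : ∀ i, (p i).eval 0 = 0) : CharControl τ μ p ∅ := by
  intro c hc
  obtain ⟨b, hb, h⟩ := exists_int_mul_of_large_mean p hp hp0 c hc
  refine ⟨b, hb, fun m f₀ f θ hm hf₀ hf hcm => ?_⟩
  simp only [compl_empty, prod_empty, mul_one, IsMean.map_mul_right] at hcm
  rw [norm_mul] at hcm
  refine ⟨fun j _ => h m hm θ (hcm.trans (mul_le_of_le_one_right (norm_nonneg _)
    hf₀.norm_integral_le)) j, 0, fun _ => 1, IsEig.one, ⟨0, by simp⟩, fun h0 => ?_⟩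
  simp only [mul_one] at h0
  rw [h0, norm_zero, mul_zero] at hcm
  linarith

lemma twistControl_of_charControl (p : ι → ℤ[X]) (S : Finset ι) {j : ι} (hj : j ∉ S)
    (h : CharControl τ μ p S) :
    TwistControl τ μ S (fun i n => (p i).eval n) (fun n => (p j).eval n) := by
  intro c hc
  obtain ⟨b, hb, h⟩ := h c hc
  refine ⟨b, hb, fun m f₀ f α hm hf₀ hf hcm => ?_⟩
  have h1 := (h m f₀ f (Pi.single j α) hm hf₀ hf (hcm.trans (le_of_eq ?_))).1 j hj
  · simpa using h1
  · congr 2; funext n; congr 1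
    rw [prod_eq_single_of_mem j (by simpa using hj)]
    · simp
    · intro i _ hi
      simp [hi, ee_zero]

omit [Fintype ι] [DecidableEq ι] in
lemma exists_dual [IsProbabilityMeasure μ] {m : (ℤ → ℂ) →ₗ[ℂ] ℂ} (hm : IsMean m)
    (hτ : IsAction τ μ) (S : Finset ι) (p : ι → ℤ → ℤ) (P : ℤ → ℤ) {w : ℤ → ℂ}
    (hw : ∀ n, ‖w n‖ = 1) {f₀ : X → ℂ} (hf₀ : B1 f₀) {f : ι → X → ℂ} (hf : ∀ i, B1 (f i)) :
    ∃ D, B1 D ∧ IsDual τ μ m S p P D ∧ ∀ φ, B1 φ → ∫ x, φ x * D x ∂μ = m (fun n => w n *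
      ∫ x, f₀ x * (∏ i ∈ S, f i (τ (p i n) x)) * φ (τ (P n) x) ∂μ) := by
  obtain ⟨D, hD, h⟩ := exists_weak_limit (μ := μ) hm
    (fun n x => w n * (f₀ (τ (-P n) x) * ∏ i ∈ S, f i (τ (p i n - P n) x)))
    fun n => (B1.const (hw n).le).mul ((hf₀.comp (hτ.meas _)).mul
      (B1.prod S fun i _ => (hf i).comp (hτ.meas _)))
  refine ⟨D, hD, ⟨w, f₀, f, hw, hf₀, hf, h⟩, fun φ hφ => ?_⟩
  rw [h φ hφ.meas ⟨1, hφ.norm_le⟩]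
  congr 1; funext n
  rw [← hτ.integral_comp (P n), ← integral_const_mul]
  congr 1; funext x
  simp only [← hτ.add, sub_add_cancel, neg_add_cancel, hτ.zero]
  ring

lemma charControl_insert [IsProbabilityMeasure μ] (hτ : IsAction τ μ) (he : Ergodic (τ 1) μ)
    (p : ι → ℤ[X]) (hp : LinearIndependent ℤ p) (hp0 : ∀ i, (p i).eval 0 = 0) (S : Finset ι)
    {j : ι} (hj : j ∉ S) (hdeg : ∀ i ∈ S, (p i).natDegree ≤ (p j).natDegree)
    (h : CharControl τ μ p S) : CharControl τ μ p (insert j S) := by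
  intro c hc
  have hnat : ∀ q : ℤ[X], q ≠ 0 → q.eval 0 = 0 → 1 ≤ q.natDegree := by
    intro q hq hq0
    by_contra hcon
    have h1 : q.natDegree = 0 := by lia
    rw [eq_C_of_natDegree_eq_zero h1] at hq0 hq
    simp only [eval_C] at hq0
    rw [hq0] at hq
    simp at hq
  have htw := twistControl_of_charControl p S hj h
  obtain ⟨L, hL, hL1, hL2⟩ := polyControl (μ := μ) hτ (fun i : S => p i) (p j)
    (hnat _ (hp.ne_zero j) (hp0 j)) (fun i => hdeg i i.2) (fun i => hnat _ (by
      rw [sub_ne_zero]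
      intro hij
      exact hj (hp.injective hij ▸ i.2)) (by simp [hp0])) (c ^ 2) (by positivity)
  have key : ∀ t : ℕ × ℤ × ℝ, ∃ b : ℕ, 0 < b ∧ (t ∈ L → ∀ (m : (ℤ → ℂ) →ₗ[ℂ] ℂ) (f₀ : X → ℂ)
      (f : ι → X → ℂ) (θ : ι → ℝ) (D : X → ℂ), IsMean m → B1 f₀ → (∀ i, B1 (f i)) → B1 D →
      IsDual τ μ m S (fun i n => (p i).eval n) (fun n => (p j).eval n) D →
      (∀ φ, B1 φ → ∫ x, φ x * D x ∂μ = m (fun n =>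
        (∏ i ∈ (insert j S)ᶜ, ee (θ i * ((p i).eval n : ℤ))) *
        ∫ x, f₀ x * (∏ i ∈ S, f i (τ ((p i).eval n) x)) * φ (τ ((p j).eval n) x) ∂μ)) →
      Theta τ μ (t.1 + 1) t.2.1 t.2.2 D →
      (∀ i ∉ insert j S, ∃ z : ℤ, (b : ℝ) * θ i = z) ∧
      ∃ θ' χ, IsEig τ μ θ' χ ∧ (∃ z : ℤ, (b : ℝ) * θ' = z) ∧ ∫ x, f₀ x * χ x ∂μ ≠ 0) := by
    intro t
    by_cases ht : t ∈ L
    swap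
    · exact ⟨1, one_pos, fun h => absurd h ht⟩
    obtain ⟨hB, hδ⟩ := hL1 t ht
    obtain ⟨δ', hδ', hlow⟩ := theta_one_of_theta hτ he S _ _ htw t.1 hB hδ
    have hBpos : (0 : ℝ) < |(t.2.1 : ℝ)| := abs_pos.2 (by exact_mod_cast hB)
    obtain ⟨b, hb, hb'⟩ := h (Real.sqrt (δ' / 2 / (8 * |t.2.1|)))
      (Real.sqrt_pos.2 (by push_cast; positivity))
    refine ⟨b, hb, fun _ m f₀ f θ D hm hf₀ hf hD hdual hφ hΘ => ?_⟩
    obtain ⟨α, χ, hχ, hχD⟩ := exists_isEig_of_theta_one hτ he hB hδ' hD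
      (hlow m D hm hD hdual hΘ)
    obtain ⟨h1, θ', χ', hχ', hθ', hne⟩ := hb' m (fun x => f₀ x * χ x) f (Function.update θ j α) hm
      (hf₀.mul hχ.b1) hf (by
        refine hχD.trans (le_of_eq ?_)
        have e1 : ∫ x, D x * χ x ∂μ = ∫ x, χ x * D x ∂μ := by simp only [mul_comm]
        rw [e1, hφ χ hχ.b1]
        congr 2; funext n
        have e2 : (Sᶜ : Finset ι) = insert j (insert j S)ᶜ := by
          rw [compl_insert, insert_erase (by simpa using hj)]
        have e3 : ∀ i ∈ (insert j S)ᶜ, ee (Function.update θ j α i * ((p i).eval n : ℤ)) =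
            ee (θ i * ((p i).eval n : ℤ)) := fun i hi => by
          rw [Function.update_of_ne]
          rintro rfl
          simp at hi
        rw [e2, prod_insert (by simp), Function.update_self, prod_congr rfl e3]
        simp only [← integral_const_mul]
        congr 1; funext x
        rw [hχ.apply hτ, mul_comm α]
        ring)
    refine ⟨fun i hi => ?_, α + θ', fun x => χ x * χ' x, hχ.mul hχ', ?_, ?_⟩
    · have h2 := h1 i fun h3 => hi (mem_insert_of_mem h3)
      rwa [Function.update_of_ne] at h2
      rintro rfl
      simp at hi
    · obtain ⟨z, hz⟩ := h1 j hj
      obtain ⟨z', hz'⟩ := hθ'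
      rw [Function.update_self] at hz
      exact ⟨z + z', by push_cast; rw [mul_add, hz, hz']⟩
    · simpa only [mul_assoc] using hne
  choose b hb hkey using key
  refine ⟨∏ t ∈ hL.toFinset, b t, prod_pos fun t _ => hb t,
    fun m f₀ f θ hm hf₀ hf hcm => ?_⟩
  set w : ℤ → ℂ := fun n => ∏ i ∈ (insert j S)ᶜ, ee (θ i * ((p i).eval n : ℤ)) with hw
  have hw1 : ∀ n, ‖w n‖ = 1 := fun n => by
    rw [hw, norm_prod]; exact prod_eq_one fun i _ => norm_ee _
  obtain ⟨D, hD, hdual, hφ⟩ := exists_dual hm hτ S (fun i n => (p i).eval n)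
    (fun n => (p j).eval n) hw1 hf₀ hf
  have h1 : c ≤ ‖∫ x, f j x * D x ∂μ‖ := by
    rw [hφ _ (hf j)]
    refine hcm.trans (le_of_eq ?_)
    congr 2; funext n; congr 2; funext x
    rw [prod_insert hj]; ring
  have h2 : c ^ 2 ≤ ‖∫ x, (starRingEnd ℂ) (D x) * D x ∂μ‖ := by
    have e1 : ∫ x, (starRingEnd ℂ) (D x) * D x ∂μ = ((∫ x, ‖D x‖ ^ 2 ∂μ : ℝ) : ℂ) := by
      rw [← integral_complex_ofReal]
      congr 1; funext x
      rw [mul_comm, Complex.mul_conj, Complex.normSq_eq_norm_sq]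
    rw [e1, Complex.norm_real, Real.norm_of_nonneg (integral_nonneg fun _ => by positivity)]
    calc c ^ 2 ≤ ‖∫ x, f j x * D x ∂μ‖ ^ 2 := by gcongr
      _ ≤ ∫ x, ‖f j x * D x‖ ^ 2 ∂μ :=
        norm_integral_sq_le ((hf j).mul hD).meas ((hf j).mul hD).norm_le
      _ ≤ _ := by
        refine integral_mono ?_ ?_ fun x => ?_
        · refine Integrable.of_bound (((hf j).mul hD).meas.norm.pow_const 2).aestronglyMeasurable 1
            (Eventually.of_forall fun x => ?_)
          rw [Real.norm_of_nonneg (by positivity)]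
          exact pow_le_one₀ (norm_nonneg _) (((hf j).mul hD).norm_le x)
        · refine Integrable.of_bound (hD.meas.norm.pow_const 2).aestronglyMeasurable 1
            (Eventually.of_forall fun x => ?_)
          rw [Real.norm_of_nonneg (by positivity)]
          exact pow_le_one₀ (norm_nonneg _) (hD.norm_le x)
        · beta_reduce
          rw [norm_mul]
          gcongr
          exact mul_le_of_le_one_left (norm_nonneg _) ((hf j).norm_le x)
  rw [hφ _ hD.conj] at h2
  obtain ⟨t, ht, hΘ⟩ := hL2 m w f₀ (fun i => f i) (fun x => (starRingEnd ℂ) (D x)) hm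
    (fun n => (hw1 n).le) hf₀ (fun i => hf i) hD.conj (h2.trans (le_of_eq (by
      congr 2; funext n; congr 2; funext x
      rw [← prod_coe_sort S])))
  obtain ⟨h3, θ', χ, hχ, hθ', hne⟩ := hkey t ht m f₀ f θ D hm hf₀ hf hD hdual hφ (theta_conj.1 hΘ)
  obtain ⟨u, hu⟩ := dvd_prod_of_mem b (hL.mem_toFinset.2 ht)
  have hmul : ∀ α : ℝ, (∃ z : ℤ, (b t : ℝ) * α = z) →
      ∃ z : ℤ, ((∏ t ∈ hL.toFinset, b t : ℕ) : ℝ) * α = z := by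
    rintro α ⟨z, hz⟩
    refine ⟨u * z, ?_⟩
    rw [hu]; push_cast; rw [← hz]; ring
  exact ⟨fun i hi => hmul _ (h3 i hi), θ', χ, hχ, hmul _ hθ', hne⟩

theorem charControl [IsProbabilityMeasure μ] (hτ : IsAction τ μ) (he : Ergodic (τ 1) μ)
    (p : ι → ℤ[X]) (hp : LinearIndependent ℤ p) (hp0 : ∀ i, (p i).eval 0 = 0) (S : Finset ι) :
    CharControl τ μ p S := by
  induction S using Finset.induction_on_max_value (fun i => (p i).natDegree) with
  | empty => exact charControl_empty p hp hp0
  | insert a s ha hs ih => exact charControl_insert hτ he p hp hp0 s ha hs ih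

end

open Polynomial

/-! ### The lower bound for ergodic actions -/

section

variable {ι : Type} [Fintype ι] [DecidableEq ι]

omit [DecidableEq ι] in
lemma linearIndependent_comp {p : ι → ℤ[X]} (hp : LinearIndependent ℤ p) {R : ℤ} (hR : R ≠ 0) :
    LinearIndependent ℤ (fun i => (p i).comp (C R * X)) := by
  rw [Fintype.linearIndependent_iff] at hp ⊢
  intro g hg
  refine hp g ?_
  have h : (∑ i, g i • p i).comp (C R * X) = 0 := by
    rw [← hg, Polynomial.sum_comp]
    refine sum_congr rfl fun i _ => ?_
    rw [Polynomial.smul_comp]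
  rcases comp_eq_zero_iff.1 h with h | ⟨-, h⟩
  · exact h
  · have := congrArg (fun q : ℤ[X] => q.coeff 1) h
    simp at this
    exact absurd this hR

/-- The family obtained from `p` after translating by `-p i`. -/
noncomputable def pivot (p : ι → ℤ[X]) (i : ι) : ι → ℤ[X] :=
    fun l => if l = i then -p i else p l - p i

lemma linearIndependent_pivot {p : ι → ℤ[X]} (hp : LinearIndependent ℤ p) (i : ι) :
    LinearIndependent ℤ (pivot p i) := by
  rw [Fintype.linearIndependent_iff] at hp ⊢
  intro g hg
  have key : ∑ l, (if l = i then -∑ j, g j else g l) • p l = 0 := by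
    rw [← hg, ← Finset.add_sum_erase _ _ (mem_univ i),
      ← Finset.add_sum_erase univ (fun l => g l • pivot p i l) (mem_univ i)]
    have h1 : ∑ l ∈ univ.erase i, (if l = i then -∑ j, g j else g l) • p l =
        ∑ l ∈ univ.erase i, g l • p l :=
      sum_congr rfl fun l hl => by rw [if_neg (ne_of_mem_erase hl)]
    have h2 : ∑ l ∈ univ.erase i, g l • pivot p i l =
        ∑ l ∈ univ.erase i, g l • p l - (∑ l ∈ univ.erase i, g l) • p i := by
      rw [sum_smul, ← sum_sub_distrib]
      exact sum_congr rfl fun l hl => by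
        rw [pivot, if_neg (ne_of_mem_erase hl), smul_sub]
    rw [h1, h2, pivot, if_pos rfl, if_pos rfl, ← Finset.add_sum_erase univ g (mem_univ i)]
    module
  have h := hp _ key
  have hne : ∀ l, l ≠ i → g l = 0 := fun l hl => by simpa [hl] using h l
  intro l
  by_cases hl : l = i
  · have := h i
    rw [if_pos rfl, neg_eq_zero, ← Finset.add_sum_erase univ g (mem_univ i),
      sum_eq_zero fun l hl => hne l (ne_of_mem_erase hl), add_zero] at this
    rw [hl, this]
  · exact hne l hl

omit [Fintype ι] in
lemma pivot_eval_zero {p : ι → ℤ[X]} (hp0 : ∀ i, (p i).eval 0 = 0) (i l : ι) :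
    (pivot p i l).eval 0 = 0 := by
  rw [pivot]; split_ifs <;> simp [hp0]

lemma prod_update_apply {X : Type*} (v : ι → X → ℂ) (i : ι) (φ : X → ℂ) (y : ι → X) :
    ∏ l, (Function.update v i φ) l (y l) = φ (y i) * ∏ l ∈ univ.erase i, v l (y l) := by
  rw [← mul_prod_erase univ _ (mem_univ i), Function.update_self]
  congr 1
  exact prod_congr rfl fun l hl => by rw [Function.update_of_ne (ne_of_mem_erase hl)]

end

section

variable {X : Type*} [MeasurableSpace X] {μ : Measure X} {τ : ℤ → X → X}

lemma IsAction.invariant_zmul (hτ : IsAction τ μ) {E : Type*} {g : X → E} {b : ℤ}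
    (hg : ∀ x, g (τ b x) = g x) (z : ℤ) (x : X) : g (τ (z * b) x) = g x := by
  induction z using Int.induction_on with
  | zero => simp [hτ.zero]
  | succ n ih => rw [add_mul, one_mul, add_comm, hτ.add, hg, ih]
  | pred n ih =>
    rw [← hg, ← hτ.add, ← ih]
    congr 2; ring

/-- Projection to the functions invariant under `τ b`. -/
lemma exists_invProj [IsProbabilityMeasure μ] (b : ℤ) {f : X → ℝ}
    (hf : Measurable f) (h0 : ∀ x, 0 ≤ f x) (h1 : ∀ x, f x ≤ 1) :
    ∃ g : X → ℝ, Measurable g ∧ (∀ x, 0 ≤ g x) ∧ (∀ x, g x ≤ 1) ∧ (∀ x, g (τ b x) = g x) ∧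
      ∀ h : X → ℝ, Measurable h → (∃ C, ∀ x, |h x| ≤ C) → (∀ x, h (τ b x) = h x) →
        ∫ x, f x * h x ∂μ = ∫ x, g x * h x ∂μ := by
  have hle : MeasurableSpace.invariants (τ b) ≤ ‹MeasurableSpace X› :=
      MeasurableSpace.invariants_le _
  set g0 : X → ℝ := μ[f|MeasurableSpace.invariants (τ b)] with hg0
  have hsm : StronglyMeasurable[MeasurableSpace.invariants (τ b)] g0 := stronglyMeasurable_condExp
  have hfi : Integrable f μ := Integrable.of_bound hf.aestronglyMeasurable 1
    (Eventually.of_forall fun x => by rw [Real.norm_of_nonneg (h0 x)]; exact h1 x)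
  have hinv : ∀ x, g0 (τ b x) = g0 x := fun x =>
    congrFun (MeasurableSpace.comp_eq_of_measurable_invariants hsm.measurable) x
  have hmeas : Measurable g0 := (hsm.mono hle).measurable
  have hge : ∀ᵐ x ∂μ, 0 ≤ g0 x := condExp_nonneg (Eventually.of_forall h0)
  have hg1 : ∀ᵐ x ∂μ, g0 x ≤ 1 := by
    have := condExp_mono (m := MeasurableSpace.invariants (τ b)) hfi (integrable_const (1 : ℝ)) (Eventually.of_forall h1)
    filter_upwards [this] with x hx
    rwa [condExp_const hle] at hx
  refine ⟨fun x => max 0 (min (g0 x) 1), measurable_const.max (hmeas.min measurable_const),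
    fun x => le_max_left _ _, fun x => max_le zero_le_one (min_le_right _ _),
    fun x => by simp only [hinv], fun h hh ⟨C, hC⟩ hhi => ?_⟩
  have hhm : Measurable[MeasurableSpace.invariants (τ b)] h :=
    MeasurableSpace.measurable_invariants_dom.2 ⟨hh, fun s _ => by
      ext x; simp [hhi]⟩
  have hfh : Integrable (f * h) μ := hfi.mul_bdd hh.aestronglyMeasurable (c := C)
    (Eventually.of_forall hC)
  calc ∫ x, f x * h x ∂μ = ∫ x, (μ[f * h|MeasurableSpace.invariants (τ b)]) x ∂μ :=
      (integral_condExp hle).symm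
    _ = ∫ x, g0 x * h x ∂μ := integral_congr_ae
      (condExp_mul_of_stronglyMeasurable_right hhm.stronglyMeasurable hfh hfi)
    _ = _ := by
      refine integral_congr_ae ?_
      filter_upwards [hge, hg1] with x hx hx'
      rw [min_eq_left hx', max_eq_right hx]

end

section

variable {ι : Type} [Fintype ι] [DecidableEq ι]
  {X : Type*} [MeasurableSpace X] {μ : Measure X} {τ : ℤ → X → X}

/-- The multilinear correlation sequence along the polynomials `P`. -/
noncomputable def corr (μ : Measure X) (τ : ℤ → X → X) (P : ι → ℤ[X]) (u : X → ℂ)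
    (v : ι → X → ℂ) (n : ℤ) : ℂ := ∫ x, u x * ∏ i, v i (τ ((P i).eval n) x) ∂μ

omit [DecidableEq ι] in
lemma norm_corr_le [IsProbabilityMeasure μ] (hτ : IsAction τ μ) (P : ι → ℤ[X]) {u : X → ℂ}
    {v : ι → X → ℂ} (hu : B1 u) (hv : ∀ i, B1 (v i)) (n : ℤ) : ‖corr μ τ P u v n‖ ≤ 1 :=
  (hu.mul (B1.prod _ fun i _ => (hv i).comp (hτ.meas _))).norm_integral_le

lemma corr_update (hτ : IsAction τ μ) (P : ι → ℤ[X]) (i : ι) (u φ : X → ℂ) (v : ι → X → ℂ)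
    (n : ℤ) : corr μ τ P u (Function.update v i φ) n =
      corr μ τ (pivot P i) φ (Function.update v i u) n := by
  unfold corr
  rw [← hτ.integral_comp (-(P i).eval n)]
  refine integral_congr_ae (Eventually.of_forall fun x => ?_)
  simp only [prod_update_apply]
  rw [← hτ.add, add_neg_cancel, hτ.zero, pivot, if_pos rfl, eval_neg]
  rw [mul_left_comm]
  congr 2
  refine prod_congr rfl fun l hl => ?_
  rw [pivot, if_neg (ne_of_mem_erase hl), eval_sub, ← hτ.add, sub_eq_add_neg]

/-- Functions orthogonal to rational eigenfunctions of bounded height do not contribute to the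
averages. -/
lemma exists_height [IsProbabilityMeasure μ] (hτ : IsAction τ μ) (he : Ergodic (τ 1) μ)
    {P : ι → ℤ[X]} (hP : LinearIndependent ℤ P) (hP0 : ∀ i, (P i).eval 0 = 0) {c : ℝ}
    (hc : 0 < c) : ∃ b : ℕ, 0 < b ∧ ∀ φ u v m, B1 φ → B1 u → (∀ i, B1 (v i)) → IsMean m →
      (∀ θ χ, IsEig τ μ θ χ → (∃ z : ℤ, (b : ℝ) * θ = z) → ∫ x, φ x * χ x ∂μ = 0) →
      ‖m (corr μ τ P φ v)‖ ≤ c ∧ ∀ i, ‖m (corr μ τ P u (Function.update v i φ))‖ ≤ c := by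
  obtain ⟨b, hb, hbc⟩ := charControl hτ he P hP hP0 univ c hc
  choose b' hb' hbc' using fun i => charControl hτ he (pivot P i) (linearIndependent_pivot hP i)
    (pivot_eval_zero hP0 i) univ c hc
  have hdvd : ∀ a d : ℕ, a ∣ d → ∀ θ : ℝ, (∃ z : ℤ, (a : ℝ) * θ = z) →
      ∃ z : ℤ, (d : ℝ) * θ = z := by
    rintro a _ ⟨e, rfl⟩ θ ⟨z, hz⟩
    refine ⟨e * z, ?_⟩
    push_cast; rw [← hz]; ring
  refine ⟨b * ∏ i, b' i, mul_pos hb (prod_pos fun i _ => hb' i),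
    fun φ u v m hφ hu hv hm horth => ⟨?_, fun i => ?_⟩⟩
  · by_contra! hlt
    obtain ⟨-, θ, χ, hχ, hθ, hne⟩ := hbc m φ v 0 hm hφ hv (by
      refine hlt.le.trans (le_of_eq ?_)
      simp only [compl_univ, prod_empty, one_mul]; rfl)
    exact hne (horth θ χ hχ (hdvd _ _ (dvd_mul_right _ _) θ hθ))
  · by_contra! hlt
    obtain ⟨-, θ, χ, hχ, hθ, hne⟩ := hbc' i m φ (Function.update v i u) 0 hm hφ (by
      intro l
      by_cases h : l = i
      · subst h; rwa [Function.update_self]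
      · rw [Function.update_of_ne h]; exact hv l) (by
      refine hlt.le.trans (le_of_eq ?_)
      rw [funext (corr_update hτ P i u φ v)]
      simp only [compl_univ, prod_empty, one_mul]; rfl)
    exact hne (horth θ χ hχ (hdvd _ _ ((dvd_prod_of_mem b' (mem_univ i)).mul_left _) θ hθ))

omit [DecidableEq ι] in
lemma corr_sub_left [IsProbabilityMeasure μ] (hτ : IsAction τ μ) (P : ι → ℤ[X]) {u u' : X → ℂ}
    {v : ι → X → ℂ} (hu : B1 u) (hu' : B1 u') (hv : ∀ i, B1 (v i)) :
    corr μ τ P u v - corr μ τ P u' v = corr μ τ P (fun x => u x - u' x) v := by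
  funext n
  have h := B1.prod univ fun i _ => (hv i).comp (hτ.meas ((P i).eval n))
  simp only [Pi.sub_apply, corr]
  rw [← integral_sub (hu.mul h).integrable (hu'.mul h).integrable]
  simp only [sub_mul]

lemma corr_sub_update [IsProbabilityMeasure μ] (hτ : IsAction τ μ) (P : ι → ℤ[X]) {u : X → ℂ}
    {v : ι → X → ℂ} (hu : B1 u) (hv : ∀ i, B1 (v i)) {i : ι} {φ φ' : X → ℂ} (hφ : B1 φ)
    (hφ' : B1 φ') :
    corr μ τ P u (Function.update v i φ) - corr μ τ P u (Function.update v i φ') =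
      corr μ τ P u (Function.update v i (fun x => φ x - φ' x)) := by
  have h : ∀ ψ : X → ℂ, B1 ψ → ∀ l, B1 (Function.update v i ψ l) := fun ψ hψ l => by
    by_cases hl : l = i
    · subst hl; rwa [Function.update_self]
    · rw [Function.update_of_ne hl]; exact hv l
  funext n
  simp only [Pi.sub_apply, corr]
  rw [← integral_sub
    (hu.mul (B1.prod univ fun l _ => (h φ hφ l).comp (hτ.meas ((P l).eval n)))).integrable
    (hu.mul (B1.prod univ fun l _ => (h φ' hφ' l).comp (hτ.meas ((P l).eval n)))).integrable]
  refine integral_congr_ae (Eventually.of_forall fun x => ?_)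
  simp only [prod_update_apply]
  ring

lemma norm_mean_corr_sub_le [IsProbabilityMeasure μ] (hτ : IsAction τ μ) (he : Ergodic (τ 1) μ)
    {P : ι → ℤ[X]} (hP : LinearIndependent ℤ P) (hP0 : ∀ i, (P i).eval 0 = 0) {c : ℝ}
    (hc : 0 < c) : ∃ b : ℕ, 0 < b ∧ ∀ f g m, B1 f → B1 g → B1 (fun x => f x - g x) → IsMean m →
      (∀ θ χ, IsEig τ μ θ χ → (∃ z : ℤ, (b : ℝ) * θ = z) → ∫ x, (f x - g x) * χ x ∂μ = 0) →
      ‖m (corr μ τ P f fun _ => f) - m (corr μ τ P g fun _ => g)‖ ≤ (Fintype.card ι + 1) * c := by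
  obtain ⟨b, hb, key⟩ := exists_height hτ he hP hP0 hc
  refine ⟨b, hb, fun f g m hf hg hfg hm horth => ?_⟩
  have hw : ∀ T : Finset ι, ∀ i, B1 (if i ∈ T then g else f) := fun T i => by
    split_ifs <;> assumption
  have hstep : ∀ T : Finset ι, ‖m (corr μ τ P f fun _ => f) -
      m (corr μ τ P f fun i => if i ∈ T then g else f)‖ ≤ T.card * c := by
    intro T
    induction T using Finset.induction_on with
    | empty => simp
    | insert i T hi ih =>
      rw [card_insert_of_notMem hi]
      have h1 : (fun l => if l ∈ T then g else f) =
          Function.update (fun l => if l ∈ T then g else f) i f := by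
        funext l
        by_cases hl : l = i
        · subst hl; simp [hi]
        · rw [Function.update_of_ne hl]
      have h2 : (fun l => if l ∈ insert i T then g else f) =
          Function.update (fun l => if l ∈ T then g else f) i g := by
        funext l
        by_cases hl : l = i
        · subst hl; simp
        · rw [Function.update_of_ne hl]; simp [hl]
      have h3 := (key _ f (fun l => if l ∈ T then g else f) m hfg hf (hw T) hm horth).2 i
      rw [← corr_sub_update hτ P hf (hw T) hf hg, ← h1, ← h2, map_sub] at h3
      calc _ ≤ _ := norm_sub_le_norm_sub_add_norm_sub _
              (m (corr μ τ P f fun l => if l ∈ T then g else f)) _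
        _ ≤ T.card * c + c := add_le_add ih h3
        _ = _ := by push_cast; ring
  have h4 := hstep univ
  simp only [mem_univ, if_true] at h4
  have h5 := (key _ f (fun _ => g) m hfg hf (fun _ => hg) hm horth).1
  rw [← corr_sub_left hτ P hf hg (fun _ => hg), map_sub] at h5
  calc _ ≤ _ := norm_sub_le_norm_sub_add_norm_sub _ (m (corr μ τ P f fun _ => g)) _
    _ ≤ (univ : Finset ι).card * c + c := add_le_add h4 h5
    _ = _ := by rw [card_univ]; ring

end

lemma abs_prod_sub_prod_le {ι : Type*} (s : Finset ι) {a b : ι → ℝ} (ha0 : ∀ i, 0 ≤ a i)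
    (ha1 : ∀ i, a i ≤ 1) (hb0 : ∀ i, 0 ≤ b i) (hb1 : ∀ i, b i ≤ 1) :
    |∏ i ∈ s, a i - ∏ i ∈ s, b i| ≤ ∑ i ∈ s, |a i - b i| := by
  classical
  induction s using Finset.induction_on with
  | empty => simp
  | insert i s hi ih =>
    rw [prod_insert hi, prod_insert hi, sum_insert hi]
    have e : a i * ∏ i ∈ s, a i - b i * ∏ i ∈ s, b i =
        (a i - b i) * ∏ i ∈ s, a i + b i * (∏ i ∈ s, a i - ∏ i ∈ s, b i) := by ring
    rw [e]
    refine (abs_add_le _ _).trans (add_le_add ?_ (le_trans ?_ ih))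
    · rw [abs_mul, abs_of_nonneg (prod_nonneg fun i _ => ha0 i)]
      exact mul_le_of_le_one_right (abs_nonneg _) (prod_le_one (fun i _ => ha0 i) fun i _ => ha1 i)
    · rw [abs_mul, abs_of_nonneg (hb0 i)]
      exact mul_le_of_le_one_left (abs_nonneg _) (hb1 i)

section

variable {X : Type*} [MeasurableSpace X] {μ : Measure X}

lemma integrable_of_abs_le [IsFiniteMeasure μ] {f : X → ℝ} (hf : Measurable f) {C : ℝ}
    (hC : ∀ x, |f x| ≤ C) : Integrable f μ :=
  Integrable.of_bound hf.aestronglyMeasurable C (Eventually.of_forall hC)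

lemma integral_abs_le_sqrt [IsProbabilityMeasure μ] {f : X → ℝ} (hf : Measurable f) {C : ℝ}
    (hC : ∀ x, |f x| ≤ C) : ∫ x, |f x| ∂μ ≤ √(∫ x, f x ^ 2 ∂μ) := by
  refine Real.le_sqrt_of_sq_le ?_
  have h := norm_integral_sq_le (μ := μ) (f := fun x => ((|f x| : ℝ) : ℂ)) (C := C)
    (Complex.measurable_ofReal.comp hf.abs) (fun x => by simpa using hC x)
  rw [integral_complex_ofReal, Complex.norm_real,
    Real.norm_of_nonneg (integral_nonneg fun x => abs_nonneg _)] at h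
  simpa using h

lemma B1.ofReal {f : X → ℝ} (hf : Measurable f) (h : ∀ x, |f x| ≤ 1) :
    B1 (fun x => (f x : ℂ)) :=
  ⟨Complex.measurable_ofReal.comp hf, fun x => by simpa using h x⟩

lemma pow_integral_le [IsProbabilityMeasure μ] {f : X → ℝ} (hf : AEStronglyMeasurable f μ)
    (h0 : ∀ x, 0 ≤ f x) (h1 : ∀ x, f x ≤ 1) (n : ℕ) :
    (∫ x, f x ∂μ) ^ n ≤ ∫ x, f x ^ n ∂μ := by
  refine (convexOn_pow n).map_integral_le (continuous_pow n).continuousOn isClosed_Ici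
    (Eventually.of_forall h0) ?_ ?_
  · refine Integrable.of_bound hf 1 (Eventually.of_forall fun x => ?_)
    rw [Real.norm_of_nonneg (h0 x)]
    exact h1 x
  · refine Integrable.of_bound (hf.pow n) 1 (Eventually.of_forall fun x => ?_)
    simp only [Function.comp_apply]
    rw [Real.norm_of_nonneg (pow_nonneg (h0 x) n)]
    exact pow_le_one₀ (h0 x) (h1 x)

lemma integral_mul_eig_eq_zero [IsProbabilityMeasure μ] {τ : ℤ → X → X} {φ : X → ℝ}
    (hφ : Measurable φ) (hφ1 : ∀ x, |φ x| ≤ 1) {b : ℤ}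
    (h : ∀ h : X → ℝ, Measurable h → (∃ C, ∀ x, |h x| ≤ C) → (∀ x, h (τ b x) = h x) →
        ∫ x, φ x * h x ∂μ = 0) {χ : X → ℂ} (hχ : B1 χ) (hχi : ∀ x, χ (τ b x) = χ x) :
    ∫ x, (φ x : ℂ) * χ x ∂μ = 0 := by
  have hre : Measurable fun x => (χ x).re := Complex.measurable_re.comp hχ.meas
  have him : Measurable fun x => (χ x).im := Complex.measurable_im.comp hχ.meas
  have h1 := h _ hre ⟨1, fun x => (Complex.abs_re_le_norm _).trans (hχ.norm_le x)⟩
    (fun x => by rw [hχi])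
  have h2 := h _ him ⟨1, fun x => (Complex.abs_im_le_norm _).trans (hχ.norm_le x)⟩
    (fun x => by rw [hχi])
  have hintg : Integrable (fun x => (φ x : ℂ) * χ x) μ := ((B1.ofReal hφ hφ1).mul hχ).integrable
  have e1 := integral_re hintg
  have e2 := integral_im hintg
  apply Complex.ext
  · rw [Complex.zero_re, ← h1]
    simpa using e1.symm
  · rw [Complex.zero_im, ← h2]
    simpa using e2.symm

end

section

variable {ι : Type} [Fintype ι]
  {X : Type*} [MeasurableSpace X] {μ : Measure X} {τ : ℤ → X → X}

lemma corr_ofReal (P : ι → ℤ[X]) (f : X → ℝ) (n : ℤ) :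
    corr μ τ P (fun x => (f x : ℂ)) (fun _ x => (f x : ℂ)) n =
      ((∫ x, f x * ∏ i, f (τ ((P i).eval n) x) ∂μ : ℝ) : ℂ) := by
  rw [corr, ← integral_complex_ofReal]
  push_cast; rfl

lemma abs_integral_prod_sub_le [IsProbabilityMeasure μ] (hτ : IsAction τ μ) {f g : X → ℝ}
    (hf : Measurable f) (hg : Measurable g) (hf0 : ∀ x, 0 ≤ f x) (hf1 : ∀ x, f x ≤ 1)
    (hg0 : ∀ x, 0 ≤ g x) (hg1 : ∀ x, g x ≤ 1) (P : ι → ℤ) :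
    |(∫ x, f x * ∏ i, f (τ (P i) x) ∂μ) - ∫ x, g x * ∏ i, g (τ (P i) x) ∂μ| ≤
      (Fintype.card ι + 1) * ∫ x, |f x - g x| ∂μ := by
  have hbd : ∀ {f : X → ℝ}, Measurable f → (∀ x, 0 ≤ f x) → (∀ x, f x ≤ 1) →
      Integrable (fun x => f x * ∏ i, f (τ (P i) x)) μ := fun {f} hf h0 h1 => by
    refine integrable_of_abs_le (C := 1) (hf.mul (Finset.measurable_prod _ fun i _ =>
      hf.comp (hτ.meas _))) fun x => ?_
    rw [abs_of_nonneg (mul_nonneg (h0 x) (prod_nonneg fun i _ => h0 _))]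
    exact mul_le_one₀ (h1 x) (prod_nonneg fun i _ => h0 _)
      (prod_le_one (fun i _ => h0 _) fun i _ => h1 _)
  have hd : Integrable (fun x => |f x - g x|) μ :=
    integrable_of_abs_le (C := 1) (hf.sub hg).abs fun x => by
      rw [abs_abs, abs_le]; constructor <;> linarith [hf0 x, hf1 x, hg0 x, hg1 x]
  have hdi : ∀ i, Integrable (fun x => |f (τ (P i) x) - g (τ (P i) x)|) μ := fun i =>
    (hτ.mp (P i)).integrable_comp_of_integrable hd
  rw [← integral_sub (hbd hf hf0 hf1) (hbd hg hg0 hg1)]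
  calc _ ≤ ∫ x, |f x * ∏ i, f (τ (P i) x) - g x * ∏ i, g (τ (P i) x)| ∂μ :=
        abs_integral_le_integral_abs
    _ ≤ ∫ x, (|f x - g x| + ∑ i, |f (τ (P i) x) - g (τ (P i) x)|) ∂μ := by
        refine integral_mono ((hbd hf hf0 hf1).sub (hbd hg hg0 hg1)).abs
          (hd.add (integrable_finsetSum _ fun i _ => hdi i)) fun x => ?_
        have := abs_prod_sub_prod_le (univ : Finset (Option ι))
          (a := fun i => i.elim (f x) fun i => f (τ (P i) x))
          (b := fun i => i.elim (g x) fun i => g (τ (P i) x))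
          (by rintro (_ | i); exacts [hf0 _, hf0 _]) (by rintro (_ | i); exacts [hf1 _, hf1 _])
          (by rintro (_ | i); exacts [hg0 _, hg0 _]) (by rintro (_ | i); exacts [hg1 _, hg1 _])
        simpa only [Fintype.prod_option, Fintype.sum_option, Option.elim] using this
    _ = _ := by
        rw [integral_add hd (integrable_finsetSum _ fun i _ => hdi i),
          integral_finsetSum _ fun i _ => hdi i,
          sum_congr rfl fun i _ => hτ.integral_comp (P i) fun x => |f x - g x|]
        rw [sum_const, card_univ, nsmul_eq_mul]; ring

theorem ergodic_lower_bound [IsProbabilityMeasure μ] (hτ : IsAction τ μ) (he : Ergodic (τ 1) μ)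
    {p : ι → ℤ[X]} (hp : LinearIndependent ℤ p) (hp0 : ∀ i, (p i).eval 0 = 0) {f : X → ℝ}
    (hf : Measurable f) (h0 : ∀ x, 0 ≤ f x) (h1 : ∀ x, f x ≤ 1) {η : ℝ} (hη : 0 < η) :
    ∃ B : ℕ, 0 < B ∧ ∀ R : ℕ, 0 < R → B ∣ R → ∀ m, IsMean m →
      (∫ x, f x ∂μ) ^ (Fintype.card ι + 1) - η ≤
        (m fun n => ((∫ x, f x * ∏ i, f (τ ((p i).eval (R * n)) x) ∂μ : ℝ) : ℂ)).re := by
  classical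
  choose G hGm hG0 hG1 hGinv hGproj using fun b : ℕ =>
    exists_invProj (μ := μ) (τ := τ) (b : ℤ) hf h0 h1
  have hGabs : ∀ b x, |G b x| ≤ 1 := fun b x => by rw [abs_of_nonneg (hG0 b x)]; exact hG1 b x
  set K : ℝ := Fintype.card ι + 1 with hK
  have hKpos : 0 < K := by positivity
  set c := η / (2 * K) with hc
  have hcpos : 0 < c := by positivity
  obtain ⟨B, hB, hBmax⟩ : ∃ B : ℕ, 0 < B ∧ ∀ b : ℕ, 0 < b →
      ∫ x, G b x ^ 2 ∂μ ≤ ∫ x, G B x ^ 2 ∂μ + c ^ 2 := by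
    set s : Set ℝ := (fun b : ℕ => ∫ x, G b x ^ 2 ∂μ) '' {b | 0 < b} with hs
    have hbdd : BddAbove s := by
      refine ⟨1, ?_⟩
      rintro _ ⟨b, -, rfl⟩
      have := norm_integral_le_of_norm_le_const (μ := μ) (f := fun x => G b x ^ 2) (C := 1)
        (Eventually.of_forall fun x => by
          rw [Real.norm_eq_abs, abs_pow]; exact pow_le_one₀ (abs_nonneg _) (hGabs b x))
      simp only [probReal_univ, mul_one] at this
      exact (le_abs_self _).trans this
    obtain ⟨_, ⟨B, hB, rfl⟩, hlt⟩ := exists_lt_of_lt_csSup (s := s) ⟨_, 1, Nat.one_pos, rfl⟩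
      (sub_lt_self (sSup s) (by positivity : 0 < c ^ 2))
    refine ⟨B, hB, fun b hb => ?_⟩
    have := le_csSup hbdd ⟨b, hb, rfl⟩
    beta_reduce at this hlt
    linarith
  refine ⟨B, hB, fun R hR hBR m hm => ?_⟩
  have hRz : (R : ℤ) ≠ 0 := by exact_mod_cast hR.ne'
  obtain ⟨b₀, hb₀, hcmp⟩ := norm_mean_corr_sub_le hτ he (linearIndependent_comp hp hRz)
    (fun i => by simp [hp0]) hcpos
  set P : ι → ℤ[X] := fun i => (p i).comp (C (R : ℤ) * Polynomial.X) with hP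
  have hPe : ∀ i n, (P i).eval n = (p i).eval (R * n) := fun i n => by simp [hP]
  set b := b₀ * B with hb
  have hsub : ∀ x, |f x - G b x| ≤ 1 := fun x => by
    rw [abs_le]; constructor <;> linarith [h0 x, h1 x, hG0 b x, hG1 b x]
  have habs : ∀ x, |f x| ≤ 1 := fun x => by rw [abs_of_nonneg (h0 x)]; exact h1 x
  have hcast : (fun x => (f x : ℂ) - (G b x : ℂ)) = fun x => ((f x - G b x : ℝ) : ℂ) := by
    funext x; push_cast; rfl
  have h2 := hcmp (fun x => (f x : ℂ)) (fun x => (G b x : ℂ)) m (B1.ofReal hf habs)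
    (B1.ofReal (hGm b) (hGabs b)) (by rw [hcast]; exact B1.ofReal (hf.sub (hGm b)) hsub) hm
    (by
      rintro θ χ hχ ⟨z, hz⟩
      have := integral_mul_eig_eq_zero (τ := τ) (hf.sub (hGm b)) hsub (b := (b : ℤ)) (by
        rintro h hh ⟨C, hC⟩ hhi
        simp only [Pi.sub_apply, sub_mul]
        have hi : ∀ {f : X → ℝ}, Measurable f → (∀ x, |f x| ≤ 1) →
            Integrable (fun x => f x * h x) μ := fun hf h1 =>
          (integrable_of_abs_le hh hC).bdd_mul hf.aestronglyMeasurable (c := 1)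
            (Eventually.of_forall h1)
        rw [integral_sub (hi hf habs) (hi (hGm b) (hGabs b)), hGproj b h hh ⟨C, hC⟩ hhi,
          sub_self]) hχ.b1 (by
        intro x
        rw [hχ.apply hτ]
        rw [(ee_eq_one_iff _).2 ⟨B * z, by rw [hb]; push_cast; rw [← hz]; ring⟩, one_mul])
      simpa using this)
  have hGB : ∀ x, G B (τ b x) = G B x := fun x => by
    have := hτ.invariant_zmul (hGinv B) b₀ x
    rw [hb]; push_cast; exact this
  have h3 : ∫ x, |G b x - G B x| ∂μ ≤ c := by
    have e1 := hGproj b (G B) (hGm B) ⟨1, hGabs B⟩ hGB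
    have e2 := hGproj B (G B) (hGm B) ⟨1, hGabs B⟩ (hGinv B)
    have hi : ∀ b b', Integrable (fun x => G b x * G b' x) μ := fun b b' =>
      integrable_of_abs_le ((hGm b).mul (hGm b')) (C := 1) fun x => by
        rw [abs_mul]; exact mul_le_one₀ (hGabs b x) (abs_nonneg _) (hGabs b' x)
    have e3 : ∫ x, (G b x - G B x) ^ 2 ∂μ ≤ c ^ 2 := by
      have e4 : ∫ x, (G b x - G B x) ^ 2 ∂μ = ∫ x, (G b x * G b x - G b x * G B x -
          G b x * G B x + G B x * G B x) ∂μ := by congr 1; funext x; ring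
      have e5 : ∫ x, (G b x * G b x - G b x * G B x - G b x * G B x + G B x * G B x) ∂μ =
          ∫ x, G b x * G b x ∂μ - ∫ x, G b x * G B x ∂μ - ∫ x, G b x * G B x ∂μ +
            ∫ x, G B x * G B x ∂μ := by
        have i1 : Integrable (fun x => G b x * G b x - G b x * G B x) μ := (hi b b).sub (hi b B)
        have i2 : Integrable (fun x => G b x * G b x - G b x * G B x - G b x * G B x) μ :=
          i1.sub (hi b B)
        rw [integral_add i2 (hi B B), integral_sub i1 (hi b B), integral_sub (hi b b) (hi b B)]
      rw [e4, e5, ← e1, e2]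
      have := hBmax b (Nat.mul_pos hb₀ hB)
      simp only [pow_two (G _ _)] at this
      linarith
    calc _ ≤ √(∫ x, (G b x - G B x) ^ 2 ∂μ) :=
          integral_abs_le_sqrt ((hGm b).sub (hGm B)) (C := 1) fun x => by
            rw [abs_le]; constructor <;> linarith [hG0 B x, hG1 B x, hG0 b x, hG1 b x]
      _ ≤ √(c ^ 2) := Real.sqrt_le_sqrt e3
      _ = c := Real.sqrt_sq hcpos.le
  have h4 : ∀ n : ℤ, (∫ x, f x ∂μ) ^ (Fintype.card ι + 1) - K * c ≤
      ∫ x, G b x * ∏ i, G b (τ ((P i).eval n) x) ∂μ := fun n => by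
    have e1 := abs_integral_prod_sub_le hτ (hGm b) (hGm B) (hG0 b) (hG1 b) (hG0 B) (hG1 B)
      (fun i => (P i).eval n)
    have e2 : ∀ x, G B x * ∏ i, G B (τ ((P i).eval n) x) = G B x ^ (Fintype.card ι + 1) :=
      fun x => by
        rw [pow_succ', ← card_univ, ← prod_const]
        congr 1
        refine prod_congr rfl fun i _ => ?_
        have hd : (B : ℤ) ∣ (P i).eval n := by
          rw [hPe]
          refine ((Int.natCast_dvd_natCast.2 hBR).mul_right n).trans ?_
          have := Polynomial.sub_dvd_eval_sub ((R : ℤ) * n) 0 (p i)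
          rwa [hp0, sub_zero, sub_zero] at this
        obtain ⟨z, hz⟩ := hd
        rw [hz, mul_comm, hτ.invariant_zmul (hGinv B)]
    simp only [e2] at e1
    have e3 := pow_integral_le (μ := μ) (hGm B).aestronglyMeasurable (hG0 B) (hG1 B) (Fintype.card ι + 1)
    have e4 : ∫ x, G B x ∂μ = ∫ x, f x ∂μ := by
      simpa using (hGproj B (fun _ => 1) measurable_const ⟨1, by simp⟩ (by simp)).symm
    rw [e4] at e3
    have e5 := mul_le_mul_of_nonneg_left h3 hKpos.le
    rw [abs_le] at e1
    linarith [e1.1]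
  have h5 : (∫ x, f x ∂μ) ^ (Fintype.card ι + 1) - K * c ≤
      (m (corr μ τ P (fun x => (G b x : ℂ)) fun _ x => (G b x : ℂ))).re := by
    have := hm.re_mono (F := fun _ => (((∫ x, f x ∂μ) ^ (Fintype.card ι + 1) - K * c : ℝ) : ℂ))
      (C := |(∫ x, f x ∂μ) ^ (Fintype.card ι + 1) - K * c|)
      (fun n => by rw [Complex.norm_real, Real.norm_eq_abs])
      (norm_corr_le hτ P (B1.ofReal (hGm b) (hGabs b)) fun _ => B1.ofReal (hGm b) (hGabs b))
      (fun n => by rw [corr_ofReal, Complex.ofReal_re, Complex.ofReal_re]; exact h4 n)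
    rwa [hm.const, Complex.ofReal_re] at this
  have h6 : corr μ τ P (fun x => (f x : ℂ)) (fun _ x => (f x : ℂ)) =
      fun n => ((∫ x, f x * ∏ i, f (τ ((p i).eval (R * n)) x) ∂μ : ℝ) : ℂ) := by
    funext n
    rw [corr_ofReal]; simp only [hPe]
  rw [h6] at h2
  have h7 := (Complex.abs_re_le_norm _).trans h2
  rw [Complex.sub_re, abs_le] at h7
  have h8 : K * c = η / 2 := by rw [hc]; field_simp
  rw [← hK] at h7
  linarith [h7.1]

end

open scoped Topology

/-! ### Ergodic decomposition -/

section

variable {X : Type*} [MeasurableSpace X] {μ : Measure X}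

/-- Birkhoff averages of the indicator of a set. -/
noncomputable def birkInd (T : X → X) (s : Set X) (N : ℕ) (x : X) : ℝ :=
  (N : ℝ)⁻¹ * ∑ n ∈ range N, s.indicator 1 (T^[n] x)

omit [MeasurableSpace X] in
lemma birkInd_nonneg (T : X → X) (s : Set X) (N : ℕ) (x : X) : 0 ≤ birkInd T s N x :=
  mul_nonneg (by positivity)
    (sum_nonneg fun n _ => Set.indicator_nonneg (fun _ _ => zero_le_one) _)

omit [MeasurableSpace X] in
lemma birkInd_le_one (T : X → X) (s : Set X) (N : ℕ) (x : X) : birkInd T s N x ≤ 1 := by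
  have h : ∑ n ∈ range N, s.indicator (1 : X → ℝ) (T^[n] x) ≤ N := by
    calc _ ≤ ∑ n ∈ range N, (1 : ℝ) :=
          sum_le_sum fun n _ => Set.indicator_le_self' (fun _ _ => zero_le_one) _
      _ = N := by simp
  rcases N.eq_zero_or_pos with rfl | hN
  · simp [birkInd]
  · rw [birkInd, inv_mul_le_iff₀ (by positivity), mul_one]; exact h

lemma measurable_birkInd {T : X → X} (hT : Measurable T) {s : Set X} (hs : MeasurableSet s)
    (N : ℕ) : Measurable (birkInd T s N) :=
  measurable_const.mul (Finset.measurable_sum _ fun n _ =>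
    (measurable_one.indicator hs).comp (hT.iterate n))

omit [MeasurableSpace X] in
lemma tendsto_birkInd_comp_iff (T : X → X) (s : Set X) {ns : ℕ → ℕ} (hns : StrictMono ns)
    (x : X) (l : ℝ) : Tendsto (fun i => birkInd T s (ns i) (T x)) atTop (𝓝 l) ↔
      Tendsto (fun i => birkInd T s (ns i) x) atTop (𝓝 l) := by
  have hz : Tendsto (fun i => birkInd T s (ns i) (T x) - birkInd T s (ns i) x) atTop (𝓝 0) := by
    have h1 : Tendsto (fun i => ((ns i : ℕ) : ℝ)⁻¹) atTop (𝓝 0) :=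
      tendsto_inv_atTop_zero.comp (tendsto_natCast_atTop_atTop.comp hns.tendsto_atTop)
    refine squeeze_zero_norm (fun i => ?_) h1
    have e : birkInd T s (ns i) (T x) - birkInd T s (ns i) x =
        ((ns i : ℕ) : ℝ)⁻¹ * (s.indicator 1 (T^[ns i] x) - s.indicator 1 x) := by
      rw [birkInd, birkInd, ← mul_sub]
      congr 1
      have := sum_range_succ' (fun n => s.indicator (1 : X → ℝ) (T^[n] x)) (ns i)
      rw [sum_range_succ] at this
      simp only [Function.iterate_succ_apply, Function.iterate_zero, id] at this
      linarith
    rw [e, norm_mul, norm_inv, Real.norm_natCast]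
    refine mul_le_of_le_one_right (by positivity) ?_
    rw [Real.norm_eq_abs, abs_le]
    have h0 : ∀ y, 0 ≤ s.indicator (1 : X → ℝ) y :=
      fun y => Set.indicator_nonneg (fun _ _ => zero_le_one) _
    have h1 : ∀ y, s.indicator (1 : X → ℝ) y ≤ 1 :=
      fun y => Set.indicator_le_self' (fun _ _ => zero_le_one) _
    constructor <;> linarith [h0 (T^[ns i] x), h1 (T^[ns i] x), h0 x, h1 x]
  constructor <;> intro h
  · simpa using h.sub hz
  · simpa using h.add hz

/-- Along a subsequence, Birkhoff averages converge almost everywhere to an invariant function. -/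
lemma exists_tendsto_birkInd [IsProbabilityMeasure μ] {T : X → X} (hT : MeasurePreserving T μ μ)
    {s : Set X} (hs : MeasurableSet s) :
    ∃ g : X → ℝ, Measurable[MeasurableSpace.invariants T] g ∧ (∀ x, |g x| ≤ 1) ∧
      ∃ ns : ℕ → ℕ, StrictMono ns ∧
        ∀ᵐ x ∂μ, Tendsto (fun i => birkInd T s (ns i) x) atTop (𝓝 (g x)) := by
  have hL : MemLp (s.indicator (1 : X → ℝ)) 2 μ := (memLp_const (1 : ℝ)).indicator hs
  set Φ : Lp ℝ 2 μ := hL.toLp _ with hΦ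
  set U : Lp ℝ 2 μ →L[ℝ] Lp ℝ 2 μ :=
    (Lp.compMeasurePreservingₗᵢ ℝ T hT).toContinuousLinearMap with hU
  have hlim := ContinuousLinearMap.tendsto_birkhoffAverage_orthogonalProjection U
    (LinearIsometry.norm_toContinuousLinearMap_le _) Φ
  have hit : ∀ n, (⇑((U^[n]) Φ) : X → ℝ) =ᵐ[μ] fun x => s.indicator 1 (T^[n] x) := by
    intro n
    induction n with
    | zero => exact hL.coeFn_toLp
    | succ n ih =>
      rw [Function.iterate_succ_apply']
      refine (Lp.coeFn_compMeasurePreserving _ hT).trans ?_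
      exact hT.quasiMeasurePreserving.ae_eq_comp ih
  have hav : ∀ N, (⇑(birkhoffAverage ℝ U id N Φ) : X → ℝ) =ᵐ[μ] birkInd T s N := by
    intro N
    rw [birkhoffAverage, birkhoffSum]
    refine (Lp.coeFn_smul _ _).trans ?_
    have h2 : ∀ᵐ x ∂μ, ∀ n, ((U^[n]) Φ) x = s.indicator 1 (T^[n] x) := ae_all_iff.2 hit
    filter_upwards [Lp.coeFn_fun_finsetSum (range N) (fun n => id ((U^[n]) Φ)), h2] with x h1 h2
    rw [Pi.smul_apply, h1, birkInd, smul_eq_mul]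
    simp only [id, h2]
  obtain ⟨ns, hns, hae⟩ := (tendstoInMeasure_of_tendsto_Lp hlim).exists_seq_tendsto_ae
  set q : X → ℝ := fun x => limUnder atTop fun i => birkInd T s (ns i) x with hq
  have hqm : Measurable q := (StronglyMeasurable.limUnder fun i =>
    (measurable_birkInd hT.measurable hs (ns i)).stronglyMeasurable).measurable
  have hqi : ∀ x, q (T x) = q x := fun x => by
    rw [hq]
    simp only [limUnder, lim]
    congr 1; funext l
    exact propext (tendsto_birkInd_comp_iff T s hns x l)
  refine ⟨fun x => max 0 (min 1 (q x)), ?_, fun x => ?_, ns, hns, ?_⟩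
  · refine MeasurableSpace.measurable_invariants_dom.2
      ⟨measurable_const.max (measurable_const.min hqm), fun t _ => ?_⟩
    ext x; simp [hqi]
  · rw [abs_of_nonneg (le_max_left _ _)]; exact max_le zero_le_one (min_le_left _ _)
  · filter_upwards [hae, ae_all_iff.2 hav] with x hx hx'
    simp only [hx'] at hx
    have h1 : q x = _ := hx.limUnder_eq
    rw [← h1] at hx
    have h2 : Tendsto (fun i => max 0 (min 1 (birkInd T s (ns i) x))) atTop
        (𝓝 (max 0 (min 1 (q x)))) := tendsto_const_nhds.max (tendsto_const_nhds.min hx)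
    refine h2.congr fun i => ?_
    rw [min_eq_right (birkInd_le_one _ _ _ _), max_eq_right (birkInd_nonneg _ _ _ _)]

end

section

open ProbabilityTheory

variable {X : Type*} {m : MeasurableSpace X} [mX : MeasurableSpace X] [StandardBorelSpace X] {μ : Measure X}
  [IsProbabilityMeasure μ]

lemma ae_ae_condExpKernel (hm : m ≤ mX) {P : X → Prop}
    (h : ∀ᵐ x ∂μ, P x) : ∀ᵐ ω ∂μ, ∀ᵐ x ∂(condExpKernel μ m ω), P x := by
  refine ae_of_ae_trim hm (Measure.ae_ae_of_ae_comp ?_)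
  rwa [condExpKernel_comp_trim hm]

lemma ae_eq_apply_condExpKernel (hm : m ≤ mX) {g : X → ℝ}
    (hg : Measurable[m] g) (hg1 : ∀ x, |g x| ≤ 1) :
    ∀ᵐ ω ∂μ, ∀ᵐ x ∂(condExpKernel μ m ω), g x = g ω := by
  have hgm : Measurable[mX] g := hg.mono hm le_rfl
  have hi : ∀ {ν : @Measure X mX} [IsProbabilityMeasure ν], Integrable[mX] g ν := fun {ν} _ =>
    integrable_of_abs_le hgm hg1
  have hi2 : ∀ {ν : @Measure X mX} [IsProbabilityMeasure ν],
      Integrable[mX] (fun x => g x ^ 2) ν := fun {ν} _ =>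
    integrable_of_abs_le (hgm.pow_const 2) (C := 1) fun x => by
      rw [abs_pow]; exact pow_le_one₀ (abs_nonneg _) (hg1 x)
  have h1 := condExp_ae_eq_integral_condExpKernel hm (hi (ν := μ))
  have h2 := condExp_ae_eq_integral_condExpKernel hm (hi2 (ν := μ))
  rw [condExp_of_stronglyMeasurable hm hg.stronglyMeasurable hi] at h1
  rw [condExp_of_stronglyMeasurable hm (hg.pow_const 2).stronglyMeasurable hi2] at h2
  filter_upwards [h1, h2] with ω h1 h2
  have h3 : ∫ x, (g x - g ω) ^ 2 ∂(condExpKernel μ m ω) = 0 := by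
    have e : ∀ x, (g x - g ω) ^ 2 = g x ^ 2 - (2 * g ω) * g x + g ω ^ 2 := fun x => by ring
    simp only [e]
    have i1 : Integrable (fun x => g x ^ 2 - (2 * g ω) * g x) (condExpKernel μ m ω) :=
      hi2.sub (hi.const_mul _)
    rw [integral_add i1 (integrable_const _), integral_sub hi2 (hi.const_mul _),
      integral_const_mul, ← h1, ← h2]
    simp; ring
  have i2 : Integrable (fun x => (g x - g ω) ^ 2) (condExpKernel μ m ω) :=
    integrable_of_abs_le ((hgm.sub_const _).pow_const 2) (C := 2 ^ 2) fun x => by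
      rw [abs_pow]
      refine pow_le_pow_left₀ (abs_nonneg _) ?_ 2
      have := hg1 x; have := hg1 ω
      rw [abs_le] at *; constructor <;> linarith
  rw [integral_eq_zero_iff_of_nonneg (fun x => sq_nonneg _) i2] at h3
  filter_upwards [h3] with x hx
  have : g x - g ω = 0 := by simpa using hx
  linarith

end

open ProbabilityTheory

section

variable {X : Type*} [mX : MeasurableSpace X] {ν : Measure X} [IsProbabilityMeasure ν]

lemma setIntegral_birkInd {T : X → X} (hT : MeasurePreserving T ν ν) {s A : Set X}
    (hs : MeasurableSet s) (hA : MeasurableSet A) (hAi : T ⁻¹' A = A) {N : ℕ} (hN : 0 < N) :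
    ∫ x in A, birkInd T s N x ∂ν = ν.real (A ∩ s) := by
  have h1 : ∀ n, ∫ x in A, s.indicator (1 : X → ℝ) (T^[n] x) ∂ν = ν.real (A ∩ s) := fun n => by
    have hAn : T^[n] ⁻¹' A = A := by
      induction n with
      | zero => rfl
      | succ n ih => rw [Function.iterate_succ, Set.preimage_comp, ih, hAi]
    have e : (fun x => s.indicator (1 : X → ℝ) (T^[n] x)) = (T^[n] ⁻¹' s).indicator 1 := by
      funext x; rfl
    have hm := (hT.iterate n).measurable hs
    rw [e, integral_indicator_one hm, measureReal_restrict_apply hm, Set.inter_comm]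
    nth_rewrite 1 [← hAn]
    rw [← Set.preimage_inter, measureReal_def,
      (hT.iterate n).measure_preimage (hA.inter hs).nullMeasurableSet, ← measureReal_def]
  have hi : ∀ n, Integrable (fun x => s.indicator (1 : X → ℝ) (T^[n] x)) (ν.restrict A) :=
    fun n => integrable_of_abs_le ((measurable_one.indicator hs).comp
      (hT.measurable.iterate n)) (C := 1) fun x => by
        by_cases h : T^[n] x ∈ s <;> simp [h]
  simp only [birkInd]
  rw [integral_const_mul, integral_finsetSum _ fun n _ => hi n, sum_congr rfl fun n _ => h1 n,
    sum_const, card_range, nsmul_eq_mul, inv_mul_cancel_left₀ (by positivity)]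

lemma measureReal_inter_of_tendsto {T : X → X} (hT : MeasurePreserving T ν ν) {s A : Set X}
    (hs : MeasurableSet s) (hA : MeasurableSet A) (hAi : T ⁻¹' A = A) {c : ℝ} {ns : ℕ → ℕ}
    (hns : StrictMono ns)
    (h : ∀ᵐ x ∂ν, Tendsto (fun i => birkInd T s (ns i) x) atTop (𝓝 c)) :
    ν.real (A ∩ s) = ν.real A * c := by
  have h1 : Tendsto (fun i => ∫ x in A, birkInd T s (ns i) x ∂ν) atTop (𝓝 (∫ _ in A, c ∂ν)) := by
    refine tendsto_integral_of_dominated_convergence (fun _ => 1)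
      (fun i => (measurable_birkInd hT.measurable hs _).aestronglyMeasurable)
      (integrable_const _) (fun i => Eventually.of_forall fun x => ?_) (ae_restrict_of_ae h)
    rw [Real.norm_of_nonneg (birkInd_nonneg _ _ _ _)]
    exact birkInd_le_one _ _ _ _
  rw [setIntegral_const, smul_eq_mul] at h1
  refine tendsto_nhds_unique (tendsto_const_nhds.congr' ?_) h1
  filter_upwards [eventually_ge_atTop 1] with i hi
  exact (setIntegral_birkInd hT hs hA hAi (hi.trans (hns.id_le i))).symm

lemma ergodic_of_tendsto_const {T : X → X} (hT : MeasurePreserving T ν ν) {𝒞 : Set (Set X)}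
    (hgen : mX = MeasurableSpace.generateFrom 𝒞) (hpi : IsPiSystem 𝒞)
    (h : ∀ s ∈ 𝒞, ∃ c : ℝ, ∃ ns : ℕ → ℕ, StrictMono ns ∧
      ∀ᵐ x ∂ν, Tendsto (fun i => birkInd T s (ns i) x) atTop (𝓝 c)) : Ergodic T ν := by
  refine ⟨hT, ⟨fun A hA hAi => ?_⟩⟩
  have hms : ∀ s ∈ 𝒞, MeasurableSet s := fun s hs => by
    rw [hgen]; exact MeasurableSpace.measurableSet_generateFrom hs
  have key : ∀ s ∈ 𝒞, ν (A ∩ s) = ν A * ν s := fun s hs => by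
    obtain ⟨c, ns, hns, hc⟩ := h s hs
    have h1 := measureReal_inter_of_tendsto hT (hms s hs) hA hAi hns hc
    have h2 := measureReal_inter_of_tendsto hT (hms s hs) MeasurableSet.univ rfl hns hc
    rw [Set.univ_inter, probReal_univ, one_mul] at h2
    rw [← h2, measureReal_def, measureReal_def, measureReal_def, ← ENNReal.toReal_mul] at h1
    exact (ENNReal.toReal_eq_toReal_iff' (measure_ne_top _ _)
      (ENNReal.mul_ne_top (measure_ne_top _ _) (measure_ne_top _ _))).1 h1
  have heq : ν.restrict A = ν A • ν := by
    refine ext_of_generate_finite 𝒞 hgen hpi (fun s hs => ?_) (by simp)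
    rw [Measure.restrict_apply (hms s hs), Set.inter_comm, key s hs]; rfl
  have h2 : ν A = ν A * ν A := by
    have := congrArg (fun ρ : Measure X => ρ A) heq
    simpa [Measure.restrict_apply hA] using this
  rw [eventuallyConst_set]
  rcases eq_or_ne (ν A) 0 with h0 | h0
  · right; exact measure_eq_zero_iff_ae_notMem.1 h0
  · left
    have : ν A = 1 := by
      have h3 := (ENNReal.mul_right_inj h0 (measure_ne_top ν A) (b := 1) (c := ν A)).1
        (by rw [mul_one]; exact h2)
      exact h3.symm
    exact (mem_ae_iff_prob_eq_one hA).2 this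

end

/-- Ergodic decomposition of a measure preserving action of `ℤ`. -/
theorem exists_ergodic_decomposition {X : Type*} [mX : MeasurableSpace X] [StandardBorelSpace X]
    {μ : Measure X} [IsProbabilityMeasure μ] {τ : ℤ → X → X} (hτ : IsAction τ μ) :
    ∃ ν : X → Measure X, (∀ ω, IsProbabilityMeasure (ν ω)) ∧
      (∀ᵐ ω ∂μ, IsAction τ (ν ω) ∧ Ergodic (τ 1) (ν ω)) ∧
      ∀ f : X → ℝ, Measurable f → (∀ x, |f x| ≤ 1) →
        Integrable (fun ω => ∫ x, f x ∂(ν ω)) μ ∧ ∫ ω, ∫ x, f x ∂(ν ω) ∂μ = ∫ x, f x ∂μ := by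
  have hm : MeasurableSpace.invariants (τ 1) ≤ mX := MeasurableSpace.invariants_le _
  set κ := fun ω => condExpKernel μ (MeasurableSpace.invariants (τ 1)) ω with hκ
  set 𝒞 : Set (Set X) := generateSetAlgebra (MeasurableSpace.countableGeneratingSet X) with h𝒞
  have hcount : 𝒞.Countable :=
    countable_generateSetAlgebra MeasurableSpace.countable_countableGeneratingSet
  have hgen : mX = MeasurableSpace.generateFrom 𝒞 := by
    rw [h𝒞, generateFrom_generateSetAlgebra_eq, MeasurableSpace.generateFrom_countableGeneratingSet]
  have hpi : IsPiSystem 𝒞 := fun s hs t ht _ =>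
    isSetAlgebra_generateSetAlgebra.inter_mem hs ht
  have hms : ∀ s ∈ 𝒞, MeasurableSet s := fun s hs => by
    rw [hgen]; exact MeasurableSpace.measurableSet_generateFrom hs
  have hinv : ∀ n : ℤ, ∀ s ∈ 𝒞, ∀ᵐ ω ∂μ, κ ω (τ n ⁻¹' s) = κ ω s := by
    intro n s hs
    have hs' := hτ.meas n (hms s hs)
    have hi : ∀ {t : Set X}, MeasurableSet t → Integrable (t.indicator fun _ => (1 : ℝ)) μ :=
      fun ht => (integrable_const 1).indicator ht
    have h1 : μ[s.indicator (fun _ => (1 : ℝ))|MeasurableSpace.invariants (τ 1)] =ᵐ[μ]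
        μ[(τ n ⁻¹' s).indicator (fun _ => (1 : ℝ))|MeasurableSpace.invariants (τ 1)] := by
      refine ae_eq_condExp_of_forall_setIntegral_eq hm (hi hs')
        (fun A _ _ => integrable_condExp.integrableOn) (fun A hA _ => ?_)
        stronglyMeasurable_condExp.aestronglyMeasurable
      rw [setIntegral_condExp hm (hi (hms s hs)) hA]
      have hAm := hm A hA
      have hAn : τ n ⁻¹' A = A := by
        ext x
        have h2 := hτ.invariant_zmul (g := fun x => x ∈ A) (b := 1) (fun x => by
          have := congrArg (fun t : Set X => x ∈ t) hA.2
          exact this) n x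
        rw [mul_one] at h2
        exact h2.to_iff
      have e : ∀ t : Set X, (t.indicator fun _ => (1 : ℝ)) = t.indicator 1 := fun _ => rfl
      rw [e, e, integral_indicator_one (hms s hs), integral_indicator_one hs',
        measureReal_restrict_apply (hms s hs), measureReal_restrict_apply hs']
      nth_rewrite 2 [← hAn]
      rw [← Set.preimage_inter, measureReal_def, measureReal_def,
        (hτ.mp n).measure_preimage ((hms s hs).inter hAm).nullMeasurableSet]
    filter_upwards [condExpKernel_ae_eq_condExp hm (μ := μ) (hms s hs),
      condExpKernel_ae_eq_condExp hm (μ := μ) hs', h1] with ω e1 e2 e3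
    rw [e3, ← e2] at e1
    exact ((measureReal_eq_measureReal_iff).1 e1).symm
  have hconv : ∀ s ∈ 𝒞, ∀ᵐ ω ∂μ, ∃ c : ℝ, ∃ ns : ℕ → ℕ, StrictMono ns ∧
      ∀ᵐ x ∂(κ ω), Tendsto (fun i => birkInd (τ 1) s (ns i) x) atTop (𝓝 c) := by
    intro s hs
    obtain ⟨g, hg, hg1, ns, hns, hae⟩ := exists_tendsto_birkInd (hτ.mp 1) (hms s hs)
    filter_upwards [ae_ae_condExpKernel hm hae, ae_eq_apply_condExpKernel hm hg hg1]
      with ω h1 h2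
    refine ⟨g ω, ns, hns, ?_⟩
    filter_upwards [h1, h2] with x h1 h2
    rwa [← h2]
  refine ⟨κ, fun ω => by rw [hκ]; infer_instance, ?_, fun f hf hf1 => ?_⟩
  · have h1 : ∀ᵐ ω ∂μ, ∀ s ∈ 𝒞, ∀ n : ℤ, κ ω (τ n ⁻¹' s) = κ ω s :=
      (ae_ball_iff hcount).2 fun s hs => ae_all_iff.2 fun n => hinv n s hs
    have h2 := (ae_ball_iff hcount).2 hconv
    filter_upwards [h1, h2] with ω h1 h2
    have : IsProbabilityMeasure (κ ω) := by rw [hκ]; infer_instance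
    have hmp : ∀ n, MeasurePreserving (τ n) (κ ω) (κ ω) := fun n => ⟨hτ.meas n, by
      have : IsProbabilityMeasure (Measure.map (τ n) (κ ω)) :=
        Measure.isProbabilityMeasure_map (hτ.meas n).aemeasurable
      refine ext_of_generate_finite 𝒞 hgen hpi (fun s hs => ?_) (by simp)
      rw [Measure.map_apply (hτ.meas n) (hms s hs), h1 s hs n]⟩
    exact ⟨⟨hτ.zero, hτ.add, hmp⟩, ergodic_of_tendsto_const (hmp 1) hgen hpi h2⟩
  · have hi : Integrable f μ := integrable_of_abs_le hf hf1
    refine ⟨hi.integral_condExpKernel, ?_⟩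
    rw [← integral_condExp hm (f := f)]
    exact integral_congr_ae (condExp_ae_eq_integral_condExpKernel hm hi).symm

section

variable {X : Type*} [TopologicalSpace X] [MeasurableSpace X] [BorelSpace X]

/-- The uniform probability measure on the orbit segment `τ 1 ω, …, τ (N + 1) ω`. -/
noncomputable def orbitMeasure (τ : ℤ → X → X) (ω : X) (N : ℕ) : Measure X :=
  (N + 1 : ENNReal)⁻¹ • ∑ x ∈ Icc 1 (N + 1), Measure.dirac (τ (x : ℕ) ω)

instance (τ : ℤ → X → X) (ω : X) (N : ℕ) : IsProbabilityMeasure (orbitMeasure τ ω N) := by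
  constructor
  simp only [orbitMeasure, Measure.smul_apply, Measure.coe_finsetSum, Finset.sum_apply,
    measure_univ, sum_const, Nat.card_Icc, smul_eq_mul, nsmul_eq_mul]
  rw [mul_one, Nat.add_sub_cancel]
  push_cast
  exact ENNReal.inv_mul_cancel (by simp) (by finiteness)

lemma integral_orbitMeasure (τ : ℤ → X → X) (ω : X) (N : ℕ) {f : X → ℝ} (hf : Continuous f) :
    ∫ x, f x ∂(orbitMeasure τ ω N) =
      (∑ x ∈ Icc 1 (N + 1), f (τ (x : ℕ) ω)) / ((N + 1 : ℕ) : ℝ) := by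
  have hm : StronglyMeasurable f := hf.measurable.stronglyMeasurable
  rw [orbitMeasure, integral_smul_measure,
    integral_finsetSum_measure fun i _ => integrable_dirac' hm (by simp)]
  simp_rw [integral_dirac' _ _ hm]
  rw [smul_eq_mul, ENNReal.toReal_inv, div_eq_inv_mul]
  congr 2
  exact_mod_cast ENNReal.toReal_natCast (N + 1)

/-- A shift changes an average over `[1, N + 1]` of a bounded function by `O(1 / N)`. -/
lemma abs_avg_shift_sub_le {g : ℕ → ℝ} {C : ℝ} (hg : ∀ n, |g n| ≤ C) (N : ℕ) :
    |(∑ x ∈ Icc 1 (N + 1), g (x + 1)) / ((N + 1 : ℕ) : ℝ) -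
      (∑ x ∈ Icc 1 (N + 1), g x) / ((N + 1 : ℕ) : ℝ)| ≤ 2 * C / ((N : ℝ) + 1) := by
  have h : ∑ x ∈ Icc 1 (N + 1), g (x + 1) - ∑ x ∈ Icc 1 (N + 1), g x = g (N + 2) - g 1 := by
    rw [← sum_sub_distrib]
    have := Finset.sum_Ico_sub g (show 1 ≤ N + 2 by omega)
    rw [← this]
    rfl
  rw [← sub_div, h, abs_div, Nat.abs_cast]
  push_cast
  gcongr
  calc |g (N + 2) - g 1| ≤ |g (N + 2)| + |g 1| := abs_sub _ _
    _ ≤ 2 * C := by linarith [hg (N + 2), hg 1]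

lemma isAction_of_measurePreserving_one {Y : Type*} [MeasurableSpace Y] {τ : ℤ → Y → Y}
    {μ : Measure Y} (hm : ∀ n, Measurable (τ n)) (hz : ∀ x, τ 0 x = x)
    (ha : ∀ a b x, τ (a + b) x = τ a (τ b x)) (h1 : MeasurePreserving (τ 1) μ μ) :
    IsAction τ μ := by
  refine ⟨hz, ha, fun n => ?_⟩
  have hneg : MeasurePreserving (τ (-1)) μ μ := by
    refine ⟨hm _, ?_⟩
    conv_lhs => rw [← h1.map_eq]
    rw [Measure.map_map (hm _) (hm _)]
    have : τ (-1) ∘ τ 1 = id := by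
      ext x
      simp [← ha, hz]
    rw [this, Measure.map_id]
  induction n using Int.induction_on with
  | zero =>
    have : τ 0 = id := funext hz
    rw [this]
    exact MeasurePreserving.id μ
  | succ i ih =>
    have : τ ((i : ℤ) + 1) = τ i ∘ τ 1 := funext fun x => ha _ _ x
    rw [this]
    exact ih.comp h1
  | pred i ih =>
    have : τ (-(i : ℤ) - 1) = τ (-(i : ℤ)) ∘ τ (-1) := funext fun x => by
      rw [Function.comp_apply, ← ha, sub_eq_add_neg]
    rw [this]
    exact ih.comp hneg

/-- Every orbit of a continuous `ℤ`-action on a compact metrizable space generates an invariant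
probability measure along an ultrafilter. -/
theorem exists_isAction_tendsto_avg [CompactSpace X] [T2Space X] [HasOuterApproxClosed X]
    {τ : ℤ → X → X}
    (hc : ∀ n, Continuous (τ n)) (hz : ∀ x, τ 0 x = x)
    (ha : ∀ a b x, τ (a + b) x = τ a (τ b x)) (ω : X) {N : ℕ → ℕ} (hN : Tendsto N atTop atTop)
    (U : Ultrafilter ℕ) (hU : (U : Filter ℕ) ≤ atTop) :
    ∃ μ : Measure X, IsProbabilityMeasure μ ∧ IsAction τ μ ∧ ∀ f : X → ℝ, Continuous f →
      Tendsto (fun j => (∑ x ∈ Icc 1 (N j + 1), f (τ (x : ℕ) ω)) / ((N j + 1 : ℕ) : ℝ)) U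
        (𝓝 (∫ x, f x ∂μ)) := by
  let P : ℕ → ProbabilityMeasure X := fun j => ⟨orbitMeasure τ ω (N j), inferInstance⟩
  obtain ⟨μ, -, hμ⟩ := isCompact_univ.ultrafilter_le_nhds (U.map P) (by simp)
  have hlim : ∀ f : X → ℝ, Continuous f →
      Tendsto (fun j => (∑ x ∈ Icc 1 (N j + 1), f (τ (x : ℕ) ω)) / ((N j + 1 : ℕ) : ℝ)) U
        (𝓝 (∫ x, f x ∂(μ : Measure X))) := by
    intro f hf
    have h := (ProbabilityMeasure.tendsto_iff_forall_integral_tendsto.1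
      (show Tendsto P U (𝓝 μ) from hμ)) (BoundedContinuousFunction.mkOfCompact ⟨f, hf⟩)
    refine h.congr fun j => ?_
    exact integral_orbitMeasure τ ω (N j) hf
  refine ⟨μ, inferInstance, ?_, hlim⟩
  refine isAction_of_measurePreserving_one (fun n => (hc n).measurable) hz ha
    ⟨(hc 1).measurable, ?_⟩
  have : IsProbabilityMeasure ((μ : Measure X).map (τ 1)) :=
    Measure.isProbabilityMeasure_map (hc 1).measurable.aemeasurable
  refine ext_of_forall_integral_eq_of_IsFiniteMeasure fun f => ?_
  rw [integral_map (hc 1).measurable.aemeasurable f.continuous.aestronglyMeasurable]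
  have h1 := hlim _ (f.continuous.comp (hc 1))
  have h2 := hlim _ f.continuous
  have hN' : Tendsto (fun j => 2 * ‖f‖ / ((N j : ℝ) + 1)) U (𝓝 0) :=
    ((tendsto_natCast_atTop_atTop.comp hN).atTop_add tendsto_const_nhds).const_div_atTop _
      |>.mono_left hU
  have h3 := squeeze_zero_norm (fun j => (Real.norm_eq_abs _).trans_le <| abs_avg_shift_sub_le
    (g := fun n => f (τ (n : ℕ) ω)) (fun n => f.norm_coe_le_norm _) (N j)) hN'
  have h4 := (h1.sub h2)
  refine sub_eq_zero.1 (tendsto_nhds_unique h4 (h3.congr fun j => ?_))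
  congr 2
  refine sum_congr rfl fun x _ => ?_
  rw [Function.comp_apply, ← ha]
  push_cast
  rw [add_comm]

end

/-- The proportion of `[1, N]` contained in a set of naturals. -/
noncomputable def density (Λ : Set ℕ) (N : ℕ) : ℝ :=
  open Classical in (((Icc 1 N).filter (fun m => m ∈ Λ)).card : ℝ) / N

lemma density_nonneg (Λ : Set ℕ) (N : ℕ) : 0 ≤ density Λ N := by
  unfold density
  positivity

lemma density_le_one (Λ : Set ℕ) (N : ℕ) : density Λ N ≤ 1 := by
  classical
  refine div_le_one_of_le₀ ?_ (Nat.cast_nonneg _)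
  exact_mod_cast (card_filter_le _ _).trans (by simp)

lemma isBoundedUnder_density (Λ : Set ℕ) : IsBoundedUnder (· ≤ ·) atTop (density Λ) :=
  isBoundedUnder_of ⟨1, density_le_one Λ⟩

lemma isCoboundedUnder_density (Λ : Set ℕ) : IsCoboundedUnder (· ≤ ·) atTop (density Λ) :=
  (isBoundedUnder_of ⟨0, density_nonneg Λ⟩ : IsBoundedUnder (· ≥ ·) atTop _).isCoboundedUnder_le

lemma upperDensity_nonneg (Λ : Set ℕ) : 0 ≤ upperDensity Λ :=
  le_limsup_of_frequently_le (Frequently.of_forall (density_nonneg Λ)) (isBoundedUnder_density Λ)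

lemma le_upperDensity_of_tendsto {Λ : Set ℕ} {N : ℕ → ℕ} (hN : Tendsto N atTop atTop)
    {l : Filter ℕ} [l.NeBot] (hl : l ≤ atTop) {a : ℝ}
    (h : Tendsto (fun j => density Λ (N j)) l (𝓝 a)) : a ≤ upperDensity Λ := by
  refine le_of_forall_lt fun b hb => ?_
  obtain ⟨c, hbc, hca⟩ := exists_between hb
  refine hbc.trans_le (le_limsup_of_frequently_le ?_ (isBoundedUnder_density Λ))
  have h1 : ∃ᶠ j in l, c ≤ density Λ (N j) :=
    ((h.eventually (lt_mem_nhds hca)).mono fun _ h => le_of_lt h).frequently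
  exact hN.frequently (Frequently.filter_mono h1 hl)

lemma exists_tendsto_upperDensity (Λ : Set ℕ) : ∃ N : ℕ → ℕ, Tendsto N atTop atTop ∧
    Tendsto (fun j => density Λ (N j + 1)) atTop (𝓝 (upperDensity Λ)) := by
  have h : ∀ n : ℕ, ∃ᶠ k in atTop, upperDensity Λ - 1 / ((n : ℝ) + 1) < density Λ (k + 1) := by
    intro n
    have h := frequently_lt_of_lt_limsup (isCoboundedUnder_density Λ)
      (show upperDensity Λ - 1 / ((n : ℝ) + 1) < limsup (density Λ) atTop from
        sub_lt_self _ (by positivity))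
    rw [frequently_atTop] at h ⊢
    intro a
    obtain ⟨b, hb, hb'⟩ := h (a + 1)
    refine ⟨b - 1, by omega, ?_⟩
    rwa [Nat.sub_add_cancel (by omega)]
  obtain ⟨N, hN, hN'⟩ := extraction_forall_of_frequently h
  refine ⟨N, hN.tendsto_atTop, ?_⟩
  rw [tendsto_order]
  constructor
  · intro a ha
    have : Tendsto (fun n : ℕ => upperDensity Λ - 1 / ((n : ℝ) + 1)) atTop
        (𝓝 (upperDensity Λ - 0)) :=
      tendsto_const_nhds.sub tendsto_one_div_add_atTop_nhds_zero_nat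
    rw [sub_zero] at this
    filter_upwards [this.eventually (lt_mem_nhds ha)] with j hj using lt_trans hj (hN' j)
  · intro a ha
    have h1 := eventually_lt_of_limsup_lt (show limsup (density Λ) atTop < a from ha)
      (isBoundedUnder_density Λ)
    exact ((tendsto_add_atTop_nat 1).comp hN.tendsto_atTop).eventually h1

/-- The shift action on two-sided binary sequences. -/
def boolShift (n : ℤ) (x : ℤ → Bool) : ℤ → Bool := fun k => x (k + n)

/-- The indicator function of the sequences with a one at the origin. -/
noncomputable def boolIndicator (x : ℤ → Bool) : ℝ := if x 0 then 1 else 0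

lemma continuous_boolShift (n : ℤ) : Continuous (boolShift n) :=
  continuous_pi fun k => continuous_apply (k + n)

lemma continuous_boolIndicator : Continuous boolIndicator :=
  (continuous_of_discreteTopology (f := fun b : Bool => if b then (1 : ℝ) else 0)).comp
    (continuous_apply 0)

lemma boolIndicator_nonneg (x : ℤ → Bool) : 0 ≤ boolIndicator x := by
  unfold boolIndicator; split_ifs <;> norm_num

lemma boolIndicator_le_one (x : ℤ → Bool) : boolIndicator x ≤ 1 := by
  unfold boolIndicator; split_ifs <;> norm_num

/-- The Furstenberg correspondence principle. -/
theorem exists_correspondence (Λ : Set ℕ) : ∃ μ : Measure (ℤ → Bool),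
    IsProbabilityMeasure μ ∧ IsAction boolShift μ ∧
    upperDensity Λ ≤ ∫ x, boolIndicator x ∂μ ∧ ∀ (k : ℕ) (s : Fin k → ℤ),
      ∫ x, boolIndicator x * ∏ i, boolIndicator (boolShift (-s i) x) ∂μ ≤
        upperDensity (Λ ∩ ⋂ i, shiftSet Λ (s i)) := by
  classical
  obtain ⟨N, hN, hd⟩ := exists_tendsto_upperDensity Λ
  let U : Ultrafilter ℕ := Ultrafilter.of atTop
  have hU : (U : Filter ℕ) ≤ atTop := Ultrafilter.of_le _
  let ω : ℤ → Bool := fun k => decide (∃ y ∈ Λ, (y : ℤ) = k)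
  have hω : ∀ (k : ℤ), boolIndicator (boolShift k ω) = if ∃ y ∈ Λ, (y : ℤ) = k then 1 else 0 := by
    intro k
    simp [boolIndicator, boolShift, ω]
  obtain ⟨μ, hμ, hact, hlim⟩ := exists_isAction_tendsto_avg continuous_boolShift
    (fun x => funext fun k => by simp [boolShift])
    (fun a b x => funext fun k => by simp [boolShift, add_assoc]) ω hN U hU
  refine ⟨μ, hμ, hact, ?_, fun k s => ?_⟩
  · refine le_of_eq (tendsto_nhds_unique (hd.mono_left hU)
      ((hlim _ continuous_boolIndicator).congr fun j => ?_))
    rw [density, card_filter]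
    push_cast
    congr 1
    refine sum_congr rfl fun x _ => ?_
    rw [hω]
    simp
  · have hcont : Continuous fun x : ℤ → Bool =>
        boolIndicator x * ∏ i, boolIndicator (boolShift (-s i) x) :=
      continuous_boolIndicator.mul (continuous_finsetProd _ fun i _ =>
        continuous_boolIndicator.comp (continuous_boolShift _))
    refine le_upperDensity_of_tendsto ((tendsto_add_atTop_nat 1).comp hN) hU
      ((hlim _ hcont).congr fun j => ?_)
    rw [density, card_filter, Function.comp_apply]
    push_cast
    congr 1
    refine sum_congr rfl fun x _ => ?_
    have h1 : ∀ i, boolIndicator (boolShift (-s i) (boolShift x ω)) =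
        if x ∈ shiftSet Λ (s i) then 1 else 0 := by
      intro i
      rw [← hact.add, hω]
      congr 1
      simp only [shiftSet, Set.mem_ofPred_eq, eq_iff_iff]
      refine exists_congr fun y => and_congr_right fun _ => ?_
      omega
    simp only [h1, hω, Set.mem_inter_iff, Set.mem_iInter]
    rw [Finset.prod_boole]
    by_cases hx : x ∈ Λ <;> simp [hx]

section

variable {X : Type*} [MeasurableSpace X] {μ : Measure X}

/-- An iterated Fatou lemma for doubly indexed families of bounded functions. -/
lemma exists_neg_le_integral_of_eventually [IsProbabilityMeasure μ] {G : ℕ → ℕ → X → ℝ} {C : ℝ}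
    (hG : ∀ q L, AEMeasurable (G q L) μ) (hC : ∀ q L ω, |G q L ω| ≤ C)
    (h : ∀ᵐ ω ∂μ, ∀ᶠ q in atTop, ∀ᶠ L in atTop, 0 ≤ G q L ω) {ε : ℝ} (hε : 0 < ε) :
    ∃ q L, -ε ≤ ∫ ω, G q L ω ∂μ := by
  by_contra! hlt
  let H : ℕ → ℕ → X → ENNReal := fun q L ω => ENNReal.ofReal (-(hG q L).mk _ ω)
  have hae : ∀ᵐ ω ∂μ, ∀ q L, G q L ω = (hG q L).mk _ ω :=
    ae_all_iff.2 fun q => ae_all_iff.2 fun L => (hG q L).ae_eq_mk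
  have hHm : ∀ q L, Measurable (H q L) := fun q L =>
    ENNReal.measurable_ofReal.comp (hG q L).measurable_mk.neg
  have hHC : ∀ᵐ ω ∂μ, ∀ q L, H q L ω ≤ ENNReal.ofReal C := by
    filter_upwards [hae] with ω hω q L
    refine ENNReal.ofReal_le_ofReal ?_
    rw [← hω q L]
    exact (neg_le_abs _).trans (hC q L ω)
  have hHint : ∀ q L, ENNReal.ofReal ε ≤ ∫⁻ ω, H q L ω ∂μ := by
    intro q L
    have e1 : ∫⁻ ω, H q L ω ∂μ = ∫⁻ ω, ENNReal.ofReal (-G q L ω) ∂μ :=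
      lintegral_congr_ae (by filter_upwards [hae] with ω hω; simp only [H, hω q L])
    have hi : Integrable (fun ω => -G q L ω) μ :=
      (Integrable.of_bound (hG q L).aestronglyMeasurable C (Eventually.of_forall (hC q L))).neg
    have e2 := integral_eq_lintegral_pos_part_sub_lintegral_neg_part hi
    rw [integral_neg] at e2
    rw [e1]
    refine ENNReal.ofReal_le_of_le_toReal ?_
    have := ENNReal.toReal_nonneg (a := ∫⁻ ω, ENNReal.ofReal (- -G q L ω) ∂μ)
    linarith [hlt q L]
  let K : ℕ → X → ENNReal := fun q ω => limsup (fun L => H q L ω) atTop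
  have hK : ∀ q, ENNReal.ofReal ε ≤ ∫⁻ ω, K q ω ∂μ := by
    intro q
    refine le_trans ?_ (limsup_lintegral_le (fun _ => ENNReal.ofReal C) (hHm q)
      (fun L => hHC.mono fun ω hω => hω q L) (by simp))
    exact le_limsup_of_frequently_le (Frequently.of_forall (hHint q))
  have hlim : Tendsto (fun q => ∫⁻ ω, K q ω ∂μ) atTop (𝓝 (∫⁻ _, 0 ∂μ)) := by
    refine tendsto_lintegral_of_dominated_convergence' (fun _ => ENNReal.ofReal C)
      (fun q => (Measurable.limsup (hHm q)).aemeasurable) (fun q => ?_) (by simp) ?_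
    · filter_upwards [hHC] with ω hω
      exact limsup_le_of_le (h := Eventually.of_forall (hω q))
    · filter_upwards [hae, h] with ω hω hω'
      refine tendsto_const_nhds.congr' ?_
      filter_upwards [hω'] with q hq
      have : (fun L => H q L ω) =ᶠ[atTop] fun _ => 0 := by
        filter_upwards [hq] with L hL
        simp only [H, ← hω q L, ENNReal.ofReal_eq_zero]
        linarith
      simp only [K]
      rw [limsup_congr this, limsup_const]
  rw [lintegral_zero] at hlim
  have := ge_of_tendsto' hlim hK
  simp only [nonpos_iff_eq_zero, ENNReal.ofReal_eq_zero] at this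
  linarith

/-- If every mean of a bounded sequence exceeds `c`, so do its averages over long intervals. -/
lemma eventually_le_intervalAvg {F : ℤ → ℂ} {C : ℝ} (hF : ∀ n, ‖F n‖ ≤ C) {c : ℝ}
    (h : ∀ m, IsMean m → c < (m F).re) :
    ∀ᶠ L in atTop, ∀ a, c < (intervalAvg a L F).re := by
  by_contra hcon
  rw [not_eventually] at hcon
  push Not at hcon
  have hex : ∀ L : ℕ, ∃ a : ℤ,
      (∃ b, (intervalAvg b L F).re ≤ c) → (intervalAvg a L F).re ≤ c := by
    intro L
    by_cases hL : ∃ b, (intervalAvg b L F).re ≤ c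
    · exact ⟨hL.choose, fun _ => hL.choose_spec⟩
    · exact ⟨0, fun h => absurd h hL⟩
  choose a ha using hex
  obtain ⟨m, hm, hm'⟩ := exists_isMean_le (a) id tendsto_id F C hF c
    (hcon.mono fun j hj => ha j hj)
  exact absurd (h m hm) (not_lt.2 hm')

lemma intervalAvg_ofReal_re (a : ℤ) (L : ℕ) (F : ℤ → ℝ) :
    (intervalAvg a L fun n => (F n : ℂ)).re = (∑ i ∈ range L, F (a + i)) / L := by
  rw [intervalAvg, ← Complex.ofReal_sum, ← Complex.ofReal_natCast, ← Complex.ofReal_div,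
    Complex.ofReal_re]

/-- Polynomial multiple recurrence with a lower bound, along a fixed arithmetic progression of
times and with uniformly bounded gaps. -/
theorem exists_gap_lower_bound [StandardBorelSpace X] [IsProbabilityMeasure μ] {τ : ℤ → X → X}
    (hτ : IsAction τ μ) {ι : Type} [Fintype ι] {p : ι → Polynomial ℤ}
    (hp : LinearIndependent ℤ p) (hp0 : ∀ i, (p i).eval 0 = 0) {f : X → ℝ} (hf : Measurable f)
    (h0 : ∀ x, 0 ≤ f x) (h1 : ∀ x, f x ≤ 1) {ε : ℝ} (hε : 0 < ε) :
    ∃ R L : ℕ, 0 < R ∧ ∀ a : ℤ, ∃ n, a ≤ n ∧ n < a + L ∧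
      (∫ x, f x ∂μ) ^ (Fintype.card ι + 1) - ε ≤
        ∫ x, f x * ∏ i, f (τ ((p i).eval (R * n)) x) ∂μ := by
  by_contra! hcon
  obtain ⟨ν, hν, hνae, hνint⟩ := exists_ergodic_decomposition hτ
  let g : ℤ → X → ℝ := fun n x => f x * ∏ i, f (τ ((p i).eval n) x)
  have hgm : ∀ n, Measurable (g n) := fun n =>
    hf.mul (Finset.measurable_fun_prod _ fun i _ => hf.comp (hτ.meas _))
  have hg0 : ∀ n x, 0 ≤ g n x := fun n x =>
    mul_nonneg (h0 x) (prod_nonneg fun i _ => h0 _)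
  have hg1 : ∀ n x, g n x ≤ 1 := fun n x =>
    mul_le_one₀ (h1 x) (prod_nonneg fun i _ => h0 _)
      (prod_le_one (fun i _ => h0 _) fun i _ => h1 _)
  have hgabs : ∀ n x, |g n x| ≤ 1 := fun n x => by
    rw [abs_of_nonneg (hg0 n x)]; exact hg1 n x
  have hfabs : ∀ x, |f x| ≤ 1 := fun x => by
    rw [abs_of_nonneg (h0 x)]; exact h1 x
  let δ : X → ℝ := fun ω => ∫ x, f x ∂(ν ω)
  let Φ : X → ℤ → ℝ := fun ω n => ∫ x, g n x ∂(ν ω)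
  have hδ0 : ∀ ω, 0 ≤ δ ω := fun ω => integral_nonneg h0
  have hδ1 : ∀ ω, δ ω ≤ 1 := fun ω => by
    refine (integral_mono (integrable_of_abs_le hf hfabs) (integrable_const 1) h1).trans ?_
    simp
  have hΦabs : ∀ ω n, |Φ ω n| ≤ 1 := fun ω n => by
    refine (norm_integral_le_of_norm_le_const (C := 1)
      (Eventually.of_forall fun x => (Real.norm_eq_abs _).trans_le (hgabs n x))).trans ?_
    simp
  set N := Fintype.card ι + 1
  have hδi : Integrable (fun ω => δ ω ^ N) μ := by
    refine Integrable.of_bound ((hνint f hf hfabs).1.aestronglyMeasurable.pow N) 1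
      (Eventually.of_forall fun ω => ?_)
    rw [Real.norm_of_nonneg (pow_nonneg (hδ0 ω) N)]
    exact pow_le_one₀ (hδ0 ω) (hδ1 ω)
  choose a ha using fun q L : ℕ => hcon q.factorial (L + 1) q.factorial_pos
  let A : ℕ → ℕ → X → ℝ := fun q L ω =>
    (∑ i ∈ range (L + 1), Φ ω (q.factorial * (a q L + i))) / ((L + 1 : ℕ) : ℝ)
  have hAi : ∀ q L, Integrable (A q L) μ := fun q L =>
    (integrable_finsetSum _ fun i _ => (hνint _ (hgm _) (hgabs _)).1).div_const _
  have hAint : ∀ q L, ∫ ω, A q L ω ∂μ ≤ (∫ x, f x ∂μ) ^ N - ε := by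
    intro q L
    simp only [A]
    rw [integral_div, integral_finsetSum _ fun i _ => (hνint _ (hgm _) (hgabs _)).1,
      div_le_iff₀ (by positivity)]
    refine (sum_le_card_nsmul _ _ ((∫ x, f x ∂μ) ^ N - ε) fun i hi => ?_).trans ?_
    · rw [(hνint _ (hgm _) (hgabs _)).2]
      have := mem_range.1 hi
      exact (ha q L (a q L + i) (by omega) (by push_cast; omega)).le
    · rw [card_range, nsmul_eq_mul, mul_comm]
  have hAabs : ∀ q L ω, |A q L ω| ≤ 1 := by
    intro q L ω
    rw [abs_div, Nat.abs_cast, div_le_one (by positivity)]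
    refine (abs_sum_le_sum_abs _ _).trans ((sum_le_card_nsmul _ _ 1 fun i _ => hΦabs _ _).trans ?_)
    rw [card_range, nsmul_eq_mul, mul_one]
  obtain ⟨q, L, hqL⟩ := exists_neg_le_integral_of_eventually (μ := μ) (C := 2 + ε / 2)
    (G := fun q L ω => A q L ω - δ ω ^ N + ε / 2)
    (fun q L => (((hAi q L).sub hδi).add (integrable_const (ε / 2))).aemeasurable)
    (fun q L ω => by
      have e1 := abs_le.1 (hAabs q L ω)
      have e2 := pow_le_one₀ (n := N) (hδ0 ω) (hδ1 ω)
      have e3 := pow_nonneg (hδ0 ω) N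
      exact abs_le.2 ⟨by linarith [e1.1], by linarith [e1.2]⟩)
    (by
      filter_upwards [hνae] with ω hω
      obtain ⟨B, hB, hB'⟩ := ergodic_lower_bound hω.1 hω.2 hp hp0 hf h0 h1
        (show 0 < ε / 4 by positivity)
      filter_upwards [eventually_ge_atTop B] with q hq
      have h2 := eventually_le_intervalAvg (F := fun n => (Φ ω (q.factorial * n) : ℂ)) (C := 1)
        (fun n => by rw [Complex.norm_real]; exact hΦabs ω _) (c := δ ω ^ N - ε / 2)
        (fun m hm => by
          have := hB' q.factorial q.factorial_pos (Nat.dvd_factorial hB hq) m hm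
          simp only [Φ, g, δ]
          linarith)
      filter_upwards [(tendsto_add_atTop_nat 1).eventually h2] with L hL
      have := hL (a q L)
      rw [intervalAvg_ofReal_re] at this
      simp only [A]
      linarith)
    (show 0 < ε / 4 by positivity)
  have hsub : Integrable (fun ω => A q L ω - δ ω ^ N) μ := (hAi q L).sub hδi
  rw [integral_add hsub (integrable_const _), integral_sub (hAi q L) hδi, integral_const] at hqL
  simp only [probReal_univ, one_smul] at hqL
  have hJ := pow_integral_le (hνint f hf hfabs).1.aestronglyMeasurable hδ0 hδ1 N
  rw [(hνint f hf hfabs).2] at hJ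
  linarith [hAint q L]

end

/-- An integer polynomial without constant term has integer coefficients after substituting a
suitable multiple of the variable. -/
lemma exists_eval_mul_eq {p : ℤ → ℤ} (hp : IsIntPoly p) (h0 : p 0 = 0) :
    ∃ D : ℕ, 0 < D ∧ ∀ e : ℕ, ∃ P : Polynomial ℤ, P.eval 0 = 0 ∧
      ∀ n : ℤ, P.eval n = p (D * e * n) := by
  obtain ⟨q, hq⟩ := hp
  obtain ⟨b, hb, hb'⟩ :=
    IsLocalization.integerNormalization_spec (nonZeroDivisors ℤ) q
  set r := IsLocalization.integerNormalization (nonZeroDivisors ℤ) q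
  have hb0 : b ≠ 0 := nonZeroDivisors.ne_zero hb
  have hr : ∀ n : ℤ, r.eval n = b * p n := by
    intro n
    have h := congrArg (Polynomial.eval (n : ℚ)) hb'
    rw [Polynomial.eval_smul, hq] at h
    have h2 : (r.map (algebraMap ℤ ℚ)).eval (n : ℚ) = ((r.eval n : ℤ) : ℚ) := by
      simp
    rw [h2, zsmul_eq_mul] at h
    exact_mod_cast h
  have hr0 : r.coeff 0 = 0 := by
    rw [Polynomial.coeff_zero_eq_eval_zero, hr, h0, mul_zero]
  have hrX : ∀ y : ℤ, r.eval y = y * r.divX.eval y := by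
    intro y
    conv_lhs => rw [← Polynomial.divX_mul_X_add r]
    rw [hr0]
    simp [mul_comm]
  refine ⟨b.natAbs, Int.natAbs_pos.2 hb0, fun e => ⟨Polynomial.C (b.sign * e) * Polynomial.X *
    r.divX.comp (Polynomial.C ((b.natAbs : ℤ) * e) * Polynomial.X), by simp, fun n => ?_⟩⟩
  refine mul_left_cancel₀ hb0 ?_
  rw [← hr, hrX]
  simp only [Polynomial.eval_mul, Polynomial.eval_C, Polynomial.eval_X, Polynomial.eval_comp]
  have : b * b.sign = b.natAbs := by rw [Int.natCast_natAbs, mul_comm, Int.sign_mul_self_eq_abs]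
  linear_combination (e * n * r.divX.eval ((b.natAbs : ℤ) * e * n)) * this

/-- Simultaneous version of `exists_eval_mul_eq` for a finite family. -/
lemma exists_forall_eval_mul_eq {ι : Type*} [Fintype ι] {p : ι → ℤ → ℤ}
    (hp : ∀ i, IsIntPoly (p i)) (h0 : ∀ i, p i 0 = 0) :
    ∃ D : ℕ, 0 < D ∧ ∃ P : ι → Polynomial ℤ, ∀ i, (P i).eval 0 = 0 ∧
      ∀ n : ℤ, (P i).eval n = p i (D * n) := by
  classical
  choose D hD hP using fun i => exists_eval_mul_eq (hp i) (h0 i)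
  choose P hP0 hP using fun i => hP i (∏ j ∈ univ.erase i, D j)
  refine ⟨∏ j, D j, prod_pos fun j _ => hD j, P, fun i => ⟨hP0 i, fun n => ?_⟩⟩
  rw [hP, ← Nat.cast_mul, mul_prod_erase univ D (mem_univ i)]

/-- Rational independence survives restriction to an arithmetic progression through `0`. -/
lemma linearIndependent_of_ratIndep {k : ℕ} {p : Fin k → ℤ → ℤ} (hp : ∀ i, IsIntPoly (p i))
    (hind : RatIndep p) {D : ℕ} (hD : 0 < D) {P : Fin k → Polynomial ℤ}
    (hP : ∀ i, ∀ n : ℤ, (P i).eval n = p i (D * n)) : LinearIndependent ℤ P := by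
  rw [Fintype.linearIndependent_iff]
  intro c hc
  by_contra! hne
  have hc0 : c ≠ 0 := fun h => hne.elim fun i hi => hi (congrFun h i)
  choose q hq using hp
  refine hind c hc0 ⟨0, fun n => ?_⟩
  have hQ : ∑ i, Polynomial.C (c i : ℚ) * q i = 0 := by
    refine Polynomial.eq_zero_of_infinite_isRoot _ (Set.infinite_of_injective_forall_mem
      (f := fun n : ℕ => (((D : ℤ) * n : ℤ) : ℚ)) (fun a b hab => ?_) fun n => ?_)
    · have : (D : ℤ) * a = D * b := Int.cast_injective (α := ℚ) hab
      exact_mod_cast mul_left_cancel₀ (by positivity) this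
    · have h := congrArg (Polynomial.eval (n : ℤ)) hc
      simp only [Polynomial.eval_finsetSum, Polynomial.eval_smul, hP, smul_eq_mul,
        Polynomial.eval_zero] at h
      simp only [Set.mem_ofPred_eq, Polynomial.IsRoot.def, Polynomial.eval_finsetSum,
        Polynomial.eval_mul, Polynomial.eval_C, hq]
      exact_mod_cast h
  have h := congrArg (Polynomial.eval (n : ℚ)) hQ
  simp only [Polynomial.eval_finsetSum, Polynomial.eval_mul, Polynomial.eval_C, hq,
    Polynomial.eval_zero] at h
  exact_mod_cast h

end PolyConfig

theorem syndetic_many_polynomial_configurations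
    (Λ : Set ℕ) (k : ℕ) (p : Fin k → ℤ → ℤ)
    (hpoly : ∀ i, IsIntPoly (p i)) (hind : RatIndep p) (hzero : ∀ i, p i 0 = 0) :
    ∀ ε > (0 : ℝ),
      Syndetic {n : ℕ |
        upperDensity Λ ^ (k + 1) - ε ≤ upperDensity (Λ ∩ ⋂ i, shiftSet Λ (p i n))} := by
  intro ε hε
  obtain ⟨μ, hμ, hact, hd, hcor⟩ := PolyConfig.exists_correspondence Λ
  obtain ⟨D, hD, P, hP⟩ := PolyConfig.exists_forall_eval_mul_eq hpoly hzero
  have hli : LinearIndependent ℤ (fun i => -P i) :=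
    (PolyConfig.linearIndependent_of_ratIndep hpoly hind hD fun i => (hP i).2).neg
  obtain ⟨R, L, hR, hL⟩ := PolyConfig.exists_gap_lower_bound hact hli
    (fun i => by rw [Polynomial.eval_neg, (hP i).1, neg_zero])
    PolyConfig.continuous_boolIndicator.measurable PolyConfig.boolIndicator_nonneg
    PolyConfig.boolIndicator_le_one hε
  refine ⟨D * R * (L + 1), fun a => ?_⟩
  obtain ⟨n, han, hnL, hn⟩ := hL ((a / (D * R) + 1 : ℕ) : ℤ)
  lift n to ℕ using (Int.natCast_nonneg _).trans han
  have hn1 : a / (D * R) + 1 ≤ n := by exact_mod_cast han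
  have hn2 : n < a / (D * R) + 1 + L := by exact_mod_cast hnL
  have hpos : 0 < D * R := Nat.mul_pos hD hR
  refine ⟨D * R * n, ?_, ?_, ?_⟩
  · have e1 := hcor k fun i => p i ((D * R * n : ℕ) : ℤ)
    have e2 : ∀ i, (-P i).eval ((R : ℤ) * n) = -p i ((D * R * n : ℕ) : ℤ) := by
      intro i
      rw [Polynomial.eval_neg, (hP i).2]
      push_cast
      rw [mul_assoc]
    simp only [e2, Fintype.card_fin] at hn
    have e3 := pow_le_pow_left₀ (PolyConfig.upperDensity_nonneg Λ) hd (k + 1)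
    rw [Set.mem_ofPred_eq]
    linarith
  · have h1 := (Nat.lt_div_mul_add hpos (a := a)).le
    calc a ≤ a / (D * R) * (D * R) + D * R := h1
      _ = D * R * (a / (D * R) + 1) := by ring
      _ ≤ D * R * n := Nat.mul_le_mul_left _ hn1
  · have h1 : a / (D * R) * (D * R) ≤ a := Nat.div_mul_le_self a _
    calc D * R * n ≤ D * R * (a / (D * R) + 1 + L) := Nat.mul_le_mul_left _ hn2.le
      _ = a / (D * R) * (D * R) + D * R * (L + 1) := by ring
      _ ≤ a + D * R * (L + 1) := Nat.add_le_add_right h1 _
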